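/- For every automorphism φ of the spectral ball Ω there exists a sequence (φ_k) of automorphisms of Ω converging to φ uniformly on every compact subset of Ω, such that each φ_k is a finite composition of maps of the following four types: (a) the transposition x ↦ xᵗ; (b) Möbius maps x ↦ γ(x − αI)(I − \bar{α}x)⁻¹ with α ∈ ℂ, |α| < 1, and γ ∈ ℂ, |γ| = 1; (c) diagonal conjugations x ↦ d(x) x d(x)⁻¹ with d(x) = diag(a(x), a(x)⁻¹) for some holomorphic nowhere-vanishing a : Ω → ℂ∗, which are automorphisms of Ω; (d) triangular conjugations x ↦ t(x) x t(x)⁻¹ with t(x) the lower-triangular matrix having rows (1,0) and (b(x),1) for some holomorphic b : Ω → ℂ, which are automorphisms of Ω. -/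

import Mathlib

open Matrix Set

attribute [local instance] Matrix.normedAddCommGroup Matrix.normedSpace

noncomputable section

/-- The algebra of `2 × 2` complex matrices. -/
abbrev M2 : Type := Matrix (Fin 2) (Fin 2) ℂ

/-- The spectral ball: `2 × 2` complex matrices whose spectral radius is less than `1`. -/
def SpectralBall : Set M2 := {x : M2 | ∀ z ∈ spectrum ℂ x, ‖z‖ < 1}

/-- `f` is an automorphism of the domain `D`. -/
def IsAutomorphismOn {E : Type*} [NormedAddCommGroup E] [NormedSpace ℂ E]
    (D : Set E) (f : E → E) : Prop :=
  DifferentiableOn ℂ f D ∧ MapsTo f D D ∧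
    ∃ g : E → E, DifferentiableOn ℂ g D ∧ MapsTo g D D ∧
      (∀ x ∈ D, g (f x) = x) ∧ (∀ x ∈ D, f (g x) = x)

/-- The Möbius map `x ↦ γ (x - α I)(I - ᾱ x)⁻¹`. -/
def MobiusMap (α γ : ℂ) (x : M2) : M2 :=
  γ • ((x - α • (1 : M2)) * ((1 : M2) - (starRingEnd ℂ α) • x)⁻¹)

/-- The diagonal matrix `diag (a, a⁻¹)`. -/
def DiagMat (a : ℂ) : M2 := Matrix.diagonal ![a, a⁻¹]

/-- The lower triangular matrix with rows `(1, 0)` and `(b, 1)`. -/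
def TriMat (b : ℂ) : M2 := !![1, 0; b, 1]

/-- A generator: transposition, a Möbius map, a diagonal conjugation which is an automorphism
of the spectral ball, or a triangular conjugation which is an automorphism of the spectral
ball. -/
def IsGenerator (f : M2 → M2) : Prop :=
  (∀ x : M2, f x = xᵀ) ∨
  (∃ α γ : ℂ, ‖α‖ < 1 ∧ ‖γ‖ = 1 ∧ ∀ x : M2, f x = MobiusMap α γ x) ∨
  (∃ a : M2 → ℂ, DifferentiableOn ℂ a SpectralBall ∧ (∀ x ∈ SpectralBall, a x ≠ 0) ∧
    (∀ x ∈ SpectralBall, f x = DiagMat (a x) * x * (DiagMat (a x))⁻¹) ∧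
    IsAutomorphismOn SpectralBall f) ∨
  (∃ b : M2 → ℂ, DifferentiableOn ℂ b SpectralBall ∧
    (∀ x ∈ SpectralBall, f x = TriMat (b x) * x * (TriMat (b x))⁻¹) ∧
    IsAutomorphismOn SpectralBall f)

/-! ### The spectral ball -/

lemma differentiable_entry (i j : Fin 2) : Differentiable ℂ (fun x : M2 => x i j) :=
  differentiable_pi.1 (differentiable_pi.1 differentiable_id i) j

lemma DifferentiableOn.entry {E : Type*} [NormedAddCommGroup E] [NormedSpace ℂ E] {s : Set E}
    {f : E → M2} (hf : DifferentiableOn ℂ f s) (i j : Fin 2) :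
    DifferentiableOn ℂ (fun x => f x i j) s :=
  (differentiable_entry i j).comp_differentiableOn hf

lemma Differentiable.entry {E : Type*} [NormedAddCommGroup E] [NormedSpace ℂ E]
    {f : E → M2} (hf : Differentiable ℂ f) (i j : Fin 2) :
    Differentiable ℂ (fun x => f x i j) :=
  (differentiable_entry i j).comp hf

lemma differentiableOn_of_entry {E : Type*} [NormedAddCommGroup E] [NormedSpace ℂ E] {s : Set E}
    {f : E → M2} (hf : ∀ i j, DifferentiableOn ℂ (fun x => f x i j) s) :
    DifferentiableOn ℂ f s :=
  differentiableOn_pi.2 fun i => differentiableOn_pi.2 fun j => hf i j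

lemma differentiable_of_entry {E : Type*} [NormedAddCommGroup E] [NormedSpace ℂ E]
    {f : E → M2} (hf : ∀ i j, Differentiable ℂ (fun x => f x i j)) :
    Differentiable ℂ f :=
  differentiable_pi.2 fun i => differentiable_pi.2 fun j => hf i j

lemma exists_eigenvalues (x : M2) : ∃ a b : ℂ, x.trace = a + b ∧ x.det = a * b := by
  obtain ⟨s, hs⟩ := IsAlgClosed.exists_pow_nat_eq (x.trace ^ 2 - 4 * x.det) (n := 2) (by norm_num)
  refine ⟨(x.trace + s) / 2, (x.trace - s) / 2, by ring, ?_⟩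
  linear_combination (1 / 4 : ℂ) * hs

lemma mem_spectralBall_iff {x : M2} {a b : ℂ} (ht : x.trace = a + b) (hd : x.det = a * b) :
    x ∈ SpectralBall ↔ ‖a‖ < 1 ∧ ‖b‖ < 1 := by
  have key : ∀ z : ℂ, z ∈ spectrum ℂ x ↔ z = a ∨ z = b := by
    intro z
    rw [spectrum.mem_iff, Matrix.isUnit_iff_isUnit_det, isUnit_iff_ne_zero, not_not]
    have : (algebraMap ℂ M2 z - x).det = (z - a) * (z - b) := by
      rw [Matrix.trace_fin_two] at ht
      rw [Matrix.det_fin_two] at hd ⊢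
      simp [Matrix.algebraMap_matrix_apply]
      linear_combination hd - z * ht
    rw [this, mul_eq_zero, sub_eq_zero, sub_eq_zero]
  simp only [SpectralBall, Set.mem_ofPred_eq, key]
  constructor
  · intro h
    exact ⟨h a (Or.inl rfl), h b (Or.inr rfl)⟩
  · rintro ⟨h1, h2⟩ z (rfl | rfl) <;> assumption

lemma mem_spectralBall_congr {x y : M2} (ht : x.trace = y.trace) (hd : x.det = y.det) :
    x ∈ SpectralBall ↔ y ∈ SpectralBall := by
  obtain ⟨a, b, h1, h2⟩ := exists_eigenvalues x
  rw [mem_spectralBall_iff h1 h2, mem_spectralBall_iff (ht ▸ h1) (hd ▸ h2)]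

lemma mem_spectralBall_iff_ne_zero {x : M2} :
    x ∈ SpectralBall ↔ ∀ w ∈ Metric.closedBall (0 : ℂ) 1, 1 - x.trace * w + x.det * w ^ 2 ≠ 0 := by
  obtain ⟨a, b, h1, h2⟩ := exists_eigenvalues x
  rw [mem_spectralBall_iff h1 h2, h1, h2]
  have key : ∀ c : ℂ, ‖c‖ < 1 ↔ ∀ w ∈ Metric.closedBall (0 : ℂ) 1, 1 - c * w ≠ 0 := by
    intro c
    constructor
    · intro hc w hw h
      have h3 : ‖c * w‖ = 1 := by rw [← sub_eq_zero.1 h]; simp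
      rw [norm_mul] at h3
      have h4 : ‖w‖ ≤ 1 := by simpa using hw
      nlinarith [norm_nonneg c, norm_nonneg w]
    · intro h
      by_contra! hc
      have hc0 : c ≠ 0 := by rintro rfl; norm_num at hc
      refine h c⁻¹ ?_ (by field_simp; simp)
      simpa using inv_le_one_of_one_le₀ hc
  rw [key a, key b]
  constructor
  · rintro ⟨ha, hb⟩ w hw
    have := mul_ne_zero (ha w hw) (hb w hw)
    intro h
    exact this (by linear_combination h)
  · intro h
    refine ⟨fun w hw h0 => h w hw ?_, fun w hw h0 => h w hw ?_⟩
    · linear_combination (1 - b * w) * h0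
    · linear_combination (1 - a * w) * h0

lemma continuous_entry (i j : Fin 2) : Continuous (fun x : M2 => x i j) :=
  (differentiable_entry i j).continuous

@[fun_prop]
lemma differentiable_trace : Differentiable ℂ (fun x : M2 => x.trace) := by
  simp only [Matrix.trace_fin_two]; fun_prop

@[fun_prop]
lemma differentiable_det : Differentiable ℂ (fun x : M2 => x.det) := by
  simp only [Matrix.det_fin_two]; fun_prop

lemma isOpen_spectralBall : IsOpen SpectralBall := by
  rw [isOpen_iff_eventually]
  intro x hx
  rw [mem_spectralBall_iff_ne_zero] at hx
  have := (isCompact_closedBall (0 : ℂ) 1).eventually_forall_of_forall_eventually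
    (x₀ := x) (P := fun (y : M2) (w : ℂ) => 1 - y.trace * w + y.det * w ^ 2 ≠ 0) (by
      intro w hw
      have hc : Continuous fun p : M2 × ℂ => 1 - p.1.trace * p.2 + p.1.det * p.2 ^ 2 := by
        have h1 := differentiable_trace.continuous
        have h2 := differentiable_det.continuous
        fun_prop
      exact hc.continuousAt.eventually_ne (hx w hw))
  filter_upwards [this] with y hy
  exact mem_spectralBall_iff_ne_zero.2 hy

lemma smul_mem_spectralBall {x : M2} (hx : x ∈ SpectralBall) {t : ℂ} (ht : ‖t‖ ≤ 1) :
    t • x ∈ SpectralBall := by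
  obtain ⟨a, b, h1, h2⟩ := exists_eigenvalues x
  rw [mem_spectralBall_iff h1 h2] at hx
  rw [mem_spectralBall_iff (a := t * a) (b := t * b)]
  · simp only [norm_mul]
    constructor <;> nlinarith [norm_nonneg a, norm_nonneg b, norm_nonneg t]
  · rw [Matrix.trace_smul, h1, smul_eq_mul, mul_add]
  · rw [Matrix.det_smul, h2]; simp; ring

lemma norm_trace_lt {x : M2} (hx : x ∈ SpectralBall) : ‖x.trace‖ < 2 := by
  obtain ⟨a, b, h1, h2⟩ := exists_eigenvalues x
  rw [mem_spectralBall_iff h1 h2] at hx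
  rw [h1]
  linarith [norm_add_le a b]

lemma norm_det_lt {x : M2} (hx : x ∈ SpectralBall) : ‖x.det‖ < 1 := by
  obtain ⟨a, b, h1, h2⟩ := exists_eigenvalues x
  rw [mem_spectralBall_iff h1 h2] at hx
  rw [h2, norm_mul]
  nlinarith [norm_nonneg a, norm_nonneg b]

lemma zero_mem_spectralBall : (0 : M2) ∈ SpectralBall :=
  (mem_spectralBall_iff (a := 0) (b := 0) (by simp) (by simp)).2 (by simp)

lemma scalar_mem_spectralBall {c : ℂ} : c • (1 : M2) ∈ SpectralBall ↔ ‖c‖ < 1 := by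
  rw [mem_spectralBall_iff (a := c) (b := c) (by simp [mul_two])
    (by simp [sq]), and_self]

/-! ### Automorphisms -/

lemma isAutomorphismOn_id {E : Type*} [NormedAddCommGroup E] [NormedSpace ℂ E] (D : Set E) :
    IsAutomorphismOn D (id : E → E) :=
  ⟨differentiableOn_id, mapsTo_id D, id, differentiableOn_id, mapsTo_id D, fun _ _ => rfl,
    fun _ _ => rfl⟩

lemma IsAutomorphismOn.comp {E : Type*} [NormedAddCommGroup E] [NormedSpace ℂ E] {D : Set E}
    {f g : E → E} (hf : IsAutomorphismOn D f) (hg : IsAutomorphismOn D g) :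
    IsAutomorphismOn D (f ∘ g) := by
  obtain ⟨df, mf, f', df', mf', lf, rf⟩ := hf
  obtain ⟨dg, mg, g', dg', mg', lg, rg⟩ := hg
  refine ⟨df.comp dg mg, mf.comp mg, g' ∘ f', dg'.comp df' mf', mg'.comp mf', fun x hx => ?_,
    fun x hx => ?_⟩
  · simp [lf _ (mg hx), lg _ hx]
  · simp [rg _ (mf' hx), rf _ hx]

lemma IsAutomorphismOn.congr {E : Type*} [NormedAddCommGroup E] [NormedSpace ℂ E] {D : Set E}
    {f g : E → E} (hf : IsAutomorphismOn D f) (h : EqOn g f D) : IsAutomorphismOn D g := by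
  obtain ⟨df, mf, f', df', mf', lf, rf⟩ := hf
  refine ⟨df.congr h, mf.congr h.symm, f', df', mf', fun x hx => ?_, fun x hx => ?_⟩
  · rw [h hx, lf x hx]
  · rw [h (mf' hx), rf x hx]

/-- Entire maps preserving trace and determinant, with an inverse of the same kind, restrict to
automorphisms of the spectral ball. -/
lemma isAutomorphismOn_of_entire {f g : M2 → M2} (hf : Differentiable ℂ f) (hg : Differentiable ℂ g)
    (ht : ∀ x, (f x).trace = x.trace) (hd : ∀ x, (f x).det = x.det)
    (hgf : ∀ x, g (f x) = x) (hfg : ∀ x, f (g x) = x) : IsAutomorphismOn SpectralBall f := by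
  refine ⟨hf.differentiableOn, fun x hx => (mem_spectralBall_congr (ht x) (hd x)).2 hx, g,
    hg.differentiableOn, fun x hx => ?_, fun x _ => hgf x, fun x _ => hfg x⟩
  rwa [← mem_spectralBall_congr (ht (g x)) (hd (g x)), hfg]

/-! ### Möbius maps -/

lemma det_one_sub_smul (w : ℂ) (x : M2) :
    ((1 : M2) - w • x).det = 1 - x.trace * w + x.det * w ^ 2 := by
  simp [Matrix.det_fin_two, Matrix.trace_fin_two]; ring

lemma isUnit_det_one_sub_smul {x : M2} (hx : x ∈ SpectralBall) {w : ℂ} (hw : ‖w‖ ≤ 1) :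
    IsUnit ((1 : M2) - w • x).det := by
  rw [isUnit_iff_ne_zero, det_one_sub_smul]
  exact mem_spectralBall_iff_ne_zero.1 hx w (by simpa using hw)

lemma DifferentiableOn.matrix_mul {E : Type*} [NormedAddCommGroup E] [NormedSpace ℂ E] {s : Set E}
    {f g : E → M2} (hf : DifferentiableOn ℂ f s) (hg : DifferentiableOn ℂ g s) :
    DifferentiableOn ℂ (fun x => f x * g x) s := by
  refine differentiableOn_of_entry fun i j => ?_
  simp only [Matrix.mul_apply, Fin.sum_univ_two]
  exact ((hf.entry i 0).mul (hg.entry 0 j)).add ((hf.entry i 1).mul (hg.entry 1 j))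

lemma Differentiable.matrix_mul {E : Type*} [NormedAddCommGroup E] [NormedSpace ℂ E]
    {f g : E → M2} (hf : Differentiable ℂ f) (hg : Differentiable ℂ g) :
    Differentiable ℂ (fun x => f x * g x) := by
  rw [← differentiableOn_univ] at *
  exact hf.matrix_mul hg

lemma DifferentiableOn.matrix_inv {s : Set M2} {f : M2 → M2}
    (hf : DifferentiableOn ℂ f s) (h0 : ∀ x ∈ s, (f x).det ≠ 0) :
    DifferentiableOn ℂ (fun x => (f x)⁻¹) s := by
  have h1 : DifferentiableOn ℂ (fun x => (f x).det⁻¹) s := by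
    refine DifferentiableOn.inv ?_ h0
    exact differentiable_det.comp_differentiableOn hf
  have h2 : ∀ i j, DifferentiableOn ℂ (fun x => f x i j) s := fun i j => hf.entry i j
  refine differentiableOn_of_entry fun i j => ?_
  simp only [Matrix.inv_def, Ring.inverse_eq_inv', Matrix.smul_apply, smul_eq_mul,
    Matrix.adjugate_fin_two]
  refine h1.mul ?_
  fin_cases i <;> fin_cases j <;> simp <;> exact h2 _ _

lemma mobius_norm_lt {a α : ℂ} (ha : ‖a‖ < 1) (hα : ‖α‖ < 1) :
    1 - starRingEnd ℂ α * a ≠ 0 ∧ ‖(a - α) / (1 - starRingEnd ℂ α * a)‖ < 1 := by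
  have key : ‖a - α‖ ^ 2 + (1 - ‖a‖ ^ 2) * (1 - ‖α‖ ^ 2) = ‖1 - starRingEnd ℂ α * a‖ ^ 2 := by
    simp only [Complex.sq_norm, Complex.normSq_apply]
    simp
    ring
  have h1 : 0 < (1 - ‖a‖ ^ 2) * (1 - ‖α‖ ^ 2) := by
    apply mul_pos <;> nlinarith [norm_nonneg a, norm_nonneg α]
  have h2 : ‖a - α‖ < ‖1 - starRingEnd ℂ α * a‖ := by
    apply lt_of_pow_lt_pow_left₀ 2 (norm_nonneg _)
    linarith
  have h3 : 0 < ‖1 - starRingEnd ℂ α * a‖ := (norm_nonneg _).trans_lt h2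
  exact ⟨norm_pos_iff.1 h3, by rw [norm_div, div_lt_one h3]; exact h2⟩

lemma mobiusMap_mem {α γ : ℂ} (hα : ‖α‖ < 1) (hγ : ‖γ‖ = 1) {x : M2} (hx : x ∈ SpectralBall) :
    MobiusMap α γ x ∈ SpectralBall := by
  have hN := isUnit_det_one_sub_smul hx (w := starRingEnd ℂ α) (by simpa using hα.le)
  obtain ⟨a, b, ht, hd⟩ := exists_eigenvalues x
  obtain ⟨ha, hb⟩ := (mem_spectralBall_iff ht hd).1 hx
  obtain ⟨ha0, ha1⟩ := mobius_norm_lt ha hα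
  obtain ⟨hb0, hb1⟩ := mobius_norm_lt hb hα
  have hN' : ((1 : M2) - (starRingEnd ℂ α) • x).det
      = (1 - starRingEnd ℂ α * a) * (1 - starRingEnd ℂ α * b) := by
    rw [det_one_sub_smul, ht, hd]; ring
  rw [mem_spectralBall_iff (a := γ * ((a - α) / (1 - starRingEnd ℂ α * a)))
    (b := γ * ((b - α) / (1 - starRingEnd ℂ α * b)))]
  · simp only [norm_mul, hγ, one_mul]
    exact ⟨ha1, hb1⟩
  · rw [Matrix.trace_fin_two] at ht
    rw [Matrix.det_fin_two] at hd
    rw [MobiusMap, Matrix.inv_def, hN', Ring.inverse_eq_inv', Matrix.trace_smul,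
      Matrix.mul_smul, Matrix.trace_smul, ← mul_add, smul_eq_mul, smul_eq_mul]
    congr 1
    rw [div_add_div _ _ ha0 hb0, inv_mul_eq_div]
    congr 1
    simp [Matrix.adjugate_fin_two, Matrix.trace_fin_two, Matrix.mul_apply, Fin.sum_univ_two]
    linear_combination (1 + α * starRingEnd ℂ α) * ht - 2 * starRingEnd ℂ α * hd
  · have h1 : (x - α • (1 : M2)).det = (a - α) * (b - α) := by
      rw [Matrix.trace_fin_two] at ht
      rw [Matrix.det_fin_two] at hd ⊢
      simp
      linear_combination hd - α * ht
    rw [MobiusMap, Matrix.det_smul, Matrix.det_mul, Matrix.det_nonsing_inv, hN', h1,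
      Ring.inverse_eq_inv']
    simp
    field_simp

lemma differentiableOn_mobiusMap {α γ : ℂ} (hα : ‖α‖ < 1) :
    DifferentiableOn ℂ (MobiusMap α γ) SpectralBall := by
  refine DifferentiableOn.const_smul (DifferentiableOn.matrix_mul (by fun_prop) ?_) γ
  refine DifferentiableOn.matrix_inv (by fun_prop) fun x hx => ?_
  exact (isUnit_det_one_sub_smul hx (w := starRingEnd ℂ α) (by simpa using hα.le)).ne_zero

lemma mobiusMap_inverse {α γ : ℂ} (hα : ‖α‖ < 1) (hγ : ‖γ‖ = 1) {x : M2} (hx : x ∈ SpectralBall) :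
    MobiusMap (-(α * γ)) (starRingEnd ℂ γ) (MobiusMap α γ x) = x := by
  have hN := isUnit_det_one_sub_smul hx (w := starRingEnd ℂ α) (by simpa using hα.le)
  have hγγ : starRingEnd ℂ γ * γ = 1 := by
    rw [mul_comm, Complex.mul_conj, Complex.normSq_eq_norm_sq, hγ]; simp
  set N : M2 := 1 - (starRingEnd ℂ α) • x with hNdef
  have hNN : N * N⁻¹ = 1 := Matrix.mul_nonsing_inv N hN
  have hNN' : N⁻¹ * N = 1 := Matrix.nonsing_inv_mul N hN
  set c : ℂ := 1 - α * starRingEnd ℂ α with hc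
  have hc0 : c ≠ 0 := by
    rw [hc, Complex.mul_conj, Complex.normSq_eq_norm_sq]
    have : (1 - ‖α‖ ^ 2 : ℝ) ≠ 0 := by nlinarith [norm_nonneg α]
    exact_mod_cast this
  have h1 : MobiusMap α γ x - (-(α * γ)) • (1 : M2) = (γ * c) • (x * N⁻¹) := by
    have : (γ * c) • (x * N⁻¹) = (γ • ((x - α • (1 : M2)) + α • N)) * N⁻¹ := by
      rw [← Matrix.smul_mul]; congr 1
      rw [hNdef, hc]
      ext i j
      simp
      ring
    rw [this, smul_add, add_mul, smul_mul_assoc, smul_mul_assoc, smul_mul_assoc, hNN, MobiusMap,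
      ← hNdef]
    simp [sub_eq_add_neg, smul_smul, mul_comm]
  have h2 : (1 : M2) - (starRingEnd ℂ (-(α * γ))) • MobiusMap α γ x = c • N⁻¹ := by
    have : c • N⁻¹ = (N + (starRingEnd ℂ α) • (x - α • (1 : M2))) * N⁻¹ := by
      have e : N + (starRingEnd ℂ α) • (x - α • (1 : M2)) = c • (1 : M2) := by
        rw [hNdef, hc]
        ext i j
        simp
        ring
      rw [e, Matrix.smul_mul, one_mul]
    rw [this, add_mul, hNN, MobiusMap, ← hNdef, smul_smul, smul_mul_assoc, map_neg, map_mul, neg_mul,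
      mul_assoc, hγγ]
    simp
  rw [MobiusMap, h1, h2]
  have h3 : (c • N⁻¹)⁻¹ = c⁻¹ • N := by
    apply Matrix.inv_eq_right_inv
    rw [Matrix.smul_mul, Matrix.mul_smul, hNN', smul_smul, mul_inv_cancel₀ hc0, one_smul]
  rw [h3, Matrix.smul_mul, Matrix.mul_smul, mul_assoc, hNN', smul_smul, smul_smul, mul_one]
  have : starRingEnd ℂ γ * (γ * c) * c⁻¹ = 1 := by
    rw [← mul_assoc, hγγ, one_mul, mul_inv_cancel₀ hc0]
  rw [this, one_smul]

lemma isAutomorphismOn_mobiusMap {α γ : ℂ} (hα : ‖α‖ < 1) (hγ : ‖γ‖ = 1) :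
    IsAutomorphismOn SpectralBall (MobiusMap α γ) := by
  have h1 : ‖-(α * γ)‖ < 1 := by rw [norm_neg, norm_mul, hγ, mul_one]; exact hα
  have h2 : ‖starRingEnd ℂ γ‖ = 1 := by simpa using hγ
  have hγγ : γ * starRingEnd ℂ γ = 1 := by
    rw [Complex.mul_conj, Complex.normSq_eq_norm_sq, hγ]; simp
  refine ⟨differentiableOn_mobiusMap hα, fun x hx => mobiusMap_mem hα hγ hx,
    MobiusMap (-(α * γ)) (starRingEnd ℂ γ), differentiableOn_mobiusMap h1,
    fun x hx => mobiusMap_mem h1 h2 hx, fun x hx => mobiusMap_inverse hα hγ hx, fun x hx => ?_⟩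
  have := mobiusMap_inverse h1 h2 hx
  rwa [neg_mul, neg_neg, mul_assoc, hγγ, mul_one, Complex.conj_conj] at this

/-! ### The group generated by the generators -/

lemma isAutomorphismOn_transpose : IsAutomorphismOn SpectralBall (fun x : M2 => xᵀ) := by
  have h : Differentiable ℂ (fun x : M2 => xᵀ) :=
    differentiable_of_entry fun i j => differentiable_entry j i
  exact isAutomorphismOn_of_entire h h Matrix.trace_transpose Matrix.det_transpose
    Matrix.transpose_transpose Matrix.transpose_transpose

lemma IsGenerator.isAutomorphismOn {f : M2 → M2} (hf : IsGenerator f) :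
    IsAutomorphismOn SpectralBall f := by
  rcases hf with h | ⟨α, γ, hα, hγ, h⟩ | ⟨-, -, -, -, h⟩ | ⟨-, -, -, h⟩
  · exact isAutomorphismOn_transpose.congr fun x _ => h x
  · exact (isAutomorphismOn_mobiusMap hα hγ).congr fun x _ => h x
  · exact h
  · exact h

/-- `f` agrees on the spectral ball with a finite composition of generators. -/
def IsGenerated (f : M2 → M2) : Prop :=
  ∃ L : List (M2 → M2), (∀ g ∈ L, IsGenerator g) ∧ EqOn f (L.foldr (· ∘ ·) id) SpectralBall

lemma isAutomorphismOn_foldr {L : List (M2 → M2)} (hL : ∀ g ∈ L, IsGenerator g) :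
    IsAutomorphismOn SpectralBall (L.foldr (· ∘ ·) id) := by
  induction L with
  | nil => exact isAutomorphismOn_id _
  | cons g L ih =>
    exact (hL g (by simp)).isAutomorphismOn.comp (ih fun g' hg' => hL g' (by simp [hg']))

lemma IsGenerated.isAutomorphismOn {f : M2 → M2} (hf : IsGenerated f) :
    IsAutomorphismOn SpectralBall f := by
  obtain ⟨L, hL, h⟩ := hf
  exact (isAutomorphismOn_foldr hL).congr h

lemma isGenerated_id : IsGenerated id := ⟨[], by simp, fun _ _ => rfl⟩

lemma IsGenerator.isGenerated {f : M2 → M2} (hf : IsGenerator f) : IsGenerated f :=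
  ⟨[f], by simpa using hf, fun _ _ => rfl⟩

lemma IsGenerated.congr {f g : M2 → M2} (hf : IsGenerated f) (h : EqOn g f SpectralBall) :
    IsGenerated g := by
  obtain ⟨L, hL, hfL⟩ := hf
  exact ⟨L, hL, h.trans hfL⟩

lemma IsGenerated.comp {f g : M2 → M2} (hf : IsGenerated f) (hg : IsGenerated g) :
    IsGenerated (f ∘ g) := by
  have hgm := hg.isAutomorphismOn.2.1
  obtain ⟨L, hL, hfL⟩ := hf
  obtain ⟨L', hL', hgL'⟩ := hg
  refine ⟨L ++ L', fun g hg => ?_, fun x hx => ?_⟩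
  · rcases List.mem_append.1 hg with h | h
    · exact hL g h
    · exact hL' g h
  · have key : ∀ l : List (M2 → M2), (l ++ L').foldr (· ∘ ·) id
        = l.foldr (· ∘ ·) id ∘ L'.foldr (· ∘ ·) id := by
      intro l
      induction l with
      | nil => rfl
      | cons a l ih => simp only [List.cons_append, List.foldr_cons, ih]; rfl
    rw [key, Function.comp_apply, hfL (hgm hx), hgL' hx, Function.comp_apply]

lemma isGenerated_transpose : IsGenerated (fun x : M2 => xᵀ) :=
  IsGenerator.isGenerated (Or.inl fun _ => rfl)

lemma isGenerated_mobiusMap {α γ : ℂ} (hα : ‖α‖ < 1) (hγ : ‖γ‖ = 1) :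
    IsGenerated (MobiusMap α γ) :=
  IsGenerator.isGenerated (Or.inr (Or.inl ⟨α, γ, hα, hγ, fun _ => rfl⟩))

lemma TriMat_mul_neg (b : ℂ) : TriMat b * TriMat (-b) = 1 := by
  ext i j; fin_cases i <;> fin_cases j <;> simp [TriMat, Matrix.mul_apply, Fin.sum_univ_two]

lemma TriMat_inv (b : ℂ) : (TriMat b)⁻¹ = TriMat (-b) :=
  Matrix.inv_eq_right_inv (TriMat_mul_neg b)

lemma triConj_eq (b : ℂ) (x : M2) : TriMat b * x * (TriMat b)⁻¹ =
    !![x 0 0 - b * x 0 1, x 0 1;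
      x 1 0 + b * (x 0 0 - x 1 1) - b ^ 2 * x 0 1, x 1 1 + b * x 0 1] := by
  rw [TriMat_inv]
  ext i j; fin_cases i <;> fin_cases j <;>
    simp [TriMat, Matrix.mul_apply, Matrix.vecMul, dotProduct, Fin.sum_univ_two] <;> ring

/-- The triangular conjugation by `b` has the triangular conjugation by `c` as an inverse as soon as
`b` and `c` cancel along the orbits. -/
lemma isGenerated_triConj {b c : M2 → ℂ} (hb : Differentiable ℂ b) (hc : Differentiable ℂ c)
    (hbc : ∀ x, c (TriMat (b x) * x * (TriMat (b x))⁻¹) = -b x)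
    (hcb : ∀ x, b (TriMat (c x) * x * (TriMat (c x))⁻¹) = -c x) :
    IsGenerated (fun x => TriMat (b x) * x * (TriMat (b x))⁻¹) := by
  have hdiff : ∀ b : M2 → ℂ, Differentiable ℂ b →
      Differentiable ℂ (fun x => TriMat (b x) * x * (TriMat (b x))⁻¹) := by
    intro b hb
    refine differentiable_of_entry fun i j => ?_
    simp only [triConj_eq]
    fin_cases i <;> fin_cases j <;> simp <;> fun_prop
  have hinv : ∀ (s : ℂ) (x : M2), TriMat (-s) * (TriMat s * x * (TriMat s)⁻¹) * (TriMat (-s))⁻¹ = x := by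
    intro s x
    have h1 := TriMat_mul_neg (-s)
    rw [neg_neg] at h1
    rw [TriMat_inv, TriMat_inv, neg_neg, ← mul_assoc, ← mul_assoc, h1, one_mul, mul_assoc, h1, mul_one]
  have hunit : ∀ s : ℂ, IsUnit (TriMat s).det := fun s => by simp [TriMat]
  refine IsGenerator.isGenerated (Or.inr (Or.inr (Or.inr ⟨b, hb.differentiableOn, fun x _ => rfl, ?_⟩)))
  refine isAutomorphismOn_of_entire (hdiff b hb) (hdiff c hc) (fun x => ?_) (fun x => ?_) (fun x => ?_)
    fun x => ?_
  · rw [Matrix.trace_mul_comm, ← mul_assoc, Matrix.nonsing_inv_mul _ (hunit _), one_mul]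
  · rw [Matrix.det_mul, Matrix.det_mul, mul_right_comm, ← Matrix.det_mul,
      Matrix.mul_nonsing_inv _ (hunit _), Matrix.det_one, one_mul]
  · simp only [hbc, hinv]
  · simp only [hcb, hinv]

lemma isGenerated_diagConj {a : ℂ} (ha : a ≠ 0) :
    IsGenerated (fun x => DiagMat a * x * (DiagMat a)⁻¹) := by
  have hunit : IsUnit (DiagMat a).det := by simp [DiagMat, ha]
  have hd : ∀ A B : M2, Differentiable ℂ (fun x : M2 => A * x * B) := fun A B =>
    ((differentiable_const A).matrix_mul differentiable_id).matrix_mul (differentiable_const B)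
  refine IsGenerator.isGenerated (Or.inr (Or.inr (Or.inl ⟨fun _ => a, differentiableOn_const a,
    fun _ _ => ha, fun _ _ => rfl, ?_⟩)))
  refine isAutomorphismOn_of_entire (g := fun x => (DiagMat a)⁻¹ * x * DiagMat a) (hd _ _) (hd _ _)
    (fun x => ?_) (fun x => ?_) (fun x => ?_) fun x => ?_
  · rw [Matrix.trace_mul_comm, ← mul_assoc, Matrix.nonsing_inv_mul _ hunit, one_mul]
  · rw [Matrix.det_mul, Matrix.det_mul, mul_right_comm, ← Matrix.det_mul,
      Matrix.mul_nonsing_inv _ hunit, Matrix.det_one, one_mul]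
  · simp only [← mul_assoc, Matrix.nonsing_inv_mul _ hunit, one_mul]
    rw [mul_assoc, Matrix.nonsing_inv_mul _ hunit, mul_one]
  · simp only [← mul_assoc, Matrix.mul_nonsing_inv _ hunit, one_mul]
    rw [mul_assoc, Matrix.mul_nonsing_inv _ hunit, mul_one]

/-- Conjugation by a constant invertible matrix is generated. -/
lemma isGenerated_conj {g : M2} (hg : g.det ≠ 0) : IsGenerated (fun x => g * x * g⁻¹) := by
  have hlow : ∀ c : ℂ, IsGenerated (fun x => TriMat c * x * (TriMat c)⁻¹) := fun c =>
    isGenerated_triConj (b := fun _ => c) (c := fun _ => -c) (by fun_prop) (by fun_prop)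
      (fun _ => rfl) (fun _ => by simp)
  refine Matrix.diagonal_transvection_induction_of_det_ne_zero
    (fun g : M2 => IsGenerated (fun x => g * x * g⁻¹)) g hg ?_ ?_ ?_
  · intro D hD
    rw [Matrix.det_diagonal, Fin.prod_univ_two] at hD
    have h0 : D 0 ≠ 0 := left_ne_zero_of_mul hD
    have h1 : D 1 ≠ 0 := right_ne_zero_of_mul hD
    obtain ⟨a, ha⟩ := IsAlgClosed.exists_pow_nat_eq (D 0 / D 1) (n := 2) (by norm_num)
    have ha0 : a ≠ 0 := by
      rintro rfl
      have := div_ne_zero h0 h1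
      simp at ha
      tauto
    have hD' : Matrix.diagonal D = (D 1 * a) • DiagMat a := by
      have h2 : D 0 = D 1 * a * a := by rw [mul_assoc, ← sq, ha]; field_simp
      ext i j
      fin_cases i <;> fin_cases j <;> simp [DiagMat, h2, ha0]
    refine (isGenerated_diagConj ha0).congr fun x _ => ?_
    have hDi : (Matrix.diagonal D)⁻¹ = (D 1 * a)⁻¹ • (DiagMat a)⁻¹ := by
      apply Matrix.inv_eq_right_inv
      have hunit : IsUnit (DiagMat a).det := by simp [DiagMat, ha0]
      rw [hD', Matrix.smul_mul, Matrix.mul_smul, Matrix.mul_nonsing_inv _ hunit, smul_smul,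
        mul_inv_cancel₀ (mul_ne_zero h1 ha0), one_smul]
    simp only
    rw [hDi, hD', Matrix.smul_mul, Matrix.smul_mul, Matrix.mul_smul, smul_smul,
      mul_inv_cancel₀ (mul_ne_zero h1 ha0), one_smul]
  · rintro ⟨i, j, hij, c⟩
    have hT : ∀ c : ℂ, (TriMat c)ᵀ = !![1, c; 0, 1] := fun c => by
      ext i j; fin_cases i <;> fin_cases j <;> simp [TriMat]
    fin_cases i <;> fin_cases j
    · exact absurd rfl hij
    · have h1 : TransvectionStruct.toMatrix ⟨0, 1, hij, c⟩ = (TriMat c)ᵀ := by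
        rw [hT, TransvectionStruct.toMatrix_mk]
        ext i j; fin_cases i <;> fin_cases j <;> simp [transvection]
      have h2 := (isGenerated_transpose.comp (hlow (-c))).comp isGenerated_transpose
      refine h2.congr fun x _ => ?_
      simp only [Function.comp_apply]
      erw [h1]
      rw [← Matrix.transpose_nonsing_inv, TriMat_inv, TriMat_inv, neg_neg, Matrix.transpose_mul,
        Matrix.transpose_mul, Matrix.transpose_transpose, mul_assoc]
    · have h1 : TransvectionStruct.toMatrix ⟨1, 0, hij, c⟩ = TriMat c := by
        rw [TransvectionStruct.toMatrix_mk]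
        ext i j; fin_cases i <;> fin_cases j <;> simp [transvection, TriMat]
      refine (hlow c).congr fun x _ => ?_
      simp only
      erw [h1]
    · exact absurd rfl hij
  · intro A B _ _ hA hB
    refine (hA.comp hB).congr fun x _ => ?_
    simp only [Function.comp_apply, Matrix.mul_inv_rev, mul_assoc]

/-! ### Vector fields integrated to first order by generated maps -/

/-- The vector fields `W` for which there is an entire family `F τ` of generated maps with
`F τ x = x + τ W x + O(τ²)`. -/
def flowFields : Submodule ℂ (M2 → M2) where
  carrier := {W | ∃ F : ℂ × M2 → M2, Differentiable ℂ F ∧ (∀ x, F (0, x) = x) ∧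
    (∀ x, HasDerivAt (fun τ => F (τ, x)) (W x) 0) ∧ ∀ τ, IsGenerated (fun x => F (τ, x))}
  zero_mem' := ⟨fun p => p.2, differentiable_snd, fun _ => rfl, fun x => hasDerivAt_const _ _,
    fun _ => isGenerated_id⟩
  add_mem' := by
    rintro V W ⟨F, hF, hF0, hFd, hFg⟩ ⟨G, hG, hG0, hGd, hGg⟩
    refine ⟨fun p => F (p.1, G p), hF.comp (differentiable_fst.prodMk hG), fun x => by
      simp [hF0, hG0], fun x => ?_, fun τ => (hFg τ).comp (hGg τ)⟩
    have h1 : HasFDerivAt F (fderiv ℂ F (0, x)) (0, G (0, x)) := by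
      rw [hG0]; exact (hF _).hasFDerivAt
    have h2 := h1.comp_hasDerivAt (0 : ℂ) ((hasDerivAt_id (0 : ℂ)).prodMk (hGd x))
    have h3 : HasDerivAt (fun τ => F (τ, x)) (fderiv ℂ F (0, x) (1, 0)) 0 :=
      (hF _).hasFDerivAt.comp_hasDerivAt (0 : ℂ)
        ((hasDerivAt_id (0 : ℂ)).prodMk (hasDerivAt_const (0 : ℂ) x))
    have h4 : HasFDerivAt (fun y => F (0, y)) ((fderiv ℂ F (0, x)).comp
        (ContinuousLinearMap.inr ℂ ℂ M2)) x :=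
      (hF _).hasFDerivAt.comp x (hasFDerivAt_prodMk_right (0 : ℂ) x)
    have h5 : (fderiv ℂ F (0, x)).comp (ContinuousLinearMap.inr ℂ ℂ M2)
        = ContinuousLinearMap.id ℂ M2 := by
      refine h4.unique ?_
      simp only [hF0]
      exact hasFDerivAt_id x
    have h6 : fderiv ℂ F (0, x) (1, W x) = V x + W x := by
      have : ((1 : ℂ), W x) = (1, 0) + (0, W x) := by simp
      rw [this, map_add, h3.unique (hFd x)]
      congr 1
      exact congrArg (fun L : M2 →L[ℂ] M2 => L (W x)) h5
    exact h2.congr_deriv h6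
  smul_mem' := by
    rintro c W ⟨F, hF, hF0, hFd, hFg⟩
    refine ⟨fun p => F (c * p.1, p.2), hF.comp (by fun_prop), fun x => by simp [hF0],
      fun x => ?_, fun τ => hFg (c * τ)⟩
    have h1 : HasDerivAt (fun τ => F (τ, x)) (W x) (c * 0) := by simpa using hFd x
    have h2 := h1.scomp (0 : ℂ) ((hasDerivAt_id (0 : ℂ)).const_mul c)
    simp only [Function.comp_def, mul_one] at h2
    exact h2

/-- Functions of the trace and the determinant. -/
def IsSpectralInvariant (I : M2 → ℂ) : Prop :=
  Differentiable ℂ I ∧ ∀ x y : M2, x.trace = y.trace → x.det = y.det → I x = I y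

lemma IsSpectralInvariant.mul {I J : M2 → ℂ} (hI : IsSpectralInvariant I) (hJ : IsSpectralInvariant J) :
    IsSpectralInvariant (I * J) :=
  ⟨hI.1.mul hJ.1, fun x y ht hd => by simp [hI.2 x y ht hd, hJ.2 x y ht hd]⟩

lemma isInvariant_one : IsSpectralInvariant 1 := ⟨differentiable_const _, fun _ _ _ _ => rfl⟩

lemma isInvariant_trace : IsSpectralInvariant (fun x => x.trace) :=
  ⟨differentiable_trace, fun _ _ h _ => h⟩

lemma isInvariant_disc : IsSpectralInvariant (fun x => x.trace ^ 2 - 4 * x.det) :=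
  ⟨by fun_prop, fun _ _ h h' => by simp [h, h']⟩

/-- The vector fields all of whose multiples by invariant functions are in `flowFields`. -/
def invFlowFields : Submodule ℂ (M2 → M2) where
  carrier := {W | ∀ I, IsSpectralInvariant I → (fun x => I x • W x) ∈ flowFields}
  zero_mem' I _ := by
    simp only [Pi.zero_apply, smul_zero]
    exact flowFields.zero_mem
  add_mem' := by
    intro V W hV hW I hI
    simpa [Pi.add_def] using flowFields.add_mem (hV I hI) (hW I hI)
  smul_mem' := by
    intro c W hW I hI
    have := flowFields.smul_mem c (hW I hI)
    simpa [Pi.smul_def, smul_comm c] using this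

lemma invFlowFields_le : invFlowFields ≤ flowFields := by
  intro W hW
  simpa using hW 1 isInvariant_one

lemma inv_smul_mem {W : M2 → M2} (hW : W ∈ invFlowFields) {I : M2 → ℂ} (hI : IsSpectralInvariant I) :
    (fun x => I x • W x) ∈ invFlowFields := by
  intro J hJ
  simpa [smul_smul] using hW _ (hJ.mul hI)

lemma trace_conj_inv {g : M2} (hg : g.det ≠ 0) (x : M2) : (g * x * g⁻¹).trace = x.trace := by
  rw [Matrix.trace_mul_comm, ← mul_assoc, Matrix.nonsing_inv_mul _ hg.isUnit, one_mul]

lemma det_conj_inv {g : M2} (hg : g.det ≠ 0) (x : M2) : (g * x * g⁻¹).det = x.det := by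
  rw [Matrix.det_mul, Matrix.det_mul, mul_right_comm, ← Matrix.det_mul,
      Matrix.mul_nonsing_inv _ hg.isUnit, Matrix.det_one, one_mul]

lemma conj_mem {W : M2 → M2} (hW : W ∈ invFlowFields) {g : M2} (hg : g.det ≠ 0) :
    (fun x => g * W (g⁻¹ * x * g) * g⁻¹) ∈ invFlowFields := by
  intro I hI
  have hg' : g⁻¹.det ≠ 0 := by simpa [Matrix.det_nonsing_inv] using hg
  have hgi : g⁻¹⁻¹ = g := Matrix.nonsing_inv_nonsing_inv _ hg.isUnit
  obtain ⟨F, hF, hF0, hFd, hFg⟩ := hW I hI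
  have hd : ∀ A B : M2, Differentiable ℂ (fun x : M2 => A * x * B) := fun A B =>
    ((differentiable_const A).matrix_mul differentiable_id).matrix_mul (differentiable_const B)
  refine ⟨fun p => g * F (p.1, g⁻¹ * p.2 * g) * g⁻¹, ?_, fun x => ?_, fun x => ?_, fun τ => ?_⟩
  · exact (hd _ _).comp (hF.comp (differentiable_fst.prodMk ((hd _ _).comp differentiable_snd)))
  · beta_reduce
    rw [hF0]
    simp only [← mul_assoc, Matrix.mul_nonsing_inv _ hg.isUnit, one_mul]
    rw [mul_assoc, Matrix.mul_nonsing_inv _ hg.isUnit, mul_one]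
  · have hI' : I x = I (g⁻¹ * x * g) := by
      refine (hI.2 _ _ ?_ ?_).symm
      · have := trace_conj_inv hg' x
        rwa [hgi] at this
      · have := det_conj_inv hg' x
        rwa [hgi] at this
    let L : M2 →L[ℂ] M2 := LinearMap.toContinuousLinearMap
      ((LinearMap.mulLeft ℂ g).comp (LinearMap.mulRight ℂ g⁻¹))
    have h1 := L.hasFDerivAt.comp_hasDerivAt (0 : ℂ) (hFd (g⁻¹ * x * g))
    have hL : ∀ y, L y = g * y * g⁻¹ := fun y => by simp [L, mul_assoc]
    simp only [Function.comp_def, hL] at h1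
    beta_reduce
    rw [hI']
    exact h1.congr_deriv ((hL _).trans (by rw [mul_smul_comm, smul_mul_assoc]))
  · refine (((isGenerated_conj hg).comp (hFg τ)).comp (isGenerated_conj hg')).congr fun x _ => ?_
    simp [hgi]

/-! ### Shear and overshear fields -/

/-- The linear vector field of the lower triangular conjugations. -/
def lowField (x : M2) : M2 := !![-x 0 1, 0; x 0 0 - x 1 1, x 0 1]

lemma hasDerivAt_of_entry {f : ℂ → M2} {f' : M2} {t : ℂ}
    (h : ∀ i j, HasDerivAt (fun s => f s i j) (f' i j) t) : HasDerivAt f f' t :=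
  hasDerivAt_pi.2 fun i => hasDerivAt_pi.2 fun j => h i j

lemma smul_lowField_mem_flowFields {b : ℂ × M2 → ℂ} {β : M2 → ℂ} (hb : Differentiable ℂ b)
    (h0 : ∀ x, b (0, x) = 0) (hβ : ∀ x, HasDerivAt (fun τ => b (τ, x)) (β x) 0)
    (hg : ∀ τ, IsGenerated (fun x => TriMat (b (τ, x)) * x * (TriMat (b (τ, x)))⁻¹)) :
    (fun x => β x • lowField x) ∈ flowFields := by
  refine ⟨fun p => TriMat (b p) * p.2 * (TriMat (b p))⁻¹, ?_, fun x => ?_, fun x => ?_, hg⟩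
  · refine differentiable_of_entry fun i j => ?_
    have h2 : ∀ i j, Differentiable ℂ (fun p : ℂ × M2 => p.2 i j) := fun i j =>
      (differentiable_entry i j).comp differentiable_snd
    have h00 := h2 0 0
    have h01 := h2 0 1
    have h10 := h2 1 0
    have h11 := h2 1 1
    simp only [triConj_eq]
    fin_cases i <;> fin_cases j <;> simp <;> fun_prop
  · simp only [h0, triConj_eq]
    ext i j; fin_cases i <;> fin_cases j <;> simp
  · refine hasDerivAt_of_entry fun i j => ?_
    have hb1 := hβ x
    have hb2 := (hβ x).pow 2
    simp only [triConj_eq]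
    fin_cases i <;> fin_cases j <;> simp [lowField]
    · simpa using (hb1.mul_const (x 0 1)).const_sub (x 0 0)
    · exact hasDerivAt_const _ _
    · simpa [h0, Pi.sub_def, Pi.pow_def] using
        ((hb1.mul_const (x 0 0 - x 1 1)).const_add (x 1 0)).sub (hb2.mul_const (x 0 1))
    · simpa using (hb1.mul_const (x 0 1)).const_add (x 1 1)

lemma invariant_triConj {I : M2 → ℂ} (hI : IsSpectralInvariant I) (c : ℂ) (x : M2) :
    I (TriMat c * x * (TriMat c)⁻¹) = I x :=
  hI.2 _ _ (trace_conj_inv (by simp [TriMat, Matrix.det_fin_two]) x) (det_conj_inv (by simp [TriMat, Matrix.det_fin_two]) x)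

lemma shear_mem (d : ℕ) : (fun x => (x 0 1) ^ d • lowField x) ∈ invFlowFields := by
  intro I hI
  have key := hI.1
  have hd : ∀ τ : ℂ, Differentiable ℂ (fun x : M2 => τ * (I x * x 0 1 ^ d)) := fun τ => by fun_prop
  have h2 : Differentiable ℂ (fun p : ℂ × M2 => I p.2 * p.2 0 1 ^ d) :=
    (show Differentiable ℂ (fun x : M2 => I x * x 0 1 ^ d) by fun_prop).comp differentiable_snd
  have := smul_lowField_mem_flowFields (b := fun p => p.1 * (I p.2 * p.2 0 1 ^ d))
    (β := fun x => I x * x 0 1 ^ d) (differentiable_fst.mul h2) (by simp)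
    (fun x => by simpa using (hasDerivAt_id (0 : ℂ)).mul_const (I x * x 0 1 ^ d))
    (fun τ => isGenerated_triConj (hd τ) (hd (-τ)) (fun x => by
      rw [invariant_triConj hI, triConj_eq]; simp) (fun x => by
      rw [invariant_triConj hI, triConj_eq]; simp))
  simpa [smul_smul] using this

/-- The entire function `(1 - exp (-w)) / w`. -/
def expQuot (w : ℂ) : ℂ := dslope (fun z => 1 - Complex.exp (-z)) 0 w

lemma differentiable_expQuot : Differentiable ℂ expQuot := by
  have : DifferentiableOn ℂ (dslope (fun z => 1 - Complex.exp (-z)) 0) univ :=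
    (Complex.differentiableOn_dslope Filter.univ_mem).2 (by fun_prop)
  exact differentiableOn_univ.1 this

lemma mul_expQuot (w : ℂ) : w * expQuot w = 1 - Complex.exp (-w) := by
  have := sub_smul_dslope (fun z => 1 - Complex.exp (-z)) 0 w
  simpa [expQuot] using this

lemma expQuot_zero : expQuot 0 = 1 := by
  have h : HasDerivAt (fun z : ℂ => 1 - Complex.exp (-z)) 1 0 := by
    simpa using ((hasDerivAt_neg (0 : ℂ)).cexp).const_sub 1
  rw [expQuot, dslope_same, h.deriv]

lemma expQuot_neg (w : ℂ) : Complex.exp (-w) * expQuot (-w) = expQuot w := by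
  by_cases hw : w = 0
  · simp [hw]
  · apply mul_left_cancel₀ hw
    have h1 := mul_expQuot w
    have h2 := mul_expQuot (-w)
    rw [neg_neg] at h2
    have h3 : Complex.exp (-w) * Complex.exp w = 1 := by rw [← Complex.exp_add]; simp
    linear_combination -Complex.exp (-w) * h2 - h1 + h3

lemma overshear_mem (d : ℕ) :
    (fun x => ((x 0 1) ^ d * (x 0 0 - x 1 1)) • lowField x) ∈ invFlowFields := by
  intro I hI
  have key := hI.1
  have kE := differentiable_expQuot
  let b : ℂ × M2 → ℂ := fun p => p.1 * ((p.2 0 0 - p.2 1 1) * (I p.2 * p.2 0 1 ^ d)) *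
    expQuot (2 * p.1 * (I p.2 * p.2 0 1 ^ (d + 1)))
  have hb : Differentiable ℂ b := by
    have h00 : Differentiable ℂ (fun p : ℂ × M2 => p.2 0 0) :=
      (differentiable_entry 0 0).comp differentiable_snd
    have h01 : Differentiable ℂ (fun p : ℂ × M2 => p.2 0 1) :=
      (differentiable_entry 0 1).comp differentiable_snd
    have h11 : Differentiable ℂ (fun p : ℂ × M2 => p.2 1 1) :=
      (differentiable_entry 1 1).comp differentiable_snd
    have hI2 : Differentiable ℂ (fun p : ℂ × M2 => I p.2) := key.comp differentiable_snd
    have hE : Differentiable ℂ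
        (fun p : ℂ × M2 => expQuot (2 * p.1 * (I p.2 * p.2 0 1 ^ (d + 1)))) :=
      kE.comp (by fun_prop)
    exact Differentiable.mul (by fun_prop) hE
  have hbτ : ∀ τ : ℂ, Differentiable ℂ (fun x => b (τ, x)) := fun τ =>
    hb.comp ((differentiable_const τ).prodMk differentiable_id)
  have hcancel : ∀ (τ : ℂ) (x : M2),
      b (-τ, TriMat (b (τ, x)) * x * (TriMat (b (τ, x)))⁻¹) = -b (τ, x) := by
    intro τ x
    simp only [b, invariant_triConj hI]
    simp only [triConj_eq]
    simp only [Matrix.of_apply, Matrix.cons_val', Matrix.cons_val_zero, Matrix.cons_val_one,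
      Matrix.cons_val_fin_one]
    set w : ℂ := 2 * τ * (I x * x 0 1 ^ (d + 1)) with hw
    have h1 := mul_expQuot w
    have h2 := expQuot_neg w
    have h3 : 2 * -τ * (I x * x 0 1 ^ (d + 1)) = -w := by rw [hw]; ring
    rw [h3]
    have h4 : x 0 0 - τ * ((x 0 0 - x 1 1) * (I x * x 0 1 ^ d)) * expQuot w * x 0 1
        - (x 1 1 + τ * ((x 0 0 - x 1 1) * (I x * x 0 1 ^ d)) * expQuot w * x 0 1)
        = (x 0 0 - x 1 1) * Complex.exp (-w) := by
      rw [hw] at h1 ⊢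
      linear_combination -(x 0 0 - x 1 1) * h1
    rw [h4]
    linear_combination -τ * (x 0 0 - x 1 1) * (I x * x 0 1 ^ d) * h2
  have := smul_lowField_mem_flowFields (b := b)
    (β := fun x => (x 0 0 - x 1 1) * (I x * x 0 1 ^ d)) hb (by simp [b])
    (fun x => by
      have h1 : HasDerivAt (fun τ : ℂ => τ * ((x 0 0 - x 1 1) * (I x * x 0 1 ^ d)))
          ((x 0 0 - x 1 1) * (I x * x 0 1 ^ d)) 0 := by
        simpa using (hasDerivAt_id (0 : ℂ)).mul_const ((x 0 0 - x 1 1) * (I x * x 0 1 ^ d))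
      have h2 : DifferentiableAt ℂ (fun τ : ℂ => expQuot (2 * τ * (I x * x 0 1 ^ (d + 1)))) 0 :=
        (kE.comp (by fun_prop)).differentiableAt
      have h3 := h1.mul h2.hasDerivAt
      simpa [expQuot_zero, b, Pi.mul_def] using h3)
    (fun τ => isGenerated_triConj (hbτ τ) (hbτ (-τ)) (hcancel τ) (fun x => by
      have := hcancel (-τ) x
      rwa [neg_neg] at this))
  refine (congrArg (· ∈ flowFields) ?_).mp this
  funext x
  rw [smul_smul]
  congr 1
  ring

/-! ### Polynomial families in a submodule -/

open Polynomial in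
lemma coeff_mem_of_forall_sum_mem {V : Type*} [AddCommGroup V] [Module ℂ V] (S : Submodule ℂ V)
    {N : ℕ} {C : ℕ → V} (h : ∀ z : ℂ, ∑ k ∈ Finset.range N, z ^ k • C k ∈ S) {k : ℕ}
    (hk : k < N) : C k ∈ S := by
  by_contra hC
  obtain ⟨f, hf, hS⟩ := S.exists_le_ker_of_notMem hC
  have h0 : (∑ k ∈ Finset.range N, Polynomial.monomial k (f (C k))) = 0 := by
    refine Polynomial.funext fun z => ?_
    have := hS (h z)
    rw [LinearMap.mem_ker, map_sum] at this
    rw [Polynomial.eval_finsetSum, Polynomial.eval_zero, ← this]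
    refine Finset.sum_congr rfl fun i _ => ?_
    rw [map_smul, Polynomial.eval_monomial, smul_eq_mul, mul_comm]
  have := congrArg (fun p => Polynomial.coeff p k) h0
  simp only [Polynomial.finsetSum_coeff, Polynomial.coeff_monomial, Polynomial.coeff_zero,
    Finset.sum_ite_eq', Finset.mem_range, hk, if_true] at this
  exact hf this

lemma deriv_sum_mem {V : Type*} [AddCommGroup V] [Module ℂ V] (S : Submodule ℂ V)
    {N : ℕ} {C : ℕ → V} (h : ∀ z : ℂ, ∑ k ∈ Finset.range N, z ^ k • C k ∈ S) (z : ℂ) :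
    ∑ k ∈ Finset.range N, (k * z ^ (k - 1) : ℂ) • C k ∈ S :=
  S.sum_mem fun _ hk => S.smul_mem _ (coeff_mem_of_forall_sum_mem S h (Finset.mem_range.1 hk))

section PolynomialFamilies

open Polynomial

/-- Evaluation of a polynomial with function coefficients at a constant. -/
def evalAt (z : ℂ) (p : (M2 → ℂ)[X]) : M2 → ℂ := p.eval (algebraMap ℂ (M2 → ℂ) z)

lemma evalAt_eq_sum {p : (M2 → ℂ)[X]} {N : ℕ} (hN : p.natDegree < N) (z : ℂ) :
    evalAt z p = ∑ k ∈ Finset.range N, z ^ k • p.coeff k := by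
  rw [evalAt, Polynomial.eval_eq_sum_range' hN]
  refine Finset.sum_congr rfl fun k _ => ?_
  rw [← map_pow, Algebra.smul_def, mul_comm]

lemma evalAt_derivative_eq_sum {p : (M2 → ℂ)[X]} {N : ℕ} (hN : p.natDegree < N) (z : ℂ) :
    evalAt z (derivative p) = ∑ k ∈ Finset.range N, (k * z ^ (k - 1) : ℂ) • p.coeff k := by
  rw [evalAt, Polynomial.derivative_eval, Polynomial.sum_over_range' _ (by simp) N hN]
  refine Finset.sum_congr rfl fun k _ => ?_
  rw [Algebra.smul_def, map_mul, map_pow, map_natCast]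
  ring

lemma evalAt_derivative_mem (S : Submodule ℂ (M2 → ℂ)) {p : (M2 → ℂ)[X]}
    (h : ∀ z, evalAt z p ∈ S) (z : ℂ) : evalAt z (derivative p) ∈ S := by
  rw [evalAt_derivative_eq_sum (Nat.lt_succ_self _)]
  exact deriv_sum_mem S (fun z => by rw [← evalAt_eq_sum (Nat.lt_succ_self _)]; exact h z) z

/-- The vector field obtained from a matrix of polynomials by evaluation at a constant. -/
def evalField (z : ℂ) (Γ : Matrix (Fin 2) (Fin 2) (M2 → ℂ)[X]) : M2 → M2 :=
  fun x => Matrix.of fun i j => evalAt z (Γ i j) x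

lemma evalField_derivative_mem (S : Submodule ℂ (M2 → M2))
    {Γ : Matrix (Fin 2) (Fin 2) (M2 → ℂ)[X]}
    (h : ∀ z, evalField z Γ ∈ S) (z : ℂ) : evalField z (Γ.map derivative) ∈ S := by
  obtain ⟨N, hN⟩ : ∃ N, ∀ i j, (Γ i j).natDegree < N := by
    refine ⟨∑ i, ∑ j, (Γ i j).natDegree + 1, fun i j => Nat.lt_succ_of_le ?_⟩
    exact (Finset.single_le_sum (f := fun j => (Γ i j).natDegree) (fun _ _ => Nat.zero_le _)
      (Finset.mem_univ j)).trans (Finset.single_le_sum (f := fun i => ∑ j, (Γ i j).natDegree)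
      (fun _ _ => Nat.zero_le _) (Finset.mem_univ i))
  let C : ℕ → M2 → M2 := fun k x => Matrix.of fun i j => (Γ i j).coeff k x
  have h1 : ∀ z, evalField z Γ = ∑ k ∈ Finset.range N, z ^ k • C k := by
    intro z
    funext x
    ext i j
    simp [evalField, evalAt_eq_sum (hN i j), C, Matrix.sum_apply]
  have h2 : evalField z (Γ.map derivative)
      = ∑ k ∈ Finset.range N, (k * z ^ (k - 1) : ℂ) • C k := by
    funext x
    ext i j
    simp [evalField, evalAt_derivative_eq_sum (hN i j), C, Matrix.sum_apply]
  rw [h2]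
  exact deriv_sum_mem S (fun z => h1 z ▸ h z) z

lemma evalAt_add (z : ℂ) (p q : (M2 → ℂ)[X]) : evalAt z (p + q) = evalAt z p + evalAt z q :=
  Polynomial.eval_add

lemma evalAt_mul (z : ℂ) (p q : (M2 → ℂ)[X]) : evalAt z (p * q) = evalAt z p * evalAt z q :=
  Polynomial.eval_mul

lemma evalField_add (z : ℂ) (Γ Δ : Matrix (Fin 2) (Fin 2) (M2 → ℂ)[X]) :
    evalField z (Γ + Δ) = evalField z Γ + evalField z Δ := by
  funext x; ext i j; simp [evalField, evalAt_add]

lemma evalField_smul (z : ℂ) (p : (M2 → ℂ)[X]) (Γ : Matrix (Fin 2) (Fin 2) (M2 → ℂ)[X]) :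
    evalField z (p • Γ) = fun x => evalAt z p x • evalField z Γ x := by
  funext x; ext i j; simp [evalField, evalAt_mul]

/-- The matrices of polynomials all of whose evaluations lie in `invFlowFields`. -/
def polyFlow : Submodule ℂ (Matrix (Fin 2) (Fin 2) (M2 → ℂ)[X]) where
  carrier := {Γ | ∀ z, evalField z Γ ∈ invFlowFields}
  zero_mem' z := by
    have : evalField z 0 = 0 := by
      funext x; ext i j; simp [evalField, evalAt]
    rw [this]; exact invFlowFields.zero_mem
  add_mem' := by
    intro Γ Δ h h' z
    rw [evalField_add]; exact invFlowFields.add_mem (h z) (h' z)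
  smul_mem' := by
    intro c Γ h z
    have : evalField z (c • Γ) = c • evalField z Γ := by
      funext x; ext i j; simp [evalField, evalAt]
    rw [this]; exact invFlowFields.smul_mem c (h z)

lemma derivative_mem_polyFlow {Γ : Matrix (Fin 2) (Fin 2) (M2 → ℂ)[X]} (h : Γ ∈ polyFlow) :
    Γ.map derivative ∈ polyFlow :=
  evalField_derivative_mem _ h

lemma invariant_smul_mem_polyFlow {I : M2 → ℂ} (hI : IsSpectralInvariant I)
    {Γ : Matrix (Fin 2) (Fin 2) (M2 → ℂ)[X]} (h : Γ ∈ polyFlow) :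
    (C I : (M2 → ℂ)[X]) • Γ ∈ polyFlow := by
  intro z
  rw [evalField_smul]
  simpa [evalAt] using inv_smul_mem (h z) hI

/-- The conjugates of the `(0, 1)` entry by the unipotent upper triangular matrices. -/
def entryPoly : (M2 → ℂ)[X] :=
  C (fun x => x 0 1) + C (fun x => x 0 0 - x 1 1) * X - C (fun x => x 1 0) * X ^ 2

/-- The derivative of `entryPoly`. -/
def entryPolyDeriv : (M2 → ℂ)[X] :=
  C (fun x => x 0 0 - x 1 1) - 2 * C (fun x => x 1 0) * X

lemma derivative_entryPoly : derivative entryPoly = entryPolyDeriv := by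
  simp [entryPoly, entryPolyDeriv]; ring

lemma derivative_entryPolyDeriv : derivative entryPolyDeriv = -2 * C (fun x => x 1 0) := by
  simp [entryPolyDeriv]
  exact (neg_mul (2 : (M2 → ℂ)[X]) _).symm

/-- The discriminant of the characteristic polynomial. -/
def discFun (x : M2) : ℂ := x.trace ^ 2 - 4 * x.det

lemma entryPolyDeriv_sq :
    entryPolyDeriv ^ 2 = C discFun + 2 * entryPoly * (-2 * C (fun x => x 1 0)) := by
  have h : discFun = (fun x => x 0 0 - x 1 1) ^ 2 + 4 * (fun x : M2 => x 0 1) * (fun x => x 1 0) := by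
    funext x; simp [discFun, Matrix.trace_fin_two, Matrix.det_fin_two]; ring
  rw [h, entryPolyDeriv, entryPoly]
  simp only [map_add, map_mul, map_pow, map_ofNat]
  ring

/-- The conjugates of `lowField` by the unipotent upper triangular matrices. -/
def lowPoly : Matrix (Fin 2) (Fin 2) (M2 → ℂ)[X] :=
  !![-C (fun x => x 0 1) - C (fun x => x 1 0) * X ^ 2,
      2 * C (fun x => x 0 1) * X + C (fun x => x 0 0 - x 1 1) * X ^ 2;
    C (fun x => x 0 0 - x 1 1) - 2 * C (fun x => x 1 0) * X,
      C (fun x => x 0 1) + C (fun x => x 1 0) * X ^ 2]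

/-- The derivative of `lowPoly`. -/
def midPoly : Matrix (Fin 2) (Fin 2) (M2 → ℂ)[X] :=
  !![-2 * C (fun x => x 1 0) * X, 2 * C (fun x => x 0 1) + 2 * C (fun x => x 0 0 - x 1 1) * X;
    -2 * C (fun x => x 1 0), 2 * C (fun x => x 1 0) * X]

/-- The derivative of `midPoly`. -/
def uppPoly : Matrix (Fin 2) (Fin 2) (M2 → ℂ)[X] :=
  !![-2 * C (fun x => x 1 0), 2 * C (fun x => x 0 0 - x 1 1); 0, 2 * C (fun x => x 1 0)]

lemma map_derivative_lowPoly : lowPoly.map derivative = midPoly := by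
  ext1 i j
  fin_cases i <;> fin_cases j <;> simp [lowPoly, midPoly] <;> ring

lemma map_derivative_midPoly : midPoly.map derivative = uppPoly := by
  ext1 i j
  fin_cases i <;> fin_cases j <;> simp [midPoly, uppPoly]

lemma map_derivative_smul (p : (M2 → ℂ)[X]) (Γ : Matrix (Fin 2) (Fin 2) (M2 → ℂ)[X]) :
    (p • Γ).map derivative = derivative p • Γ + p • Γ.map derivative := by
  ext1 i j
  simp

lemma entryPoly_smul_uppPoly :
    entryPoly • uppPoly = entryPolyDeriv • midPoly - (-2 * C (fun x => x 1 0) : (M2 → ℂ)[X]) • lowPoly := by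
  ext1 i j
  fin_cases i <;> fin_cases j <;>
    simp [lowPoly, midPoly, uppPoly, entryPoly, entryPolyDeriv] <;> ring
lemma upperConj (z : ℂ) (W : M2 → M2) (hW : W ∈ invFlowFields) :
    (fun x => !![1, z; 0, 1] * W (!![1, -z; 0, 1] * x * !![1, z; 0, 1]) * !![1, -z; 0, 1])
      ∈ invFlowFields := by
  have hdet : (!![1, z; 0, 1] : M2).det ≠ 0 := by simp [Matrix.det_fin_two]
  have hinv : (!![1, z; 0, 1] : M2)⁻¹ = !![1, -z; 0, 1] := by
    refine Matrix.inv_eq_right_inv ?_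
    ext i j
    fin_cases i <;> fin_cases j <;> simp [Matrix.mul_apply, Fin.sum_univ_two]
  simpa only [hinv] using conj_mem hW hdet

lemma pow_smul_lowPoly_mem (n : ℕ) : entryPoly ^ n • lowPoly ∈ polyFlow := by
  intro z
  refine (congrArg (· ∈ invFlowFields) ?_).mp (upperConj z _ (shear_mem n))
  rw [evalField_smul]
  funext x
  rw [mul_smul_comm, smul_mul_assoc]
  congr 1
  · simp [evalAt, entryPoly, Matrix.mul_apply, Matrix.vecMul, dotProduct, Fin.sum_univ_two]; ring
  · ext i j
    fin_cases i <;> fin_cases j <;>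
      simp [evalField, evalAt, lowPoly, lowField, Matrix.mul_apply, Matrix.vecMul,
        dotProduct, Fin.sum_univ_two] <;> ring

lemma pow_mul_deriv_smul_lowPoly_mem (n : ℕ) :
    (entryPoly ^ n * entryPolyDeriv) • lowPoly ∈ polyFlow := by
  intro z
  refine (congrArg (· ∈ invFlowFields) ?_).mp (upperConj z _ (overshear_mem n))
  rw [evalField_smul]
  funext x
  rw [mul_smul_comm, smul_mul_assoc]
  congr 1
  · simp [evalAt, entryPoly, entryPolyDeriv, Matrix.mul_apply, Matrix.vecMul, dotProduct, Fin.sum_univ_two]; ring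
  · ext i j
    fin_cases i <;> fin_cases j <;>
      simp [evalField, evalAt, lowPoly, lowField, Matrix.mul_apply, Matrix.vecMul,
        dotProduct, Fin.sum_univ_two] <;> ring

lemma natCast_smul_mem_polyFlow_iff (n : ℕ) {Γ : Matrix (Fin 2) (Fin 2) (M2 → ℂ)[X]} :
    (((n + 1 : ℕ) : (M2 → ℂ)[X]) • Γ ∈ polyFlow) ↔ Γ ∈ polyFlow := by
  have h : ((n + 1 : ℕ) : (M2 → ℂ)[X]) • Γ = ((n + 1 : ℕ) : ℂ) • Γ := by
    rw [Nat.cast_smul_eq_nsmul, Nat.cast_smul_eq_nsmul]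
  rw [h]
  exact polyFlow.smul_mem_iff (Nat.cast_ne_zero.2 (Nat.succ_ne_zero n))

lemma natCast_smul_mem_polyFlow (n : ℕ) {Γ : Matrix (Fin 2) (Fin 2) (M2 → ℂ)[X]}
    (h : Γ ∈ polyFlow) : (n : (M2 → ℂ)[X]) • Γ ∈ polyFlow := by
  rw [Nat.cast_smul_eq_nsmul]
  exact polyFlow.nsmul_mem h n

lemma pow_smul_midPoly_mem (n : ℕ) : entryPoly ^ n • midPoly ∈ polyFlow := by
  cases n with
  | zero =>
    have := derivative_mem_polyFlow (pow_smul_lowPoly_mem 0)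
    simpa [map_derivative_lowPoly] using this
  | succ n =>
    have h1 := derivative_mem_polyFlow (pow_smul_lowPoly_mem (n + 1))
    rw [map_derivative_smul, derivative_pow_succ, derivative_entryPoly, map_derivative_lowPoly] at h1
    have h2 := natCast_smul_mem_polyFlow (n + 1) (pow_mul_deriv_smul_lowPoly_mem n)
    refine (Submodule.add_mem_iff_right _ ?_).1 h1
    convert h2 using 1
    rw [smul_smul]
    congr 1
    push_cast
    simp
    ring

lemma isSpectralInvariant_discFun : IsSpectralInvariant discFun := isInvariant_disc

lemma mem_polyFlow_of_nonneg_combination (n : ℕ) {A B : Matrix (Fin 2) (Fin 2) (M2 → ℂ)[X]}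
    (h1 : ((n + 2 : ℕ) : (M2 → ℂ)[X]) • B - A ∈ polyFlow)
    (h2 : ((2 * n + 1 : ℕ) : (M2 → ℂ)[X]) • A + B ∈ polyFlow) : B ∈ polyFlow := by
  have h3 := polyFlow.add_mem (natCast_smul_mem_polyFlow (2 * n + 1) h1) h2
  rw [← natCast_smul_mem_polyFlow_iff ((2 * n + 1) * (n + 2))]
  convert h3 using 1
  ext1 i j
  simp
  ring

lemma pow_smul_uppPoly_mem (n : ℕ) : entryPoly ^ n • uppPoly ∈ polyFlow := by
  cases n with
  | zero =>
    have := derivative_mem_polyFlow (pow_smul_midPoly_mem 0)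
    simpa [map_derivative_midPoly] using this
  | succ n =>
    set A : Matrix (Fin 2) (Fin 2) (M2 → ℂ)[X] :=
      (entryPoly ^ n * (-2 * C (fun x => x 1 0))) • lowPoly with hA
    set B : Matrix (Fin 2) (Fin 2) (M2 → ℂ)[X] := (entryPoly ^ n * entryPolyDeriv) • midPoly with hB
    have hE : entryPoly ^ (n + 1) • uppPoly = B - A := by
      rw [pow_succ, mul_smul, entryPoly_smul_uppPoly, smul_sub, smul_smul, smul_smul]
    have h1 := derivative_mem_polyFlow (pow_smul_midPoly_mem (n + 1))
    rw [map_derivative_smul, derivative_pow_succ, derivative_entryPoly, map_derivative_midPoly,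
      hE] at h1
    have h2 := derivative_mem_polyFlow (pow_mul_deriv_smul_lowPoly_mem n)
    rw [map_derivative_smul, derivative_mul, derivative_pow, derivative_entryPoly,
      derivative_entryPolyDeriv, map_derivative_lowPoly] at h2
    have h3 : (n : (M2 → ℂ)[X]) • (C discFun : (M2 → ℂ)[X]) • entryPoly ^ (n - 1) • lowPoly ∈ polyFlow :=
      natCast_smul_mem_polyFlow n
        (invariant_smul_mem_polyFlow isSpectralInvariant_discFun (pow_smul_lowPoly_mem _))
    have h4 : ((n + 2 : ℕ) : (M2 → ℂ)[X]) • B - A ∈ polyFlow := by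
      convert h1 using 1
      rw [hB, smul_smul]
      rw [show (C ((n : M2 → ℂ) + 1) : (M2 → ℂ)[X]) * entryPoly ^ n * entryPolyDeriv
        = ((n : (M2 → ℂ)[X]) + 1) * (entryPoly ^ n * entryPolyDeriv) by simp; ring]
      push_cast
      module
    have h5 : ((2 * n + 1 : ℕ) : (M2 → ℂ)[X]) • A + B ∈ polyFlow := by
      convert polyFlow.sub_mem h2 h3 using 1
      rw [hA, hB, smul_smul, smul_smul, smul_smul]
      have : (C (n : M2 → ℂ) : (M2 → ℂ)[X]) * entryPoly ^ (n - 1) * entryPolyDeriv * entryPolyDeriv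
          = (n : (M2 → ℂ)[X]) * (C discFun * entryPoly ^ (n - 1)) +
            2 * (n : (M2 → ℂ)[X]) * (entryPoly ^ n * (-2 * C (fun x => x 1 0))) := by
        rw [mul_assoc, ← sq, entryPolyDeriv_sq]
        cases n with
        | zero => simp
        | succ m => simp [pow_succ]; ring
      rw [this]
      push_cast
      module
    have hBmem : B ∈ polyFlow := mem_polyFlow_of_nonneg_combination n h4 h5
    rw [hE]
    have h6 := polyFlow.sub_mem h4 (natCast_smul_mem_polyFlow (n + 1) hBmem)
    convert h6 using 1
    push_cast
    module

end PolynomialFamilies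

section PolynomialFields

open Polynomial

/-! ### Polynomial tangent fields -/

/-- Polynomial functions on `M2`. -/
def polyFuns : Subalgebra ℂ (M2 → ℂ) :=
  Algebra.adjoin ℂ (Set.range fun (p : Fin 2 × Fin 2) (x : M2) => x p.1 p.2)

lemma entry_mem_polyFuns (i j : Fin 2) : (fun x : M2 => x i j) ∈ polyFuns :=
  Algebra.subset_adjoin ⟨(i, j), rfl⟩

lemma continuous_of_mem_polyFuns {P : M2 → ℂ} (hP : P ∈ polyFuns) : Continuous P := by
  induction hP using Algebra.adjoin_induction with
  | mem f hf => obtain ⟨p, rfl⟩ := hf; exact continuous_entry p.1 p.2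
  | algebraMap c => exact continuous_const
  | add f g _ _ hf hg => exact hf.add hg
  | mul f g _ _ hf hg => exact hf.mul hg

/-- The span of the products of an invariant function and a power of a conjugate of the
`(0, 1)` entry. -/
def invSpan : Submodule ℂ (M2 → ℂ) :=
  Submodule.span ℂ {f | ∃ I, IsSpectralInvariant I ∧ ∃ z d, f = I * (evalAt z entryPoly) ^ d}

lemma evalAt_pow (z : ℂ) (p : (M2 → ℂ)[X]) (n : ℕ) : evalAt z (p ^ n) = evalAt z p ^ n :=
  Polynomial.eval_pow _

lemma evalAt_C (z : ℂ) (f : M2 → ℂ) : evalAt z (C f) = f := Polynomial.eval_C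

lemma inv_mul_pow_mem {I : M2 → ℂ} (hI : IsSpectralInvariant I) (d : ℕ) (z : ℂ) :
    evalAt z (C I * entryPoly ^ d) ∈ invSpan := by
  rw [evalAt_mul, evalAt_pow, evalAt_C]
  exact Submodule.subset_span ⟨I, hI, z, d, rfl⟩

lemma inv_mul_pow_mul_deriv_mem {I : M2 → ℂ} (hI : IsSpectralInvariant I) (d : ℕ) (z : ℂ) :
    evalAt z (C I * entryPoly ^ d * entryPolyDeriv) ∈ invSpan := by
  have h := evalAt_derivative_mem invSpan (inv_mul_pow_mem hI (d + 1)) z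
  have h2 : derivative (C I * entryPoly ^ (d + 1))
      = ((d + 1 : ℕ) : ℂ) • (C I * entryPoly ^ d * entryPolyDeriv) := by
    rw [Nat.cast_smul_eq_nsmul, nsmul_eq_mul, derivative_mul, derivative_C, derivative_pow_succ,
      derivative_entryPoly]
    simp
    ring
  have h3 : evalAt z (((d + 1 : ℕ) : ℂ) • (C I * entryPoly ^ d * entryPolyDeriv))
      = ((d + 1 : ℕ) : ℂ) • evalAt z (C I * entryPoly ^ d * entryPolyDeriv) :=
    Polynomial.eval_smul _ _ _
  rw [h2, h3] at h
  exact (Submodule.smul_mem_iff _ (Nat.cast_ne_zero.2 (Nat.succ_ne_zero d))).1 h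

lemma inv_mul_pow_mul_entry_mem {I : M2 → ℂ} (hI : IsSpectralInvariant I) (d : ℕ) (z : ℂ) :
    evalAt z (C I * entryPoly ^ d * C (fun x => x 1 0)) ∈ invSpan := by
  have h := evalAt_derivative_mem invSpan (inv_mul_pow_mul_deriv_mem hI d) z
  have h2 : derivative (C I * entryPoly ^ d * entryPolyDeriv)
      = (d : (M2 → ℂ)[X]) * (C (I * discFun) * entryPoly ^ (d - 1)) +
        ((-2 * (2 * d + 1) : ℤ) : (M2 → ℂ)[X]) *
          (C I * entryPoly ^ d * C (fun x : M2 => x 1 0)) := by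
    rw [derivative_mul, derivative_mul, derivative_C, derivative_pow,
      derivative_entryPoly, derivative_entryPolyDeriv]
    have h3 : (C I * (C (d : M2 → ℂ) * entryPoly ^ (d - 1) * entryPolyDeriv)) * entryPolyDeriv
      = (d : (M2 → ℂ)[X]) * (C I * entryPoly ^ (d - 1) * entryPolyDeriv ^ 2) := by
      simp; ring
    rw [zero_mul, zero_add, h3, entryPolyDeriv_sq]
    cases d with
    | zero => simp; ring
    | succ m => simp [pow_succ]; ring
  have h4 : ∀ (n : ℤ) (p : (M2 → ℂ)[X]), evalAt z ((n : (M2 → ℂ)[X]) * p) = (n : ℂ) • evalAt z p := by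
    intro n p
    funext x
    simp [evalAt]
  have h4' : ∀ (n : ℕ) (p : (M2 → ℂ)[X]), evalAt z ((n : (M2 → ℂ)[X]) * p) = (n : ℂ) • evalAt z p := by
    intro n p
    exact_mod_cast h4 n p
  rw [h2, evalAt_add, h4, h4', Submodule.add_mem_iff_right _
    (Submodule.smul_mem _ _ (inv_mul_pow_mem (hI.mul isSpectralInvariant_discFun) _ z))] at h
  refine (Submodule.smul_mem_iff _ ?_).1 h
  rw [Int.cast_ne_zero]
  omega

lemma entry_mul_mem_invSpan (i j : Fin 2) {f : M2 → ℂ} (hf : f ∈ invSpan) :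
    (fun x => x i j) * f ∈ invSpan := by
  induction hf using Submodule.span_induction with
  | zero => simp
  | add f g _ _ hf hg => rw [mul_add]; exact invSpan.add_mem hf hg
  | smul c f _ hf => rw [mul_smul_comm]; exact invSpan.smul_mem c hf
  | mem f hf =>
    obtain ⟨I, hI, z, d, rfl⟩ := hf
    have hv := inv_mul_pow_mul_entry_mem hI d z
    have hk := inv_mul_pow_mul_deriv_mem hI d z
    have hu := inv_mul_pow_mem hI (d + 1) z
    have ht := inv_mul_pow_mem (isInvariant_trace.mul hI) d z
    have hk' := invSpan.add_mem hk (invSpan.smul_mem (2 * z) hv)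
    have hu' := invSpan.add_mem (invSpan.sub_mem hu (invSpan.smul_mem z hk'))
      (invSpan.smul_mem (z ^ 2) hv)
    have h0' := invSpan.smul_mem (1 / 2 : ℂ) (invSpan.add_mem ht hk')
    have h1' := invSpan.smul_mem (1 / 2 : ℂ) (invSpan.sub_mem ht hk')
    fin_cases i <;> fin_cases j
    · convert h0' using 1
      funext x
      simp [evalAt, entryPoly, entryPolyDeriv, Matrix.trace_fin_two]; ring
    · convert hu' using 1
      funext x
      simp [evalAt, entryPoly, entryPolyDeriv]; ring
    · convert hv using 1
      funext x
      simp [evalAt, entryPoly]; ring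
    · convert h1' using 1
      funext x
      simp [evalAt, entryPoly, entryPolyDeriv, Matrix.trace_fin_two]; ring

lemma mem_invSpan_of_mem_polyFuns {P : M2 → ℂ} (hP : P ∈ polyFuns) : P ∈ invSpan := by
  have h : ∀ f ∈ invSpan, P * f ∈ invSpan := by
    induction hP using Algebra.adjoin_induction with
    | mem f hf => obtain ⟨p, rfl⟩ := hf; exact fun f hf => entry_mul_mem_invSpan p.1 p.2 hf
    | algebraMap c =>
      intro f hf
      rw [← Algebra.smul_def]
      exact invSpan.smul_mem c hf
    | add f g _ _ hf hg => intro h hh; rw [add_mul]; exact invSpan.add_mem (hf h hh) (hg h hh)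
    | mul f g _ _ hf hg => intro h hh; rw [mul_assoc]; exact hf _ (hg h hh)
  have h1 : (1 : M2 → ℂ) ∈ invSpan :=
    Submodule.subset_span ⟨1, isInvariant_one, 0, 0, by simp⟩
  simpa using h 1 h1

lemma polyFuns_smul_mem_of_pow {W : M2 → M2}
    (hW : ∀ z d, (fun x => (evalAt z entryPoly ^ d) x • W x) ∈ invFlowFields) {P : M2 → ℂ}
    (hP : P ∈ polyFuns) : (fun x => P x • W x) ∈ invFlowFields := by
  have hP' := mem_invSpan_of_mem_polyFuns hP
  clear hP
  induction hP' using Submodule.span_induction with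
  | zero =>
    simp only [Pi.zero_apply, zero_smul]
    exact invFlowFields.zero_mem
  | add f g _ _ hf hg =>
    convert invFlowFields.add_mem hf hg using 1
    funext x
    simp [add_smul]
  | smul c f _ hf =>
    convert invFlowFields.smul_mem c hf using 1
    funext x
    simp [mul_smul]
  | mem f hf =>
    obtain ⟨I, hI, z, d, rfl⟩ := hf
    convert inv_smul_mem (hW z d) hI using 1
    funext x
    simp [mul_smul]

/-- The linear vector field of the upper triangular conjugations. -/
def uppField (x : M2) : M2 := !![x 1 0, -(x 0 0 - x 1 1); 0, -x 1 0]

/-- The linear vector field of the diagonal conjugations. -/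
def midField (x : M2) : M2 := !![0, x 0 1; -x 1 0, 0]

lemma pow_smul_uppField_mem (z : ℂ) (d : ℕ) :
    (fun x => (evalAt z entryPoly ^ d) x • uppField x) ∈ invFlowFields := by
  have h := invFlowFields.smul_mem (-1 / 2 : ℂ) (pow_smul_uppPoly_mem d z)
  rw [evalField_smul] at h
  convert h using 1
  funext x
  rw [Pi.smul_apply, smul_comm, evalAt_pow]
  congr 1
  ext i j
  fin_cases i <;> fin_cases j <;> simp [evalField, uppPoly, evalAt, uppField] <;> ring

lemma pow_smul_midField_mem (z : ℂ) (d : ℕ) :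
    (fun x => (evalAt z entryPoly ^ d) x • midField x) ∈ invFlowFields := by
  have h := invFlowFields.smul_mem (1 / 2 : ℂ) (pow_smul_midPoly_mem d z)
  rw [evalField_smul] at h
  convert invFlowFields.add_mem h (invFlowFields.smul_mem z (pow_smul_uppField_mem z d)) using 1
  funext x
  rw [Pi.add_apply, Pi.smul_apply, Pi.smul_apply, smul_comm, smul_comm z, evalAt_pow, ← smul_add]
  congr 1
  ext i j
  fin_cases i <;> fin_cases j <;> simp [evalField, midPoly, evalAt, uppField, midField] <;> ring

lemma pow_smul_lowField_mem (z : ℂ) (d : ℕ) :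
    (fun x => (evalAt z entryPoly ^ d) x • lowField x) ∈ invFlowFields := by
  have h := pow_smul_lowPoly_mem d z
  rw [evalField_smul] at h
  convert invFlowFields.add_mem (invFlowFields.sub_mem h (invFlowFields.smul_mem (2 * z)
    (pow_smul_midField_mem z d))) (invFlowFields.smul_mem (z ^ 2) (pow_smul_uppField_mem z d)) using 1
  funext x
  simp only [Pi.add_apply, Pi.sub_apply, Pi.smul_apply, smul_comm (2 * z), smul_comm (z ^ 2),
    evalAt_pow]
  rw [← smul_sub, ← smul_add]
  congr 1
  have h2 : evalField z lowPoly x = !![-x 0 1 - x 1 0 * z ^ 2,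
      2 * x 0 1 * z + (x 0 0 - x 1 1) * z ^ 2; x 0 0 - x 1 1 - 2 * x 1 0 * z,
      x 0 1 + x 1 0 * z ^ 2] := by
    ext i j
    fin_cases i <;> fin_cases j <;> simp [evalField, lowPoly, evalAt]
  rw [h2]
  ext i j
  fin_cases i <;> fin_cases j <;> simp [uppField, midField, lowField] <;> ring

/-- Replace the `(0, 1)` entry by `0`. -/
def clearUpper (x : M2) : M2 := !![x 0 0, 0; x 1 0, x 1 1]

/-- Replace the `(1, 0)` entry by `0`. -/
def clearLower (x : M2) : M2 := !![x 0 0, x 0 1; 0, x 1 1]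

lemma exists_eq_add_mul {P : M2 → ℂ} (hP : P ∈ polyFuns) {r : M2 → M2} {i j : Fin 2}
    (hr : ∀ i' j', (fun x => r x i' j') ∈ polyFuns)
    (hrq : ∀ i' j', ∃ c : ℂ, ∀ x, x i' j' = r x i' j' + x i j * c) :
    P ∘ r ∈ polyFuns ∧ ∃ Q ∈ polyFuns, ∀ x, P x = P (r x) + x i j * Q x := by
  induction hP using Algebra.adjoin_induction with
  | mem f hf =>
    obtain ⟨p, rfl⟩ := hf
    obtain ⟨c, hc⟩ := hrq p.1 p.2
    exact ⟨hr p.1 p.2, fun _ => c, polyFuns.algebraMap_mem c, hc⟩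
  | algebraMap c => exact ⟨polyFuns.algebraMap_mem c, 0, polyFuns.zero_mem, fun x => by simp⟩
  | add f g _ _ hf hg =>
    obtain ⟨hf, P, hP, hfP⟩ := hf
    obtain ⟨hg, Q, hQ, hgQ⟩ := hg
    exact ⟨polyFuns.add_mem hf hg, P + Q, polyFuns.add_mem hP hQ, fun x => by
      simp only [Pi.add_apply]; rw [hfP x, hgQ x]; ring⟩
  | mul f g hf' hg' hf hg =>
    obtain ⟨hf, P, hP, hfP⟩ := hf
    obtain ⟨hg, Q, hQ, hgQ⟩ := hg
    refine ⟨polyFuns.mul_mem hf hg, P * g + (f ∘ r) * Q,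
      polyFuns.add_mem (polyFuns.mul_mem hP hg') (polyFuns.mul_mem hf hQ), fun x => ?_⟩
    simp only [Pi.add_apply, Pi.mul_apply, Function.comp_apply]
    rw [hfP x, hgQ x]; ring

lemma exists_eq_add_upper {P : M2 → ℂ} (hP : P ∈ polyFuns) :
    P ∘ clearUpper ∈ polyFuns ∧ ∃ Q ∈ polyFuns, ∀ x, P x = P (clearUpper x) + x 0 1 * Q x := by
  refine exists_eq_add_mul hP (fun i j => ?_) (fun i j => ?_)
  · fin_cases i <;> fin_cases j <;> simp only [clearUpper]
    exacts [entry_mem_polyFuns 0 0, polyFuns.zero_mem, entry_mem_polyFuns 1 0,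
      entry_mem_polyFuns 1 1]
  · fin_cases i <;> fin_cases j
    exacts [⟨0, fun x => by simp [clearUpper]⟩, ⟨1, fun x => by simp [clearUpper]⟩,
      ⟨0, fun x => by simp [clearUpper]⟩, ⟨0, fun x => by simp [clearUpper]⟩]

lemma exists_eq_add_lower {P : M2 → ℂ} (hP : P ∈ polyFuns) :
    P ∘ clearLower ∈ polyFuns ∧ ∃ Q ∈ polyFuns, ∀ x, P x = P (clearLower x) + x 1 0 * Q x := by
  refine exists_eq_add_mul hP (fun i j => ?_) (fun i j => ?_)
  · fin_cases i <;> fin_cases j <;> simp only [clearLower]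
    exacts [entry_mem_polyFuns 0 0, entry_mem_polyFuns 0 1, polyFuns.zero_mem,
      entry_mem_polyFuns 1 1]
  · fin_cases i <;> fin_cases j
    exacts [⟨0, fun x => by simp [clearLower]⟩, ⟨0, fun x => by simp [clearLower]⟩,
      ⟨1, fun x => by simp [clearLower]⟩, ⟨0, fun x => by simp [clearLower]⟩]

lemma eq_zero_of_mul_eq_zero {f : M2 → ℂ} (hf : Continuous f) (l : M2 →ₗ[ℂ] ℂ) {B : M2}
    (hB : l B ≠ 0) (h : ∀ x, l x * f x = 0) (x : M2) : f x = 0 := by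
  have hc : Continuous (fun t : ℂ => f (x + t • B)) :=
    hf.comp (continuous_const.add (continuous_id.smul continuous_const))
  have h2 : (fun t : ℂ => f (x + t • B)) = fun _ => 0 := by
    refine hc.ext_on (dense_compl_singleton (-l x / l B)) continuous_const fun t ht => ?_
    refine (mul_eq_zero.1 (h (x + t • B))).resolve_left fun h0 => ht ?_
    rw [map_add, map_smul, smul_eq_mul] at h0
    rw [mem_singleton_iff, eq_div_iff hB]
    linear_combination h0
  simpa using congrFun h2 0

lemma tangent_mem_flowFields {a b e : M2 → ℂ} (ha : a ∈ polyFuns) (hb : b ∈ polyFuns)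
    (he : e ∈ polyFuns)
    (h : ∀ x : M2, (x 0 0 - x 1 1) * a x + x 0 1 * e x + x 1 0 * b x = 0) :
    (fun x => !![a x, b x; e x, -a x]) ∈ flowFields := by
  obtain ⟨ha0, a1, ha1, haa1⟩ := exists_eq_add_upper ha
  obtain ⟨ha00, a2, ha2, haa2⟩ := exists_eq_add_lower ha0
  let lu : M2 →ₗ[ℂ] ℂ := Matrix.entryLinearMap ℂ ℂ 0 1
  let lv : M2 →ₗ[ℂ] ℂ := Matrix.entryLinearMap ℂ ℂ 1 0
  let lk : M2 →ₗ[ℂ] ℂ := Matrix.entryLinearMap ℂ ℂ 0 0 - Matrix.entryLinearMap ℂ ℂ 1 1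
  have hk : (fun x : M2 => x 0 0 - x 1 1) ∈ polyFuns :=
    polyFuns.sub_mem (entry_mem_polyFuns 0 0) (entry_mem_polyFuns 1 1)
  have h00 : ∀ x, a (clearUpper (clearLower x)) = 0 := by
    refine eq_zero_of_mul_eq_zero (continuous_of_mem_polyFuns ha00) lk (B := !![1, 0; 0, 0])
      (by simp [lk]) fun x => ?_
    have := h (clearUpper (clearLower x))
    simpa [lk, clearUpper, clearLower] using this
  have haeq : ∀ x, a x = x 0 1 * a1 x + x 1 0 * a2 x := by
    intro x
    have := haa2 x
    simp only [Function.comp_apply, h00, zero_add] at this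
    rw [haa1 x, this]; ring
  have hr : (b + (fun x : M2 => x 0 0 - x 1 1) * a2) ∈ polyFuns :=
    polyFuns.add_mem hb (polyFuns.mul_mem hk ha2)
  obtain ⟨hr0, s, hs, hrs⟩ := exists_eq_add_upper hr
  have hr00 : ∀ x, (b + (fun x : M2 => x 0 0 - x 1 1) * a2) (clearUpper x) = 0 := by
    refine eq_zero_of_mul_eq_zero (continuous_of_mem_polyFuns hr0) lv (B := !![0, 0; 1, 0])
      (by simp [lv]) fun x => ?_
    have := h (clearUpper x)
    rw [haeq] at this
    have h2 : x 1 0 * (b (clearUpper x) + (x 0 0 - x 1 1) * a2 (clearUpper x)) = 0 := by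
      simp only [clearUpper, Matrix.of_apply, Matrix.cons_val', Matrix.cons_val_zero,
        Matrix.cons_val_one, Matrix.cons_val_fin_one] at this ⊢
      linear_combination this
    simpa [lv, clearUpper] using h2
  have hbeq : ∀ x, b x + (x 0 0 - x 1 1) * a2 x = x 0 1 * s x := by
    intro x
    have := hrs x
    rw [hr00 x, zero_add] at this
    simpa using this
  have hp : ∀ x, e x + (x 0 0 - x 1 1) * a1 x + x 1 0 * s x = 0 := by
    refine eq_zero_of_mul_eq_zero (continuous_of_mem_polyFuns (P :=
      e + (fun x : M2 => x 0 0 - x 1 1) * a1 + (fun x : M2 => x 1 0) * s)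
      (polyFuns.add_mem (polyFuns.add_mem he (polyFuns.mul_mem hk ha1))
        (polyFuns.mul_mem (entry_mem_polyFuns 1 0) hs))) lu (B := !![0, 1; 0, 0])
      (by simp [lu]) fun x => ?_
    have h1 := h x
    have h2 := hbeq x
    have h3 := haeq x
    simp only [lu, Matrix.entryLinearMap_apply]
    linear_combination h1 - x 1 0 * h2 - (x 0 0 - x 1 1) * h3
  apply invFlowFields_le
  convert invFlowFields.add_mem (invFlowFields.sub_mem
    (polyFuns_smul_mem_of_pow pow_smul_uppField_mem ha2)
    (polyFuns_smul_mem_of_pow pow_smul_lowField_mem ha1))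
    (polyFuns_smul_mem_of_pow pow_smul_midField_mem hs) using 1
  funext x
  have h1 := haeq x
  have h2 := hbeq x
  have h3 := hp x
  ext i j
  fin_cases i <;> fin_cases j <;> simp [uppField, midField, lowField]
  · linear_combination h1
  · linear_combination h2
  · linear_combination h3
  · linear_combination -h1

end PolynomialFields

/-! ### Holomorphic functions of several variables -/

section SeveralVariables

open Metric MeasureTheory

variable {E : Type*} [NormedAddCommGroup E] [NormedSpace ℂ E]
  {F : Type*} [NormedAddCommGroup F] [NormedSpace ℂ F]

lemma differentiable_line (x v : E) : Differentiable ℂ (fun ζ : ℂ => x + ζ • v) :=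
  (differentiable_id.smul_const v).const_add x

lemma hasDerivAt_comp_line {f : E → F} {x v : E} {ζ : ℂ} (hf : DifferentiableAt ℂ f (x + ζ • v)) :
    HasDerivAt (fun ζ : ℂ => f (x + ζ • v)) (fderiv ℂ f (x + ζ • v) v) ζ := by
  have h := ((hasDerivAt_id ζ).smul_const v).const_add x
  rw [one_smul] at h
  exact hf.hasFDerivAt.comp_hasDerivAt ζ h

lemma norm_fderiv_le_of_forall_closedBall {f : E → F} {U : Set E} (hU : IsOpen U)
    (hf : DifferentiableOn ℂ f U) {y : E} {R M : ℝ} (hR : 0 < R) (hRU : closedBall y R ⊆ U)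
    (hM : ∀ x ∈ closedBall y R, ‖f x‖ ≤ M) : ‖fderiv ℂ f y‖ ≤ M / R := by
  have hM0 : 0 ≤ M := (norm_nonneg _).trans (hM y (mem_closedBall_self hR.le))
  refine ContinuousLinearMap.opNorm_le_bound _ (by positivity) fun w => ?_
  by_cases hw : w = 0
  · simp [hw]
  have hw' : 0 < ‖w‖ := norm_pos_iff.2 hw
  have hmem : ∀ ζ ∈ closedBall (0 : ℂ) (R / ‖w‖), y + ζ • w ∈ closedBall y R := by
    intro ζ hζ
    rw [mem_closedBall_zero_iff, le_div_iff₀ hw'] at hζ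
    simpa [norm_smul] using hζ
  have hd : DifferentiableAt ℂ f y := hf.differentiableAt (hU.mem_nhds (hRU (mem_closedBall_self hR.le)))
  have h1 : deriv (fun ζ : ℂ => f (y + ζ • w)) 0 = fderiv ℂ f y w := by
    have := hasDerivAt_comp_line (f := f) (x := y) (v := w) (ζ := 0) (by simpa using hd)
    simpa using this.deriv
  have h2 : DifferentiableOn ℂ (fun ζ : ℂ => f (y + ζ • w)) (closedBall 0 (R / ‖w‖)) :=
    hf.comp (differentiable_line y w).differentiableOn fun ζ hζ => hRU (hmem ζ hζ)
  have h3 := Complex.norm_deriv_le_of_forall_mem_sphere_norm_le (c := 0) (div_pos hR hw')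
    (h2.diffContOnCl_ball subset_rfl)
    (fun ζ hζ => hM _ (hmem ζ (sphere_subset_closedBall hζ)))
  rw [h1] at h3
  convert h3 using 1
  field_simp

lemma differentiableOn_fderiv_apply [FiniteDimensional ℂ E] {f : E → ℂ} {U : Set E}
    (hU : IsOpen U) (hf : DifferentiableOn ℂ f U) (v : E) :
    DifferentiableOn ℂ (fun x => fderiv ℂ f x v) U := by
  intro x0 hx0
  have : ProperSpace E := FiniteDimensional.proper ℂ E
  obtain ⟨ε, hε, hεU⟩ := nhds_basis_closedBall.mem_iff.1 (hU.mem_nhds hx0)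
  set R := ε / 3 with hRdef
  have hR : 0 < R := by positivity
  obtain ⟨M, hM⟩ := (isCompact_closedBall x0 ε).exists_bound_of_continuousOn
    (hf.continuousOn.mono hεU)
  obtain ⟨r, hr, hrv⟩ : ∃ r : ℝ, 0 < r ∧ r * ‖v‖ ≤ R := by
    refine ⟨R / (‖v‖ + 1), by positivity, ?_⟩
    rw [div_mul_eq_mul_div, div_le_iff₀ (by positivity)]
    nlinarith [norm_nonneg v]
  have hball : ∀ x ∈ ball x0 R, ∀ ζ ∈ closedBall (0 : ℂ) r,
      closedBall (x + ζ • v) R ⊆ closedBall x0 ε := by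
    intro x hx ζ hζ
    refine closedBall_subset_closedBall' ?_
    have h1 : ‖ζ • v‖ ≤ R := by
      rw [norm_smul]
      exact (mul_le_mul_of_nonneg_right (by simpa using hζ) (norm_nonneg v)).trans hrv
    have h2 : dist (x + ζ • v) x0 ≤ dist x x0 + ‖ζ • v‖ := by
      rw [dist_eq_norm, dist_eq_norm, add_sub_right_comm]; exact norm_add_le _ _
    have h3 := mem_ball.1 hx
    linarith
  have hmemU : ∀ x ∈ ball x0 R, ∀ ζ ∈ closedBall (0 : ℂ) r, x + ζ • v ∈ U := fun x hx ζ hζ =>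
    hεU (hball x hx ζ hζ (mem_closedBall_self hR.le))
  have hcirc : ∀ θ : ℝ, circleMap 0 r θ ∈ closedBall (0 : ℂ) r := fun θ =>
    circleMap_mem_closedBall 0 hr.le θ
  have hformula : ∀ x ∈ ball x0 R, fderiv ℂ f x v = (2 * Real.pi * Complex.I : ℂ)⁻¹ •
      ∮ z in C(0, r), ((z - 0) ^ 2)⁻¹ • f (x + z • v) := by
    intro x hx
    have hopen : IsOpen ((fun ζ : ℂ => x + ζ • v) ⁻¹' U) :=
      hU.preimage (differentiable_line x v).continuous
    have hC := Complex.two_pi_I_inv_smul_circleIntegral_sub_sq_inv_smul_of_differentiable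
      (f := fun ζ : ℂ => f (x + ζ • v)) hopen (fun ζ hζ => hmemU x hx ζ hζ)
      (hf.comp (differentiable_line x v).differentiableOn fun _ h => h) (mem_ball_self hr)
    rw [hC]
    have hxU : DifferentiableAt ℂ f x := hf.differentiableAt (hU.mem_nhds (by
      simpa using hmemU x hx 0 (by simpa using hr.le)))
    have := hasDerivAt_comp_line (f := f) (x := x) (v := v) (ζ := 0) (by simpa using hxU)
    simpa using this.deriv.symm
  have hcont : ∀ x ∈ ball x0 R, Continuous (fun θ : ℝ =>
      deriv (circleMap 0 r) θ • ((circleMap 0 r θ - 0) ^ 2)⁻¹ • f (x + circleMap 0 r θ • v)) := by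
    intro x hx
    have h1 : Continuous (fun θ : ℝ => f (x + circleMap 0 r θ • v)) := by
      refine hf.continuousOn.comp_continuous ?_ fun θ => hmemU x hx _ (hcirc θ)
      exact (differentiable_line x v).continuous.comp (continuous_circleMap 0 r)
    have h2 : Continuous (fun θ : ℝ => ((circleMap 0 r θ - 0) ^ 2)⁻¹) := by
      refine Continuous.inv₀ (((continuous_circleMap 0 r).sub continuous_const).pow 2) fun θ => ?_
      exact pow_ne_zero 2 (sub_ne_zero.2 (circleMap_ne_center hr.ne'))
    have h3 : Continuous (deriv (circleMap 0 r)) := by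
      have : deriv (circleMap 0 r) = fun θ => circleMap 0 r θ * Complex.I := by
        funext θ; exact deriv_circleMap 0 r θ
      rw [this]
      exact (continuous_circleMap 0 r).mul continuous_const
    exact h3.smul (h2.smul h1)
  borelize E
  borelize (E →L[ℂ] ℂ)
  have : FiniteDimensional ℂ (E →L[ℂ] ℂ) := inferInstance
  have : ProperSpace (E →L[ℂ] ℂ) := FiniteDimensional.proper ℂ _
  have hderiv := intervalIntegral.hasFDerivAt_integral_of_dominated_of_fderiv_le (𝕜 := ℂ)
    (μ := volume) (a := 0) (b := 2 * Real.pi) (s := ball x0 R) (x₀ := x0)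
    (F := fun x θ => deriv (circleMap 0 r) θ • ((circleMap 0 r θ - 0) ^ 2)⁻¹ •
      f (x + circleMap 0 r θ • v))
    (F' := fun x θ => deriv (circleMap 0 r) θ • ((circleMap 0 r θ - 0) ^ 2)⁻¹ •
      fderiv ℂ f (x + circleMap 0 r θ • v)) (bound := fun _ => r * ((r ^ 2)⁻¹ * (M / R)))
    (ball_mem_nhds x0 hR)
    (Filter.eventually_of_mem (ball_mem_nhds x0 hR) fun x hx =>
      (hcont x hx).aestronglyMeasurable)
    ((hcont x0 (mem_ball_self hR)).intervalIntegrable _ _)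
    (by
      have h1 : Measurable (fun θ : ℝ => fderiv ℂ f (x0 + circleMap 0 r θ • v)) :=
        (measurable_fderiv ℂ f).comp ((differentiable_line x0 v).continuous.comp
          (continuous_circleMap 0 r)).measurable
      have h2 : Measurable (fun θ : ℝ => ((circleMap 0 r θ - 0) ^ 2)⁻¹) :=
        (((continuous_circleMap 0 r).sub continuous_const).pow 2).measurable.inv
      have h3 : Measurable (fun θ : ℝ => deriv (circleMap 0 r) θ •
          ((circleMap 0 r θ - 0) ^ 2)⁻¹ • fderiv ℂ f (x0 + circleMap 0 r θ • v)) :=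
        (measurable_deriv (circleMap 0 r)).smul (h2.smul h1)
      exact h3.aestronglyMeasurable)
    (Filter.Eventually.of_forall fun θ _ x hx => by
      rw [norm_smul, norm_smul]
      have h1 : ‖deriv (circleMap 0 r) θ‖ = r := by
        simp [deriv_circleMap, abs_of_pos hr]
      have h2 : ‖((circleMap 0 r θ - 0) ^ 2)⁻¹‖ = (r ^ 2)⁻¹ := by
        simp [norm_inv, norm_pow, abs_of_pos hr]
      rw [h1, h2]
      gcongr
      refine norm_fderiv_le_of_forall_closedBall hU hf hR
        ((hball x hx _ (hcirc θ)).trans hεU) fun y hy => ?_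
      exact hM y (hball x hx _ (hcirc θ) hy))
    (intervalIntegrable_const)
    (Filter.Eventually.of_forall fun θ _ x hx => by
      have h1 : HasFDerivAt f (fderiv ℂ f (x + circleMap 0 r θ • v)) (x + circleMap 0 r θ • v) :=
        (hf.differentiableAt (hU.mem_nhds (hmemU x hx _ (hcirc θ)))).hasFDerivAt
      have h2 := h1.comp x ((hasFDerivAt_id x).add_const (circleMap 0 r θ • v))
      exact (h2.const_smul ((circleMap 0 r θ - 0) ^ 2)⁻¹).const_smul (deriv (circleMap 0 r) θ))
  refine DifferentiableAt.differentiableWithinAt ?_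
  refine (hderiv.differentiableAt.const_smul ((2 * Real.pi * Complex.I : ℂ)⁻¹)).congr_of_eventuallyEq ?_
  filter_upwards [ball_mem_nhds x0 hR] with x hx
  rw [hformula x hx]
  rfl

end SeveralVariables

/-! ### Homogeneous expansions on the spectral ball -/

section HomogeneousExpansion

open Metric

lemma exists_one_lt_forall_smul_mem {K : Set M2} (hK : IsCompact K) (hKS : K ⊆ SpectralBall) :
    ∃ r : ℝ, 1 < r ∧ ∀ x ∈ K, ∀ q : ℂ, ‖q‖ ≤ r → q • x ∈ SpectralBall := by
  have hC : IsCompact ((fun p : ℂ × M2 => p.1 • p.2) '' (closedBall 0 1 ×ˢ K)) :=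
    ((isCompact_closedBall 0 1).prod hK).image (continuous_fst.smul continuous_snd)
  have hCS : (fun p : ℂ × M2 => p.1 • p.2) '' (closedBall 0 1 ×ˢ K) ⊆ SpectralBall := by
    rintro _ ⟨⟨q, x⟩, ⟨hq, hx⟩, rfl⟩
    exact smul_mem_spectralBall (hKS hx) (by simpa using hq)
  obtain ⟨δ, hδ, hsub⟩ := hC.exists_cthickening_subset_open isOpen_spectralBall hCS
  obtain ⟨B, hB⟩ := hK.isBounded.exists_norm_le
  set d : ℝ := δ / (|B| + 1) with hd
  have hd0 : 0 < d := by positivity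
  refine ⟨1 + d, by linarith, fun x hx q hq => hsub ?_⟩
  have h1 : (1 + d : ℂ) ≠ 0 := by
    have : (1 + d : ℝ) ≠ 0 := by positivity
    exact_mod_cast this
  have hn : ‖(1 + d : ℂ)‖ = 1 + d := by
    rw [show (1 + d : ℂ) = ((1 + d : ℝ) : ℂ) by push_cast; rfl, Complex.norm_real,
      Real.norm_of_nonneg (by positivity)]
  have hq1 : ‖q / (1 + d)‖ ≤ 1 := by
    rw [norm_div, hn, div_le_one (by positivity)]; exact hq
  refine mem_cthickening_of_dist_le (q • x) ((q / (1 + d)) • x) δ _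
    ⟨(q / (1 + d), x), ⟨by simpa using hq1, hx⟩, rfl⟩ ?_
  have h2 : q • x - (q / (1 + d)) • x = ((q / (1 + d)) * d) • x := by
    rw [← sub_smul]; congr 1; field_simp; ring
  rw [dist_eq_norm, h2, norm_smul, norm_mul, Complex.norm_real, Real.norm_of_nonneg hd0.le]
  have h3 : ‖x‖ ≤ |B| + 1 := (hB x hx).trans ((le_abs_self B).trans (by linarith))
  calc ‖q / (1 + d)‖ * d * ‖x‖ ≤ 1 * d * (|B| + 1) := by gcongr
    _ = δ := by rw [hd]; field_simp

lemma isOpen_smul_preimage (x : M2) : IsOpen {ζ : ℂ | ζ • x ∈ SpectralBall} :=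
  isOpen_spectralBall.preimage (continuous_id.smul continuous_const)

lemma zero_mem_smul_preimage (x : M2) : (0 : ℂ) ∈ {ζ : ℂ | ζ • x ∈ SpectralBall} := by
  simpa using zero_mem_spectralBall

lemma differentiableOn_comp_smul {F : Type*} [NormedAddCommGroup F] [NormedSpace ℂ F]
    {g : M2 → F} (hg : DifferentiableOn ℂ g SpectralBall) (x : M2) :
    DifferentiableOn ℂ (fun ζ : ℂ => g (ζ • x)) {ζ : ℂ | ζ • x ∈ SpectralBall} :=
  hg.comp (differentiable_id.smul_const x).differentiableOn fun _ h => h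

lemma contDiffAt_comp_smul {g : M2 → ℂ} (hg : DifferentiableOn ℂ g SpectralBall) (x : M2)
    (n : ℕ) : ContDiffAt ℂ n (fun ζ : ℂ => g (ζ • x)) 0 :=
  ((differentiableOn_comp_smul hg x).contDiffOn (isOpen_smul_preimage x)).contDiffAt
    ((isOpen_smul_preimage x).mem_nhds (zero_mem_smul_preimage x))

lemma iteratedDeriv_sum_sum_mul (k : ℕ) (c : Fin 2 → Fin 2 → ℂ) (t : Fin 2 → Fin 2 → ℂ → ℂ)
    (ht : ∀ i j, ContDiffAt ℂ k (t i j) 0) :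
    iteratedDeriv k (fun ζ => ∑ i, ∑ j, c i j * t i j ζ) 0 =
      ∑ i, ∑ j, c i j * iteratedDeriv k (t i j) 0 := by
  rw [iteratedDeriv_fun_sum fun i _ => ContDiffAt.sum fun j _ => contDiffAt_const.mul (ht i j)]
  refine Finset.sum_congr rfl fun i _ => ?_
  rw [iteratedDeriv_fun_sum fun j _ => contDiffAt_const.mul (ht i j)]
  exact Finset.sum_congr rfl fun j _ => iteratedDeriv_const_mul_field _ _

lemma iteratedDeriv_comp_smul_mem_polyFuns (k : ℕ) {g : M2 → ℂ}
    (hg : DifferentiableOn ℂ g SpectralBall) :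
    (fun x : M2 => iteratedDeriv k (fun ζ : ℂ => g (ζ • x)) 0) ∈ polyFuns := by
  induction k generalizing g with
  | zero =>
    simp only [iteratedDeriv_zero, zero_smul]
    exact polyFuns.algebraMap_mem (g 0)
  | succ k ih =>
    have hpart : ∀ i j : Fin 2, DifferentiableOn ℂ
        (fun y => fderiv ℂ g y (Matrix.single i j (1 : ℂ))) SpectralBall := fun i j =>
      differentiableOn_fderiv_apply isOpen_spectralBall hg _
    have key : (fun x : M2 => iteratedDeriv (k + 1) (fun ζ : ℂ => g (ζ • x)) 0) =
        ∑ i, ∑ j, (fun x : M2 => x i j) * (fun x : M2 => iteratedDeriv k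
          (fun ζ : ℂ => fderiv ℂ g (ζ • x) (Matrix.single i j (1 : ℂ))) 0) := by
      funext x
      have hev : deriv (fun ζ : ℂ => g (ζ • x)) =ᶠ[nhds 0]
          fun ζ => ∑ i, ∑ j, x i j * fderiv ℂ g (ζ • x) (Matrix.single i j (1 : ℂ)) := by
        filter_upwards [(isOpen_smul_preimage x).mem_nhds (zero_mem_smul_preimage x)] with ζ hζ
        have hd : DifferentiableAt ℂ g (0 + ζ • x) := by
          rw [zero_add]; exact hg.differentiableAt (isOpen_spectralBall.mem_nhds hζ)
        have h1 := (hasDerivAt_comp_line hd).deriv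
        simp only [zero_add] at h1
        rw [h1]
        have hdec : x = ∑ i, ∑ j, x i j • Matrix.single i j (1 : ℂ) := by
          conv_lhs => rw [Matrix.matrix_eq_sum_single x]
          simp only [Matrix.smul_single, smul_eq_mul, mul_one]
        refine (congrArg (fderiv ℂ g (ζ • x)) hdec).trans ?_
        simp only [map_sum, map_smul, smul_eq_mul]
      rw [iteratedDeriv_succ', hev.iteratedDeriv_eq]
      refine (iteratedDeriv_sum_sum_mul k (fun i j => x i j) _ fun i j =>
        contDiffAt_comp_smul (hpart i j) x k).trans ?_
      simp only [Finset.sum_apply, Pi.mul_apply]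
    rw [key]
    exact Subalgebra.sum_mem _ fun i _ => Subalgebra.sum_mem _ fun j _ =>
      polyFuns.mul_mem (entry_mem_polyFuns i j) (ih (hpart i j))

/-- The homogeneous part of degree `k` of a scalar function holomorphic near the origin. -/
def homPart (k : ℕ) (g : M2 → ℂ) (x : M2) : ℂ :=
  (k.factorial : ℂ)⁻¹ * iteratedDeriv k (fun ζ : ℂ => g (ζ • x)) 0

lemma homPart_mem_polyFuns (k : ℕ) {g : M2 → ℂ} (hg : DifferentiableOn ℂ g SpectralBall) :
    homPart k g ∈ polyFuns :=
  polyFuns.smul_mem (iteratedDeriv_comp_smul_mem_polyFuns k hg) (k.factorial : ℂ)⁻¹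

lemma exists_norm_sub_sum_homPart_le {g : M2 → ℂ} (hg : DifferentiableOn ℂ g SpectralBall)
    {K : Set M2} (hK : IsCompact K) (hKS : K ⊆ SpectralBall) {η : ℝ} (hη : 0 < η) :
    ∃ N : ℕ, ∀ n ≥ N, ∀ x ∈ K, ∀ q : ℂ, ‖q‖ ≤ 1 →
      ‖g (q • x) - ∑ k ∈ Finset.range n, q ^ k * homPart k g x‖ ≤ η := by
  obtain ⟨r, hr, hrK⟩ := exists_one_lt_forall_smul_mem hK hKS
  have hr0 : 0 < r := by linarith
  have hC : IsCompact ((fun p : ℂ × M2 => p.1 • p.2) '' (closedBall 0 r ×ˢ K)) :=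
    ((isCompact_closedBall 0 r).prod hK).image (continuous_fst.smul continuous_snd)
  have hCS : (fun p : ℂ × M2 => p.1 • p.2) '' (closedBall 0 r ×ˢ K) ⊆ SpectralBall := by
    rintro _ ⟨⟨q, x⟩, ⟨hq, hx⟩, rfl⟩
    exact hrK x hx q (by simpa using hq)
  obtain ⟨M, hM⟩ := hC.exists_bound_of_continuousOn (hg.continuousOn.mono hCS)
  have hMx : ∀ x ∈ K, ∀ ζ ∈ closedBall (0 : ℂ) r, ‖g (ζ • x)‖ ≤ M := fun x hx ζ hζ =>
    hM _ ⟨(ζ, x), ⟨hζ, hx⟩, rfl⟩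
  have hdiff : ∀ x ∈ K, DifferentiableOn ℂ (fun ζ : ℂ => g (ζ • x)) (closedBall 0 r) :=
    fun x hx => (differentiableOn_comp_smul hg x).mono fun ζ hζ => hrK x hx ζ (by simpa using hζ)
  have hcoeff : ∀ x ∈ K, ∀ k, ‖homPart k g x‖ ≤ M * (r⁻¹) ^ k := by
    intro x hx k
    have h1 := Complex.norm_iteratedDeriv_le_of_forall_mem_sphere_norm_le k hr0
      ((hdiff x hx).diffContOnCl_ball subset_rfl)
      (fun ζ hζ => hMx x hx ζ (sphere_subset_closedBall hζ))
    rw [homPart, norm_mul, norm_inv, Complex.norm_natCast, inv_pow]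
    have hk : (0 : ℝ) < k.factorial := by exact_mod_cast k.factorial_pos
    rw [inv_mul_le_iff₀ hk]
    exact h1.trans_eq (by ring)
  have hgeo : Filter.Tendsto (fun n : ℕ => |M| * (r⁻¹) ^ n / (1 - r⁻¹)) Filter.atTop (nhds 0) := by
    have := ((tendsto_pow_atTop_nhds_zero_of_lt_one (inv_nonneg.2 hr0.le)
      (inv_lt_one_of_one_lt₀ hr)).const_mul |M|).div_const (1 - r⁻¹)
    simpa using this
  obtain ⟨N, hN⟩ := Filter.eventually_atTop.1 (hgeo.eventually_le_const hη)
  refine ⟨N, fun n hn x hx q hq => le_trans ?_ (hN n hn)⟩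
  have hsum : HasSum (fun k => q ^ k * homPart k g x) (g (q • x)) := by
    have h1 := Complex.hasSum_taylorSeries_on_ball (r := r) (c := 0)
      ((hdiff x hx).mono ball_subset_closedBall) (z := q) (by simpa using lt_of_le_of_lt hq hr)
    refine h1.congr_fun fun k => ?_
    rw [homPart, sub_zero, smul_eq_mul]
    ring
  have hterm : ∀ k, ‖q ^ k * homPart k g x‖ ≤ |M| * (r⁻¹) ^ k := fun k => by
    rw [norm_mul, norm_pow]
    calc ‖q‖ ^ k * ‖homPart k g x‖ ≤ 1 * (|M| * (r⁻¹) ^ k) := by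
          gcongr
          · exact pow_le_one₀ (norm_nonneg _) hq
          · exact (hcoeff x hx k).trans (by gcongr; exact le_abs_self M)
      _ = _ := one_mul _
  have h2 := norm_sub_le_of_geometric_bound_of_hasSum (inv_lt_one_of_one_lt₀ hr) hterm hsum n
  rw [norm_sub_rev]
  exact h2

/-- A vector field on the spectral ball annihilating the trace and the determinant. -/
def IsTangentField (W : M2 → M2) : Prop := ∀ x ∈ SpectralBall, W x 1 1 = -W x 0 0 ∧
  (x 0 0 - x 1 1) * W x 0 0 + x 0 1 * W x 1 0 + x 1 0 * W x 0 1 = 0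

/-- The homogeneous part of degree `k` of a trace-free vector field. -/
def homField (k : ℕ) (W : M2 → M2) (x : M2) : M2 :=
  !![homPart k (fun y => W y 0 0) x, homPart k (fun y => W y 0 1) x;
    homPart k (fun y => W y 1 0) x, -homPart k (fun y => W y 0 0) x]

lemma homField_mem_flowFields (k : ℕ) {W : M2 → M2} (hW : DifferentiableOn ℂ W SpectralBall)
    (ht : IsTangentField W) : homField k W ∈ flowFields := by
  have hent : ∀ i j, DifferentiableOn ℂ (fun y => W y i j) SpectralBall := fun i j => hW.entry i j
  refine tangent_mem_flowFields (homPart_mem_polyFuns k (hent 0 0))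
    (homPart_mem_polyFuns k (hent 0 1)) (homPart_mem_polyFuns k (hent 1 0)) fun x => ?_
  let c : Fin 2 → Fin 2 → ℂ := ![![x 0 0 - x 1 1, x 1 0], ![x 0 1, 0]]
  have hsum := iteratedDeriv_sum_sum_mul k c (fun i j ζ => W (ζ • x) i j) fun i j =>
    contDiffAt_comp_smul (hent i j) x k
  have hopen := isOpen_smul_preimage x
  have h0 := zero_mem_smul_preimage x
  have hev : (fun ζ : ℂ => ∑ i, ∑ j, c i j * W (ζ • x) i j) =ᶠ[nhds 0] fun _ => 0 := by
    have hcont : ContinuousAt (fun ζ : ℂ => ∑ i, ∑ j, c i j * W (ζ • x) i j) 0 := by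
      refine tendsto_finsetSum _ fun i _ => tendsto_finsetSum _ fun j _ => ?_
      exact (contDiffAt_comp_smul (hent i j) x 0).continuousAt.const_mul (c i j)
    have hne : ∀ ζ ∈ {ζ : ℂ | ζ • x ∈ SpectralBall}, ζ ≠ 0 →
        ∑ i, ∑ j, c i j * W (ζ • x) i j = 0 := by
      intro ζ hζ hζ0
      have h1 := (ht _ hζ).2
      simp only [Matrix.smul_apply, smul_eq_mul] at h1
      simp only [Fin.sum_univ_two, c, Matrix.cons_val_zero, Matrix.cons_val_one,
        Matrix.cons_val_fin_one, zero_mul, add_zero]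
      refine (mul_eq_zero.1 (?_ : ζ * _ = 0)).resolve_left hζ0
      linear_combination h1
    have hz : ∑ i, ∑ j, c i j * W ((0 : ℂ) • x) i j = 0 := by
      refine tendsto_nhds_unique (hcont.tendsto.mono_left (nhdsWithin_le_nhds (s := {0}ᶜ))) ?_
      refine tendsto_const_nhds.congr' ?_
      filter_upwards [self_mem_nhdsWithin, nhdsWithin_le_nhds (hopen.mem_nhds h0)] with ζ h1 h2
      exact (hne ζ h2 h1).symm
    filter_upwards [hopen.mem_nhds h0] with ζ hζ
    by_cases hζ0 : ζ = 0
    · rw [hζ0]; exact hz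
    · exact hne ζ hζ hζ0
  rw [hev.iteratedDeriv_eq] at hsum
  simp only [iteratedDeriv_const, ite_self, Fin.sum_univ_two, c, Matrix.cons_val_zero,
    Matrix.cons_val_one, Matrix.cons_val_fin_one, zero_mul, add_zero] at hsum
  simp only [homPart]
  linear_combination (-(k.factorial : ℂ)⁻¹) * hsum

lemma continuous_homField (k : ℕ) {W : M2 → M2} (hW : DifferentiableOn ℂ W SpectralBall) :
    Continuous (homField k W) := by
  have h : ∀ i j, Continuous (homPart k fun y => W y i j) := fun i j =>
    continuous_of_mem_polyFuns (homPart_mem_polyFuns k (hW.entry i j))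
  refine continuous_matrix fun i j => ?_
  fin_cases i <;> fin_cases j
  · exact h 0 0
  · exact h 0 1
  · exact h 1 0
  · exact (h 0 0).neg

lemma exists_norm_sub_sum_homField_le {W : M2 → M2} (hW : DifferentiableOn ℂ W SpectralBall)
    (ht : IsTangentField W) {K : Set M2} (hK : IsCompact K) (hKS : K ⊆ SpectralBall) {η : ℝ}
    (hη : 0 < η) : ∃ N : ℕ, ∀ x ∈ K, ∀ q : ℂ, ‖q‖ ≤ 1 →
      ‖W (q • x) - ∑ k ∈ Finset.range N, q ^ k • homField k W x‖ ≤ η := by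
  have hent : ∀ i j, DifferentiableOn ℂ (fun y => W y i j) SpectralBall := fun i j => hW.entry i j
  choose N hN using fun i j => exists_norm_sub_sum_homPart_le (hent i j) hK hKS hη
  refine ⟨∑ i, ∑ j, N i j, fun x hx q hq => (Matrix.norm_le_iff hη.le).2 fun i j => ?_⟩
  have hle : ∀ i j, N i j ≤ ∑ i, ∑ j, N i j := fun i j =>
    (Finset.single_le_sum (f := fun j => N i j) (fun _ _ => Nat.zero_le _) (Finset.mem_univ j)).trans
      (Finset.single_le_sum (f := fun i => ∑ j, N i j) (fun _ _ => Nat.zero_le _)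
        (Finset.mem_univ i))
  have hqx : q • x ∈ SpectralBall := smul_mem_spectralBall (hKS hx) hq
  have hb := fun i j => hN i j _ (hle i j) x hx q hq
  have hsub : (W (q • x) - ∑ k ∈ Finset.range (∑ i, ∑ j, N i j), q ^ k • homField k W x) i j =
      W (q • x) i j - ∑ k ∈ Finset.range (∑ i, ∑ j, N i j), q ^ k * homField k W x i j := by
    rw [Matrix.sub_apply, Matrix.sum_apply]; rfl
  rw [hsub]
  fin_cases i <;> fin_cases j
  · exact hb 0 0
  · exact hb 0 1
  · exact hb 1 0
  · have h1 := hb 0 0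
    rw [← norm_neg] at h1
    refine (congrArg norm ?_).trans_le h1
    have h2 := (ht _ hqx).1
    simp only [Fin.mk_one, Fin.isValue, homField, Matrix.of_apply, Matrix.cons_val', 
      Matrix.cons_val_one, Matrix.cons_val_fin_one, h2, mul_neg, Finset.sum_neg_distrib]
    ring

end HomogeneousExpansion

/-! ### Euler's method -/

section EulerMethod

open Metric

lemma norm_sub_sub_smul_deriv_le {F : Type*} [NormedAddCommGroup F] [NormedSpace ℂ F]
    [CompleteSpace F] {g : ℂ → F} {c : ℂ} {ρ M : ℝ} (hρ : 0 < ρ)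
    (hg : DifferentiableOn ℂ g (closedBall c (3 * ρ)))
    (hM : ∀ z ∈ closedBall c (3 * ρ), ‖g z‖ ≤ M) {τ : ℂ} (hτ : ‖τ‖ ≤ ρ) :
    ‖g (c + τ) - g c - τ • deriv g c‖ ≤ M / ρ ^ 2 * ‖τ‖ ^ 2 := by
  have hM0 : 0 ≤ M := (norm_nonneg _).trans (hM c (mem_closedBall_self (by positivity)))
  have hsub : ∀ {z : ℂ} {a b : ℝ}, z ∈ closedBall c a → a + ρ ≤ b →
      closedBall z ρ ⊆ closedBall c b := fun {z a b} hz hab =>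
    closedBall_subset_closedBall' (by rw [mem_closedBall] at hz; linarith)
  have hg' : DifferentiableOn ℂ (deriv g) (ball c (3 * ρ)) :=
    (hg.mono ball_subset_closedBall).deriv isOpen_ball
  have h1 : ∀ z ∈ closedBall c (2 * ρ), ‖deriv g z‖ ≤ M / ρ := by
    intro z hz
    have hs := hsub (b := 3 * ρ) hz (by linarith)
    exact Complex.norm_deriv_le_of_forall_mem_sphere_norm_le hρ
      ((hg.mono hs).diffContOnCl_ball subset_rfl) fun w hw => hM w (hs (sphere_subset_closedBall hw))
  have h2 : ∀ z ∈ closedBall c ρ, ‖deriv (deriv g) z‖ ≤ M / ρ / ρ := by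
    intro z hz
    have hs := hsub (b := 2 * ρ) hz (by linarith)
    refine Complex.norm_deriv_le_of_forall_mem_sphere_norm_le hρ
      ((hg'.mono (hs.trans (closedBall_subset_ball (by linarith)))).diffContOnCl_ball subset_rfl)
      fun w hw => h1 w (hs (sphere_subset_closedBall hw))
  have hmemb : ∀ z ∈ closedBall c ‖τ‖, z ∈ closedBall c ρ := fun z hz =>
    closedBall_subset_closedBall hτ hz
  have hmem3 : ∀ z ∈ closedBall c ρ, z ∈ ball c (3 * ρ) := fun z hz =>
    closedBall_subset_ball (by linarith) hz
  have hgd : ∀ z ∈ ball c (3 * ρ), DifferentiableAt ℂ g z := fun z hz =>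
    (hg.mono ball_subset_closedBall).differentiableAt (isOpen_ball.mem_nhds hz)
  have h3 : ∀ z ∈ closedBall c ‖τ‖, ‖deriv g z - deriv g c‖ ≤ M / ρ / ρ * ‖τ‖ := by
    intro z hz
    have h := (convex_closedBall c ρ).norm_image_sub_le_of_norm_deriv_le (𝕜 := ℂ)
      (fun w hw => hg'.differentiableAt (isOpen_ball.mem_nhds (hmem3 w hw))) h2
      (mem_closedBall_self hρ.le) (hmemb z hz)
    refine h.trans (mul_le_mul_of_nonneg_left ?_ (by positivity))
    rw [← dist_eq_norm]; exact hz
  have h4 : ∀ z ∈ closedBall c ‖τ‖, HasDerivWithinAt (fun z => g z - (z - c) • deriv g c)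
      (deriv g z - deriv g c) (closedBall c ‖τ‖) z := by
    intro z hz
    have ha := (hgd z (hmem3 z (hmemb z hz))).hasDerivAt
    have hb := ((hasDerivAt_id z).sub_const c).smul_const (deriv g c)
    rw [one_smul] at hb
    exact (ha.sub hb).hasDerivWithinAt
  have h5 := (convex_closedBall c ‖τ‖).norm_image_sub_le_of_norm_hasDerivWithin_le h4 h3
    (mem_closedBall_self (norm_nonneg _)) (y := c + τ) (by simp)
  have h6 : g (c + τ) - (c + τ - c) • deriv g c - (g c - (c - c) • deriv g c) =
      g (c + τ) - g c - τ • deriv g c := by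
    simp only [add_sub_cancel_left, sub_self, zero_smul]; abel
  rw [h6, add_sub_cancel_left] at h5
  refine h5.trans_eq ?_
  field_simp

/-- The one-step maps `G q h` are uniformly of the form `x + h V q x + o(h)` on compact sets. -/
def IsConsistent (ε : ℝ) (G : ℝ → ℝ → M2 → M2) (V : ℝ → M2 → M2) : Prop :=
  ∀ K : Set M2, IsCompact K → ∀ η : ℝ, 0 < η → ∃ h₀ : ℝ, 0 < h₀ ∧ ∀ q ∈ Icc ε 1,
    ∀ h ∈ Icc 0 h₀, ∀ x ∈ K, ‖G q h x - x - (h : ℂ) • V q x‖ ≤ η * h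

lemma exists_isConsistent_of_mem_flowFields {W : M2 → M2} (hW : W ∈ flowFields) {ε C : ℝ}
    {c : ℝ → ℂ} (hc : ∀ q ∈ Icc ε 1, ‖c q‖ ≤ C) :
    ∃ G : ℝ → ℝ → M2 → M2, (∀ q h, IsGenerated (G q h)) ∧
      IsConsistent ε G (fun q x => c q • W x) := by
  obtain ⟨F, hF, hF0, hFd, hFg⟩ := hW
  refine ⟨fun q h x => F (c q * h, x), fun q h => hFg _, fun K hK η hη => ?_⟩
  obtain ⟨M, hM⟩ := ((isCompact_closedBall (0 : ℂ) 3).prod hK).exists_bound_of_continuousOn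
    hF.continuous.continuousOn
  refine ⟨min (|C| + 1)⁻¹ (η / (|M| * C ^ 2 + 1)), by positivity, fun q hq h hh x hx => ?_⟩
  have hcq := (hc q hq).trans (le_abs_self C)
  have hh1 : h * (|C| + 1) ≤ 1 := by
    have := hh.2.trans (min_le_left _ _)
    rwa [inv_eq_one_div, le_div_iff₀ (by positivity)] at this
  have hh2 : h * (|M| * C ^ 2 + 1) ≤ η := by
    have := hh.2.trans (min_le_right _ _)
    rwa [le_div_iff₀ (by positivity)] at this
  have hn : ‖c q * (h : ℂ)‖ = ‖c q‖ * h := by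
    rw [norm_mul, Complex.norm_real, Real.norm_of_nonneg hh.1]
  have hτ : ‖c q * (h : ℂ)‖ ≤ 1 := by
    rw [hn]
    nlinarith [mul_le_mul_of_nonneg_right hcq hh.1, hh.1]
  have key := norm_sub_sub_smul_deriv_le (g := fun τ => F (τ, x)) (c := 0) (ρ := 1) (M := M)
    one_pos (by
      have : Differentiable ℂ (fun τ : ℂ => F (τ, x)) :=
        hF.comp (differentiable_id.prodMk (differentiable_const x))
      exact this.differentiableOn)
    (fun z hz => hM (z, x) ⟨by simpa using hz, hx⟩) hτ
  rw [zero_add, hF0, (hFd x).deriv, hn, one_pow, div_one, mul_pow] at key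
  rw [smul_smul, mul_comm (h : ℂ)]
  refine key.trans ?_
  have h3 : ‖c q‖ ^ 2 ≤ C ^ 2 := by
    rw [← sq_abs C]; gcongr
  calc M * (‖c q‖ ^ 2 * h ^ 2) ≤ |M| * (C ^ 2 * h ^ 2) := by
        gcongr
        exact le_abs_self M
    _ = h * (|M| * C ^ 2) * h := by ring
    _ ≤ η * h := mul_le_mul_of_nonneg_right (by linarith [hh.1]) hh.1

lemma IsConsistent.add {ε : ℝ} {G G' : ℝ → ℝ → M2 → M2} {V V' : ℝ → M2 → M2}
    (hG : IsConsistent ε G V) (hG' : IsConsistent ε G' V')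
    (hV : ∀ K : Set M2, IsCompact K → ∀ η : ℝ, 0 < η → ∃ δ : ℝ, 0 < δ ∧ ∀ q ∈ Icc ε 1,
      ∀ x ∈ K, ∀ y, ‖y - x‖ ≤ δ → ‖V q y - V q x‖ ≤ η)
    (hV' : ∀ K : Set M2, IsCompact K → ∃ B, ∀ q ∈ Icc ε 1, ∀ x ∈ K, ‖V' q x‖ ≤ B) :
    IsConsistent ε (fun q h x => G q h (G' q h x)) (fun q x => V q x + V' q x) := by
  intro K hK η hη
  obtain ⟨h₁, hh₁, H₁⟩ := hG (cthickening 1 K) hK.cthickening (η / 3) (by positivity)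
  obtain ⟨h₂, hh₂, H₂⟩ := hG' K hK (min (η / 3) 1) (by positivity)
  obtain ⟨δ, hδ, Hδ⟩ := hV K hK (η / 3) (by positivity)
  obtain ⟨B, hB⟩ := hV' K hK
  refine ⟨min (min h₁ h₂) (min δ 1 / (|B| + 1)), by positivity, fun q hq h hh x hx => ?_⟩
  have hle1 : h ≤ h₁ := hh.2.trans ((min_le_left _ _).trans (min_le_left _ _))
  have hle2 : h ≤ h₂ := hh.2.trans ((min_le_left _ _).trans (min_le_right _ _))
  have hle3 : h * (|B| + 1) ≤ min δ 1 := by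
    have := hh.2.trans (min_le_right _ _)
    rwa [le_div_iff₀ (by positivity)] at this
  set y := G' q h x with hy
  have e2 := H₂ q hq h ⟨hh.1, hle2⟩ x hx
  rw [← hy] at e2
  have hnh : ‖(h : ℂ)‖ = h := by rw [Complex.norm_real, Real.norm_of_nonneg hh.1]
  have hyx : ‖y - x‖ ≤ min δ 1 := by
    have h1 : y - x = (y - x - (h : ℂ) • V' q x) + (h : ℂ) • V' q x := by abel
    rw [h1]
    refine (norm_add_le _ _).trans (le_trans ?_ hle3)
    rw [norm_smul, hnh]
    have h2 := (hB q hq x hx).trans (le_abs_self B)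
    have h3 := e2.trans (mul_le_mul_of_nonneg_right (min_le_right _ _) hh.1)
    nlinarith [mul_le_mul_of_nonneg_left h2 hh.1]
  have hyK : y ∈ cthickening 1 K := mem_cthickening_of_dist_le y x 1 K hx (by
    rw [dist_eq_norm]; exact hyx.trans (min_le_right _ _))
  have e1 := H₁ q hq h ⟨hh.1, hle1⟩ y hyK
  have e3 := Hδ q hq x hx y (hyx.trans (min_le_left _ _))
  have e2' := e2.trans (mul_le_mul_of_nonneg_right (min_le_left _ _) hh.1)
  have hdec : G q h y - x - (h : ℂ) • (V q x + V' q x) = (G q h y - y - (h : ℂ) • V q y) +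
      (y - x - (h : ℂ) • V' q x) + (h : ℂ) • (V q y - V q x) := by
    rw [smul_add, smul_sub]; abel
  change ‖G q h y - x - (h : ℂ) • (V q x + V' q x)‖ ≤ η * h
  rw [hdec]
  refine (norm_add₃_le).trans ?_
  rw [norm_smul, hnh]
  nlinarith [mul_le_mul_of_nonneg_left e3 hh.1]

lemma exists_isConsistent_sum {H : ℕ → M2 → M2} (hH : ∀ k, H k ∈ flowFields)
    (hHc : ∀ k, Continuous (H k)) {ε : ℝ} {C : ℕ → ℝ} {c : ℕ → ℝ → ℂ}
    (hc : ∀ k, ∀ q ∈ Icc ε 1, ‖c k q‖ ≤ C k) (N : ℕ) :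
    ∃ G : ℝ → ℝ → M2 → M2, (∀ q h, IsGenerated (G q h)) ∧
      IsConsistent ε G (fun q x => ∑ k ∈ Finset.range N, c k q • H k x) := by
  induction N with
  | zero =>
    refine ⟨fun _ _ => id, fun _ _ => isGenerated_id, fun K _ η hη => ⟨1, one_pos, ?_⟩⟩
    intro q _ h hh x _
    have : id x - x - (h : ℂ) • ∑ k ∈ Finset.range 0, c k q • H k x = 0 := by simp
    rw [this, norm_zero]
    exact mul_nonneg hη.le hh.1
  | succ N ih =>
    obtain ⟨G', hG'g, hG'⟩ := ih
    obtain ⟨G, hGg, hG⟩ := exists_isConsistent_of_mem_flowFields (hH N) (hc N)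
    have hC0 : ∀ k, ∀ q ∈ Icc ε 1, ‖c k q‖ ≤ |C k| := fun k q hq =>
      (hc k q hq).trans (le_abs_self _)
    refine ⟨fun q h x => G q h (G' q h x), fun q h => (hGg q h).comp (hG'g q h), ?_⟩
    have key := hG.add hG' (fun K hK η hη => by
      have huc := (hK.cthickening (r := 1)).uniformContinuousOn_of_continuous
        (hHc N).continuousOn
      obtain ⟨δ, hδ, Hδ⟩ := Metric.uniformContinuousOn_iff.1 huc (η / (|C N| + 1)) (by positivity)
      refine ⟨min (δ / 2) 1, by positivity, fun q hq x hx y hy => ?_⟩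
      have hyx : dist y x ≤ min (δ / 2) 1 := by rw [dist_eq_norm]; exact hy
      have h1 := Hδ y (mem_cthickening_of_dist_le y x 1 K hx (hyx.trans (min_le_right _ _))) x
        (self_subset_cthickening K hx) (by
          have := hyx.trans (min_le_left _ _); linarith)
      rw [dist_eq_norm, lt_div_iff₀ (by positivity)] at h1
      rw [← smul_sub, norm_smul]
      have h2 := hC0 N q hq
      nlinarith [norm_nonneg (H N y - H N x), mul_le_mul_of_nonneg_right h2
        (norm_nonneg (H N y - H N x))])
      (fun K hK => by
        choose B hB using fun k => hK.exists_bound_of_continuousOn (hHc k).continuousOn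
        refine ⟨∑ k ∈ Finset.range N, |C k| * B k, fun q hq x hx => ?_⟩
        refine norm_sum_le_of_le _ fun k _ => ?_
        rw [norm_smul]
        exact mul_le_mul (hC0 k q hq) (hB k x hx) (norm_nonneg _) (abs_nonneg _))
    simp only [Finset.sum_range_succ_comm]
    exact key

/-- The composition of the Euler steps `G (a + i h) h`, `i < n`. -/
def eulerMap {E : Type*} (G : ℝ → ℝ → E → E) (a h : ℝ) : ℕ → E → E
  | 0 => id
  | n + 1 => fun x => G (a + n * h) h (eulerMap G a h n x)

lemma isGenerated_eulerMap {G : ℝ → ℝ → M2 → M2} (hG : ∀ q h, IsGenerated (G q h)) (a h : ℝ)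
    (n : ℕ) : IsGenerated (eulerMap G a h n) := by
  induction n with
  | zero => exact isGenerated_id
  | succ n ih => exact (hG _ _).comp ih

lemma norm_eulerMap_sub_le {E : Type*} [NormedAddCommGroup E] [NormedSpace ℂ E]
    {G : ℝ → ℝ → E → E} {V : ℝ → E → E} {p : ℝ → E} {ε δ Λ η h : ℝ} {n : ℕ}
    (hε : 0 ≤ ε) (hΛ : 0 ≤ Λ) (hη : 0 ≤ η) (hh : 0 ≤ h) (hn : ε + n * h = 1)
    (hVL : ∀ q ∈ Icc ε 1, ∀ y, ‖y - p q‖ ≤ δ → ‖V q y - V q (p q)‖ ≤ Λ * ‖y - p q‖)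
    (hp : ∀ q ∈ Icc ε 1, q + h ≤ 1 → ‖p (q + h) - p q - (h : ℂ) • V q (p q)‖ ≤ η * h)
    (hG : ∀ q ∈ Icc ε 1, ∀ y, ‖y - p q‖ ≤ δ → ‖G q h y - y - (h : ℂ) • V q y‖ ≤ 2 * η * h)
    (hδ : 3 * η * Real.exp Λ ≤ δ) :
    ‖eulerMap G ε h n (p ε) - p 1‖ ≤ 3 * η * Real.exp Λ := by
  have hbound : ∀ i ≤ n, 3 * η * h * i * (1 + h * Λ) ^ i ≤ 3 * η * Real.exp Λ := by
    intro i hi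
    have hi' : (i : ℝ) ≤ n := by exact_mod_cast hi
    have h1 : h * i ≤ 1 := by nlinarith
    have h2 : (1 + h * Λ) ^ i ≤ Real.exp Λ := by
      calc (1 + h * Λ) ^ i ≤ (Real.exp (h * Λ)) ^ i := by
            gcongr
            linarith [Real.add_one_le_exp (h * Λ)]
        _ = Real.exp (i * (h * Λ)) := (Real.exp_nat_mul _ _).symm
        _ ≤ Real.exp Λ := Real.exp_le_exp.2 (by nlinarith)
    calc 3 * η * h * i * (1 + h * Λ) ^ i = 3 * η * ((h * i) * (1 + h * Λ) ^ i) := by ring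
      _ ≤ 3 * η * (1 * Real.exp Λ) := by gcongr
      _ = _ := by ring
  have key : ∀ i ≤ n, ‖eulerMap G ε h i (p ε) - p (ε + i * h)‖ ≤
      3 * η * h * i * (1 + h * Λ) ^ i := by
    intro i
    induction i with
    | zero => intro _; simp [eulerMap]
    | succ i ih =>
      intro hi
      have hi' : ((i : ℝ) + 1) ≤ n := by exact_mod_cast hi
      have e := ih (Nat.le_of_succ_le hi)
      set q := ε + i * h with hq
      set x := eulerMap G ε h i (p ε) with hx
      have hq1 : q + h ≤ 1 := by rw [hq, ← hn]; nlinarith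
      have hqm : q ∈ Icc ε 1 := ⟨by rw [hq]; nlinarith [(Nat.cast_nonneg i : (0:ℝ) ≤ i)], by linarith⟩
      have hxδ : ‖x - p q‖ ≤ δ := e.trans ((hbound i (Nat.le_of_succ_le hi)).trans hδ)
      have e1 := hG q hqm x hxδ
      have e2 := hp q hqm hq1
      have e3 := hVL q hqm x hxδ
      have hstep : eulerMap G ε h (i + 1) (p ε) = G q h x := rfl
      have hqs : ε + ((i + 1 : ℕ) : ℝ) * h = q + h := by rw [hq]; push_cast; ring
      rw [hstep, hqs]
      have hdec : G q h x - p (q + h) = (G q h x - x - (h : ℂ) • V q x) +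
          (h : ℂ) • (V q x - V q (p q)) - (p (q + h) - p q - (h : ℂ) • V q (p q)) + (x - p q) := by
        rw [smul_sub]; abel
      rw [hdec]
      have hnh : ‖(h : ℂ)‖ = h := by rw [Complex.norm_real, Real.norm_of_nonneg hh]
      have e4 : ‖(G q h x - x - (h : ℂ) • V q x) +
          (h : ℂ) • (V q x - V q (p q)) - (p (q + h) - p q - (h : ℂ) • V q (p q)) + (x - p q)‖ ≤
          2 * η * h + h * (Λ * ‖x - p q‖) + η * h + ‖x - p q‖ := by
        refine norm_add_le_of_le (norm_sub_le_of_le (norm_add_le_of_le e1 ?_) e2) le_rfl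
        rw [norm_smul, hnh]
        gcongr
      refine e4.trans ?_
      have h1 : (1 : ℝ) ≤ (1 + h * Λ) ^ (i + 1) := one_le_pow₀ (by nlinarith [mul_nonneg hh hΛ])
      have h2 : 0 ≤ 3 * η * h := by positivity
      have h3 : (1 + h * Λ) * ‖x - p q‖ ≤ (1 + h * Λ) * (3 * η * h * i * (1 + h * Λ) ^ i) := by
        gcongr
      push_cast
      calc 2 * η * h + h * (Λ * ‖x - p q‖) + η * h + ‖x - p q‖
          = (1 + h * Λ) * ‖x - p q‖ + 3 * η * h * 1 := by ring
        _ ≤ (1 + h * Λ) * (3 * η * h * i * (1 + h * Λ) ^ i) +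
            3 * η * h * (1 + h * Λ) ^ (i + 1) := by gcongr
        _ = _ := by ring
  have h1 := key n le_rfl
  rw [hn] at h1
  exact h1.trans (hbound n le_rfl)

end EulerMethod

/-! ### Locally uniform limits of generated maps -/

section Approximation

open Metric

/-- `f` is a limit of generated maps, uniformly on compact subsets of the spectral ball. -/
def IsApproximable (f : M2 → M2) : Prop :=
  ∀ K ⊆ SpectralBall, IsCompact K → ∀ η : ℝ, 0 < η →
    ∃ g, IsGenerated g ∧ ∀ x ∈ K, ‖g x - f x‖ ≤ η

lemma IsGenerated.isApproximable {f : M2 → M2} (hf : IsGenerated f) : IsApproximable f :=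
  fun K _ _ η hη => ⟨f, hf, fun x _ => by rw [sub_self, norm_zero]; exact hη.le⟩

lemma IsApproximable.comp {f f' : M2 → M2} (hf : IsApproximable f)
    (hfc : ContinuousOn f SpectralBall) (hf' : IsApproximable f')
    (hfc' : ContinuousOn f' SpectralBall) (hmaps : MapsTo f' SpectralBall SpectralBall) :
    IsApproximable (fun x => f (f' x)) := by
  intro K hKS hK η hη
  have hC : IsCompact (f' '' K) := hK.image_of_continuousOn (hfc'.mono hKS)
  have hCS : f' '' K ⊆ SpectralBall := (hmaps.mono_left hKS).image_subset
  obtain ⟨δ, hδ, hsub⟩ := hC.exists_cthickening_subset_open isOpen_spectralBall hCS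
  have hC' : IsCompact (cthickening δ (f' '' K)) := hC.cthickening
  obtain ⟨δ₁, hδ₁, Hδ⟩ := Metric.uniformContinuousOn_iff.1
    (hC'.uniformContinuousOn_of_continuous (hfc.mono hsub)) (η / 2) (by positivity)
  obtain ⟨g', hg', Hg'⟩ := hf' K hKS hK (min δ (δ₁ / 2)) (by positivity)
  obtain ⟨g, hg, Hg⟩ := hf _ hsub hC' (η / 2) (by positivity)
  refine ⟨fun x => g (g' x), hg.comp hg', fun x hx => ?_⟩
  have h1 := Hg' x hx
  have hmem : f' x ∈ f' '' K := ⟨x, hx, rfl⟩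
  have h2 : g' x ∈ cthickening δ (f' '' K) := mem_cthickening_of_dist_le _ (f' x) δ _ hmem (by
    rw [dist_eq_norm]; exact h1.trans (min_le_left _ _))
  have h3 := Hg _ h2
  have h4 := Hδ _ h2 _ (self_subset_cthickening _ hmem) (by
    rw [dist_eq_norm]; have := h1.trans (min_le_right _ _); linarith)
  rw [dist_eq_norm] at h4
  have h5 : g (g' x) - f (f' x) = (g (g' x) - f (g' x)) + (f (g' x) - f (f' x)) := by abel
  rw [h5]
  refine (norm_add_le _ _).trans ?_
  linarith

lemma isApproximable_of_forall_exists {f : M2 → M2}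
    (h : ∀ K ⊆ SpectralBall, IsCompact K → ∀ η : ℝ, 0 < η →
      ∃ g, IsApproximable g ∧ ∀ x ∈ K, ‖g x - f x‖ ≤ η) : IsApproximable f := by
  intro K hKS hK η hη
  obtain ⟨g, hg, Hg⟩ := h K hKS hK (η / 2) (by positivity)
  obtain ⟨g', hg', Hg'⟩ := hg K hKS hK (η / 2) (by positivity)
  refine ⟨g', hg', fun x hx => ?_⟩
  have h5 : g' x - f x = (g' x - g x) + (g x - f x) := by abel
  rw [h5]
  refine (norm_add_le _ _).trans ?_
  linarith [Hg x hx, Hg' x hx]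

lemma IsApproximable.congr {f f' : M2 → M2} (hf : IsApproximable f)
    (h : EqOn f' f SpectralBall) : IsApproximable f' := by
  intro K hKS hK η hη
  obtain ⟨g, hg, Hg⟩ := hf K hKS hK η hη
  exact ⟨g, hg, fun x hx => by rw [h (hKS hx)]; exact Hg x hx⟩

lemma IsApproximable.exists_seq {f : M2 → M2} (hf : IsApproximable f) :
    ∃ g : ℕ → M2 → M2, (∀ k, IsGenerated (g k)) ∧
      ∀ K ⊆ SpectralBall, IsCompact K → TendstoUniformlyOn g f Filter.atTop K := by
  have : LocallyCompactSpace M2 := inferInstanceAs (LocallyCompactSpace (Fin 2 → Fin 2 → ℂ))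
  have : SecondCountableTopology M2 :=
    inferInstanceAs (SecondCountableTopology (Fin 2 → Fin 2 → ℂ))
  have : LocallyCompactSpace SpectralBall := isOpen_spectralBall.locallyCompactSpace
  let E : CompactExhaustion SpectralBall := CompactExhaustion.choice _
  have hE : ∀ n, IsCompact (Subtype.val '' E n) := fun n =>
    (E.isCompact n).image continuous_subtype_val
  choose g hg Hg using fun n : ℕ => hf (Subtype.val '' E n) (by
    rintro _ ⟨x, _, rfl⟩; exact x.2) (hE n) (1 / ((n : ℝ) + 1)) (by positivity)
  refine ⟨g, hg, fun K hKS hK => ?_⟩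
  have hK' : IsCompact (Subtype.val ⁻¹' K : Set SpectralBall) :=
    Topology.IsInducing.subtypeVal.isCompact_preimage' hK (by simpa using hKS)
  obtain ⟨n, hn⟩ := E.exists_superset_of_isCompact hK'
  refine Metric.tendstoUniformlyOn_iff.2 ?_
  intro η hη
  have h0 := (tendsto_one_div_add_atTop_nhds_zero_nat (𝕜 := ℝ)).eventually_lt_const hη
  filter_upwards [h0, Filter.eventually_ge_atTop n] with k hk hnk x hx
  rw [dist_comm, dist_eq_norm]
  exact (Hg k x ⟨⟨x, hKS hx⟩, E.subset hnk (hn hx), rfl⟩).trans_lt hk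

end Approximation

/-! ### Radial deformation of an automorphism preserving trace and determinant -/

section RadialDeformation

open Metric

lemma hasDerivAt_smul_comp_smul {φ : M2 → M2} {q : ℂ} {z : M2}
    (hφ : DifferentiableAt ℂ φ (q • z)) :
    HasDerivAt (fun ζ : ℂ => φ (ζ • z)) (fderiv ℂ φ (q • z) z) q := by
  have h1 : DifferentiableAt ℂ φ (0 + q • z) := by rwa [zero_add]
  have h2 := hasDerivAt_comp_line h1
  simp only [zero_add] at h2
  exact h2

/-- The infinitesimal generator of the deformation `q ↦ q⁻¹ φ (q z)`. -/
def radialField (φ χ : M2 → M2) (w : M2) : M2 := fderiv ℂ φ (χ w) (χ w) - w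

lemma fderiv_entry {φ : M2 → M2} {y : M2} (hφ : DifferentiableAt ℂ φ y) (v : M2) (i j : Fin 2) :
    fderiv ℂ φ y v i j = fderiv ℂ (fun x => φ x i j) y v := by
  have h1 : HasDerivAt (fun ζ : ℂ => φ (y + ζ • v)) (fderiv ℂ φ y v) 0 := by
    have := hasDerivAt_comp_line (f := φ) (x := y) (v := v) (ζ := 0) (by rwa [zero_smul, add_zero])
    rwa [zero_smul, add_zero] at this
  have hφ' : DifferentiableAt ℂ (fun x => φ x i j) y :=
    (differentiable_entry i j _).comp y hφ
  have h2 : HasDerivAt (fun ζ : ℂ => φ (y + ζ • v) i j) (fderiv ℂ (fun x => φ x i j) y v) 0 := by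
    have := hasDerivAt_comp_line (f := fun x => φ x i j) (x := y) (v := v) (ζ := 0)
      (by rwa [zero_smul, add_zero])
    rwa [zero_smul, add_zero] at this
  exact (hasDerivAt_pi.1 (hasDerivAt_pi.1 h1 i) j).unique h2

lemma differentiableOn_radialField {φ χ : M2 → M2} (hφ : DifferentiableOn ℂ φ SpectralBall)
    (hχ : DifferentiableOn ℂ χ SpectralBall) (mχ : MapsTo χ SpectralBall SpectralBall) :
    DifferentiableOn ℂ (radialField φ χ) SpectralBall := by
  refine DifferentiableOn.sub (differentiableOn_of_entry fun i j => ?_) differentiableOn_id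
  have h1 : DifferentiableOn ℂ (fun w => ∑ k, ∑ l, χ w k l *
      fderiv ℂ (fun x => φ x i j) (χ w) (Matrix.single k l (1 : ℂ))) SpectralBall := by
    refine DifferentiableOn.fun_sum fun k _ => DifferentiableOn.fun_sum fun l _ => ?_
    exact (hχ.entry k l).mul ((differentiableOn_fderiv_apply isOpen_spectralBall
      (hφ.entry i j) _).comp hχ mχ)
  refine h1.congr fun w hw => ?_
  rw [fderiv_entry (hφ.differentiableAt (isOpen_spectralBall.mem_nhds (mχ hw)))]
  have hdec : χ w = ∑ k, ∑ l, χ w k l • Matrix.single k l (1 : ℂ) := by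
    conv_lhs => rw [Matrix.matrix_eq_sum_single (χ w)]
    simp only [Matrix.smul_single, smul_eq_mul, mul_one]
  refine (congrArg (fderiv ℂ (fun x => φ x i j) (χ w)) hdec).trans ?_
  simp only [map_sum, map_smul, smul_eq_mul]

variable {φ χ : M2 → M2}

lemma isTangentField_radialField (hφ : DifferentiableOn ℂ φ SpectralBall)
    (ht : ∀ x ∈ SpectralBall, (φ x).trace = x.trace)
    (hd : ∀ x ∈ SpectralBall, (φ x).det = x.det) (mχ : MapsTo χ SpectralBall SpectralBall)
    (hφχ : ∀ x ∈ SpectralBall, φ (χ x) = x) : IsTangentField (radialField φ χ) := by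
  intro w hw
  set y := χ w with hy
  have hyS : y ∈ SpectralBall := mχ hw
  have hD : HasDerivAt (fun ζ : ℂ => φ (ζ • y)) (fderiv ℂ φ y y) 1 := by
    have := hasDerivAt_smul_comp_smul (φ := φ) (q := 1) (z := y)
      (by rw [one_smul]; exact hφ.differentiableAt (isOpen_spectralBall.mem_nhds hyS))
    rwa [one_smul] at this
  have hent : ∀ i j, HasDerivAt (fun ζ : ℂ => φ (ζ • y) i j) (fderiv ℂ φ y y i j) 1 := fun i j =>
    hasDerivAt_pi.1 (hasDerivAt_pi.1 hD i) j
  have hφy : φ y = w := hφχ w hw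
  have hev : ∀ᶠ ζ : ℂ in nhds 1, ζ • y ∈ SpectralBall :=
    (isOpen_smul_preimage y).mem_nhds (by simpa using hyS)
  have htr : y.trace = w.trace := by rw [← ht y hyS, hφy]
  have hdt : y.det = w.det := by rw [← hd y hyS, hφy]
  have e1 : fderiv ℂ φ y y 0 0 + fderiv ℂ φ y y 1 1 = w.trace := by
    have h1 := (hent 0 0).add (hent 1 1)
    have h2 : HasDerivAt (fun ζ : ℂ => ζ * y.trace) (1 * y.trace) 1 :=
      (hasDerivAt_id (1 : ℂ)).mul_const _
    rw [one_mul, htr] at h2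
    refine h1.unique (h2.congr_of_eventuallyEq ?_)
    filter_upwards [hev] with ζ hζ
    have h3 := ht _ hζ
    rw [Matrix.trace_smul, smul_eq_mul, htr, Matrix.trace_fin_two] at h3
    exact h3
  have e2 : fderiv ℂ φ y y 0 0 * w 1 1 + w 0 0 * fderiv ℂ φ y y 1 1 -
      (fderiv ℂ φ y y 0 1 * w 1 0 + w 0 1 * fderiv ℂ φ y y 1 0) = 2 * w.det := by
    have h1 := ((hent 0 0).mul (hent 1 1)).sub ((hent 0 1).mul (hent 1 0))
    simp only [one_smul, hφy] at h1
    have h2 : HasDerivAt (fun ζ : ℂ => ζ ^ 2 * y.det) (2 * w.det) 1 := by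
      have := ((hasDerivAt_id (1 : ℂ)).pow 2).mul_const y.det
      refine this.congr_deriv ?_
      rw [hdt]; simp
    refine h1.unique (h2.congr_of_eventuallyEq ?_)
    filter_upwards [hev] with ζ hζ
    have h3 := hd _ hζ
    rw [Matrix.det_smul, Fintype.card_fin, Matrix.det_fin_two] at h3
    exact h3
  rw [Matrix.trace_fin_two] at e1
  rw [Matrix.det_fin_two] at e2
  simp only [radialField, ← hy, Matrix.sub_apply]
  exact ⟨by linear_combination e1, by linear_combination (-1 : ℂ) * e2 + w 0 0 * e1⟩

lemma inv_smul_mem_spectralBall (ht : ∀ x ∈ SpectralBall, (φ x).trace = x.trace)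
    (hd : ∀ x ∈ SpectralBall, (φ x).det = x.det) {q : ℂ} (hq : q ≠ 0) {z : M2}
    (hz : z ∈ SpectralBall) (hqz : q • z ∈ SpectralBall) : q⁻¹ • φ (q • z) ∈ SpectralBall := by
  refine (mem_spectralBall_congr (y := z) ?_ ?_).2 hz
  · rw [Matrix.trace_smul, ht _ hqz, Matrix.trace_smul, smul_smul, inv_mul_cancel₀ hq, one_smul]
  · rw [Matrix.det_smul, hd _ hqz, Matrix.det_smul, ← mul_assoc, ← mul_pow, inv_mul_cancel₀ hq,
      one_pow, one_mul]

lemma hasDerivAt_inv_smul_comp_smul {q : ℂ} {z : M2} (hq : q ≠ 0)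
    (hφ : DifferentiableAt ℂ φ (q • z)) (hχφ : χ (φ (q • z)) = q • z) :
    HasDerivAt (fun u : ℂ => u⁻¹ • φ (u • z))
      ((q ^ 2)⁻¹ • radialField φ χ (φ (q • z))) q := by
  refine ((hasDerivAt_inv hq).smul (hasDerivAt_smul_comp_smul hφ)).congr_deriv ?_
  rw [radialField, hχφ, ContinuousLinearMap.map_smul, smul_sub, smul_smul, neg_smul,
    ← sub_eq_add_neg]
  congr 2
  field_simp

lemma norm_sub_sub_smul_le {E : Type*} [NormedAddCommGroup E] [NormedSpace ℂ E] [CompleteSpace E]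
    {g : ℂ → E} {g' : E} {c : ℂ} {ρ M : ℝ} (hg' : HasDerivAt g g' c) (hρ : 0 < ρ)
    (hg : DifferentiableOn ℂ g (closedBall c (3 * ρ)))
    (hM : ∀ z ∈ closedBall c (3 * ρ), ‖g z‖ ≤ M) {τ : ℂ} (hτ : ‖τ‖ ≤ ρ) :
    ‖g (c + τ) - g c - τ • g'‖ ≤ M / ρ ^ 2 * ‖τ‖ ^ 2 := by
  rw [← hg'.deriv]
  exact norm_sub_sub_smul_deriv_le hρ hg hM hτ

lemma isApproximable_rescale (hφ : DifferentiableOn ℂ φ SpectralBall)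
    (hχ : DifferentiableOn ℂ χ SpectralBall) (mχ : MapsTo χ SpectralBall SpectralBall)
    (hχφ : ∀ x ∈ SpectralBall, χ (φ x) = x) (hφχ : ∀ x ∈ SpectralBall, φ (χ x) = x)
    (ht : ∀ x ∈ SpectralBall, (φ x).trace = x.trace)
    (hd : ∀ x ∈ SpectralBall, (φ x).det = x.det) {ε : ℝ} (hε : 0 < ε) (hε1 : ε < 1) :
    IsApproximable (fun x => φ ((ε : ℂ)⁻¹ • χ ((ε : ℂ) • x))) := by
  have htχ : ∀ x ∈ SpectralBall, (χ x).trace = x.trace := fun x hx => by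
    rw [← ht _ (mχ hx), hφχ x hx]
  have hdχ : ∀ x ∈ SpectralBall, (χ x).det = x.det := fun x hx => by
    rw [← hd _ (mχ hx), hφχ x hx]
  have hεC : (ε : ℂ) ≠ 0 := by exact_mod_cast hε.ne'
  have hεn : ‖(ε : ℂ)‖ ≤ 1 := by rw [Complex.norm_real, Real.norm_of_nonneg hε.le]; exact hε1.le
  intro K hKS hK η₀ hη₀
  have hψ : ContinuousOn (fun x : M2 => (ε : ℂ)⁻¹ • χ ((ε : ℂ) • x)) K := by
    have h1 : ContinuousOn (fun x : M2 => χ ((ε : ℂ) • x)) K :=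
      hχ.continuousOn.comp (continuous_const_smul (ε : ℂ)).continuousOn
        fun x hx => smul_mem_spectralBall (hKS hx) hεn
    exact h1.const_smul (ε : ℂ)⁻¹
  set Z := (fun x : M2 => (ε : ℂ)⁻¹ • χ ((ε : ℂ) • x)) '' K with hZdef
  have hZ : IsCompact Z := hK.image_of_continuousOn hψ
  have hZS : Z ⊆ SpectralBall := by
    rintro _ ⟨x, hx, rfl⟩
    exact inv_smul_mem_spectralBall htχ hdχ hεC (hKS hx) (smul_mem_spectralBall (hKS hx) hεn)
  obtain ⟨r, hr, hrZ⟩ := exists_one_lt_forall_smul_mem hZ hZS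
  set A : Set ℂ := closedBall 0 r \ ball 0 (ε / 2) with hA
  have hAc : IsCompact A := (isCompact_closedBall 0 r).diff isOpen_ball
  have hAr : ∀ q ∈ A, ‖q‖ ≤ r := fun q hq => by simpa using hq.1
  have hA0 : ∀ q ∈ A, q ≠ 0 := fun q hq h0 => hq.2 (by rw [h0]; exact mem_ball_self (by positivity))
  set pc : ℂ × M2 → M2 := fun s => s.1⁻¹ • φ (s.1 • s.2) with hpc
  have hpcc : ContinuousOn pc (A ×ˢ Z) := by
    have h1 : ContinuousOn (fun s : ℂ × M2 => s.1⁻¹) (A ×ˢ Z) :=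
      continuousOn_fst.inv₀ fun s hs => hA0 _ hs.1
    have h2 : ContinuousOn (fun s : ℂ × M2 => φ (s.1 • s.2)) (A ×ˢ Z) :=
      hφ.continuousOn.comp (continuous_fst.smul continuous_snd).continuousOn
        fun s hs => hrZ _ hs.2 _ (hAr _ hs.1)
    exact h1.smul h2
  set P := pc '' (A ×ˢ Z) with hP
  have hPc : IsCompact P := (hAc.prod hZ).image_of_continuousOn hpcc
  have hPS : P ⊆ SpectralBall := by
    rintro _ ⟨⟨q, z⟩, ⟨hq, hz⟩, rfl⟩
    exact inv_smul_mem_spectralBall ht hd (hA0 q hq) (hZS hz) (hrZ z hz q (hAr q hq))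
  obtain ⟨M, hM⟩ := hPc.isBounded.exists_norm_le
  obtain ⟨δ₀, hδ₀, hsub⟩ := hPc.exists_cthickening_subset_open isOpen_spectralBall hPS
  set K₂ := cthickening δ₀ P with hK₂
  have hK₂c : IsCompact K₂ := hPc.cthickening
  set δ := δ₀ / 2 with hδ
  have hδ0 : 0 < δ := by positivity
  set W := radialField φ χ with hW
  have hWd : DifferentiableOn ℂ W SpectralBall := differentiableOn_radialField hφ hχ mχ
  have hWt : IsTangentField W := isTangentField_radialField hφ ht hd mχ hφχ
  have hqn : ∀ q ∈ Icc ε 1, ‖(q : ℂ)‖ ≤ 1 := fun q hq => by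
    rw [Complex.norm_real, Real.norm_of_nonneg (hε.le.trans hq.1)]; exact hq.2
  have hqi : ∀ q ∈ Icc ε 1, ‖((q : ℂ) ^ 2)⁻¹‖ ≤ (ε ^ 2)⁻¹ := fun q hq => by
    rw [norm_inv, norm_pow, Complex.norm_real, Real.norm_of_nonneg (hε.le.trans hq.1)]
    have := hq.1
    gcongr
  have hqA : ∀ q ∈ Icc ε 1, (q : ℂ) ∈ A := fun q hq => ⟨by
    simpa using (hqn q hq).trans hr.le, fun h => by
    rw [mem_ball_zero_iff, Complex.norm_real, Real.norm_of_nonneg (hε.le.trans hq.1)] at h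
    linarith [hq.1]⟩
  set V : ℝ → M2 → M2 := fun q x => ((q : ℂ) ^ 2)⁻¹ • W ((q : ℂ) • x) with hV
  have hVd : ∀ q ∈ Icc ε 1, DifferentiableOn ℂ (V q) SpectralBall := fun q hq => by
    have h1 : DifferentiableOn ℂ (fun x : M2 => W ((q : ℂ) • x)) SpectralBall :=
      hWd.comp ((differentiable_id.const_smul (q : ℂ)).differentiableOn)
        fun x hx => smul_mem_spectralBall hx (hqn q hq)
    exact h1.const_smul ((q : ℂ) ^ 2)⁻¹
  obtain ⟨B, hB⟩ : ∃ B, ∀ q ∈ Icc ε 1, ∀ x ∈ K₂, ‖V q x‖ ≤ B := by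
    have hC : ContinuousOn (fun s : ℂ × M2 => W (s.1 • s.2)) (closedBall 0 1 ×ˢ K₂) :=
      hWd.continuousOn.comp (continuous_fst.smul continuous_snd).continuousOn fun s hs =>
        smul_mem_spectralBall (hsub hs.2) (by simpa using hs.1)
    obtain ⟨B, hB⟩ := ((isCompact_closedBall (0 : ℂ) 1).prod hK₂c).exists_bound_of_continuousOn hC
    refine ⟨(ε ^ 2)⁻¹ * B, fun q hq x hx => ?_⟩
    rw [hV]
    simp only [norm_smul]
    exact mul_le_mul (hqi q hq) (hB (q, x) ⟨by simpa using hqn q hq, hx⟩) (norm_nonneg _)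
      (by positivity)
  set Λ := |B| / δ with hΛ
  have hball : ∀ p ∈ P, ∀ y ∈ closedBall p δ, closedBall y δ ⊆ K₂ := by
    intro p hp y hy u hu
    refine mem_cthickening_of_dist_le u p δ₀ P hp ?_
    have := dist_triangle u y p
    rw [mem_closedBall] at hy hu
    linarith
  have hVL : ∀ p ∈ P, ∀ q ∈ Icc ε 1, ∀ y, ‖y - p‖ ≤ δ → ‖V q y - V q p‖ ≤ Λ * ‖y - p‖ := by
    intro p hp q hq y hy
    refine (convex_closedBall p δ).norm_image_sub_le_of_norm_fderiv_le (𝕜 := ℂ) (fun u hu => ?_)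
      (fun u hu => ?_) (mem_closedBall_self hδ0.le) (by rwa [mem_closedBall, dist_eq_norm])
    · exact (hVd q hq).differentiableAt (isOpen_spectralBall.mem_nhds
        (hsub (hball p hp u hu (mem_closedBall_self hδ0.le))))
    · exact norm_fderiv_le_of_forall_closedBall isOpen_spectralBall (hVd q hq) hδ0
        ((hball p hp u hu).trans hsub) fun v hv =>
          (hB q hq v (hball p hp u hu hv)).trans (le_abs_self B)
  set η := min δ η₀ / (3 * Real.exp Λ) with hη
  have hη0 : 0 < η := by positivity
  have hηe : 3 * η * Real.exp Λ = min δ η₀ := by rw [hη]; field_simp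
  obtain ⟨N, hN⟩ := exists_norm_sub_sum_homField_le hWd hWt hK₂c hsub
    (η := η * ε ^ 2) (by positivity)
  obtain ⟨G, hGg, hG⟩ := exists_isConsistent_sum (H := fun k => homField k W)
    (fun k => homField_mem_flowFields k hWd hWt) (fun k => continuous_homField k hWd) (ε := ε)
    (C := fun _ => (ε ^ 2)⁻¹) (c := fun k q => ((q : ℂ) ^ 2)⁻¹ * (q : ℂ) ^ k)
    (fun k q hq => by
      rw [norm_mul, norm_pow]
      calc _ ≤ (ε ^ 2)⁻¹ * 1 := by
            gcongr
            · exact hqi q hq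
            · exact pow_le_one₀ (norm_nonneg _) (hqn q hq)
        _ = _ := mul_one _) N
  obtain ⟨h₀, hh₀, hGh⟩ := hG K₂ hK₂c η hη0
  set ρ := min (ε / 2) (r - 1) / 3 with hρ
  have hρ0 : 0 < ρ := by
    have : 0 < r - 1 := by linarith
    positivity
  have h3ρ : 3 * ρ = min (ε / 2) (r - 1) := by rw [hρ]; ring
  have hAρ : ∀ q ∈ Icc ε 1, closedBall (q : ℂ) (3 * ρ) ⊆ A := by
    intro q hq u hu
    rw [mem_closedBall, dist_eq_norm, h3ρ] at hu
    have h1 := norm_sub_norm_le (q : ℂ) u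
    rw [norm_sub_rev] at h1
    have h2 := norm_sub_norm_le u (q : ℂ)
    have h3 : ‖(q : ℂ)‖ = q := by rw [Complex.norm_real, Real.norm_of_nonneg (hε.le.trans hq.1)]
    have h4 := hu.trans (min_le_left _ _)
    have h5 := hu.trans (min_le_right _ _)
    refine ⟨?_, fun h => ?_⟩
    · rw [mem_closedBall_zero_iff]; linarith [hqn q hq]
    · rw [mem_ball_zero_iff] at h; linarith [hq.1]
  set h₁ := min (min h₀ ρ) (η * ρ ^ 2 / (|M| + 1)) with hh₁
  have hh₁0 : 0 < h₁ := by positivity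
  obtain ⟨n, hn⟩ := exists_nat_gt ((1 - ε) / h₁)
  have hn0 : (0 : ℝ) < n := lt_of_le_of_lt (div_nonneg (by linarith) hh₁0.le) hn
  set h := (1 - ε) / n with hh
  have hhpos : 0 ≤ h := div_nonneg (by linarith) hn0.le
  have hhle : h ≤ h₁ := by
    rw [hh, div_le_iff₀ hn0]
    rw [div_lt_iff₀ hh₁0] at hn
    linarith
  have hnorm : ‖(h : ℂ)‖ = h := by rw [Complex.norm_real, Real.norm_of_nonneg hhpos]
  refine ⟨eulerMap G ε h n, isGenerated_eulerMap hGg ε h n, fun x hx => ?_⟩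
  set z := (ε : ℂ)⁻¹ • χ ((ε : ℂ) • x) with hz
  have hzZ : z ∈ Z := ⟨x, hx, rfl⟩
  have hpP : ∀ q ∈ Icc ε 1, pc ((q : ℂ), z) ∈ P := fun q hq => ⟨(q, z), ⟨hqA q hq, hzZ⟩, rfl⟩
  have key := norm_eulerMap_sub_le (G := G) (V := V) (p := fun q : ℝ => pc ((q : ℂ), z)) (δ := δ)
    (Λ := Λ) (η := η) (h := h) (n := n) hε.le (by positivity) hη0.le hhpos
    (by rw [hh]; field_simp; ring) (fun q hq y hy => hVL _ (hpP q hq) q hq y hy)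
    (fun q hq _ => by
      have hqz : (q : ℂ) • z ∈ SpectralBall := hrZ z hzZ _ (hAr _ (hqA q hq))
      have hq0 := hA0 _ (hqA q hq)
      have hdq : ∀ u ∈ A, DifferentiableAt ℂ (fun u : ℂ => pc (u, z)) u := fun u hu =>
        (differentiableAt_inv (hA0 u hu)).smul (hasDerivAt_smul_comp_smul
          (hφ.differentiableAt (isOpen_spectralBall.mem_nhds
            (hrZ z hzZ u (hAr u hu))))).differentiableAt
      have hderiv : HasDerivAt (fun u : ℂ => pc (u, z)) (V q (pc (q, z))) q := by
        have h2 : (q : ℂ) • pc (q, z) = φ ((q : ℂ) • z) := by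
          rw [hpc]; simp only [smul_smul, mul_inv_cancel₀ hq0, one_smul]
        have h3 : V q (pc (q, z)) =
            ((q : ℂ) ^ 2)⁻¹ • radialField φ χ (φ ((q : ℂ) • z)) :=
          congrArg (fun w => ((q : ℂ) ^ 2)⁻¹ • radialField φ χ w) h2
        exact (hasDerivAt_inv_smul_comp_smul hq0
          (hφ.differentiableAt (isOpen_spectralBall.mem_nhds hqz)) (hχφ _ hqz)).congr_deriv h3.symm
      have h1 := norm_sub_sub_smul_le (g := fun u : ℂ => pc (u, z)) (c := (q : ℂ)) (M := M)
        hderiv hρ0 (fun u hu => (hdq u (hAρ q hq hu)).differentiableWithinAt)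
        (fun u hu => hM _ ⟨(u, z), ⟨hAρ q hq hu, hzZ⟩, rfl⟩) (τ := (h : ℂ))
        (by rw [hnorm]; exact hhle.trans ((min_le_left _ _).trans (min_le_right _ _)))
      rw [hnorm] at h1
      rw [Complex.ofReal_add]
      refine h1.trans ?_
      have h3 : h * (|M| + 1) ≤ η * ρ ^ 2 := by
        have := hhle.trans (min_le_right _ _)
        rwa [le_div_iff₀ (by positivity)] at this
      have h4 : M * h ≤ η * ρ ^ 2 := by nlinarith [le_abs_self M]
      calc M / ρ ^ 2 * h ^ 2 = M * h / ρ ^ 2 * h := by ring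
        _ ≤ η * h := by
          refine mul_le_mul_of_nonneg_right ?_ hhpos
          rw [div_le_iff₀ (by positivity)]; exact h4)
    (fun q hq y hy => by
      have hyK : y ∈ K₂ := hball _ (hpP q hq) y (by rwa [mem_closedBall, dist_eq_norm])
        (mem_closedBall_self hδ0.le)
      have h1 := hGh q hq h ⟨hhpos, hhle.trans ((min_le_left _ _).trans (min_le_left _ _))⟩ y hyK
      have h2 := hN y hyK q (hqn q hq)
      have h3 : V q y - ∑ k ∈ Finset.range N, (((q : ℂ) ^ 2)⁻¹ * (q : ℂ) ^ k) • homField k W y =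
          ((q : ℂ) ^ 2)⁻¹ • (W ((q : ℂ) • y) -
            ∑ k ∈ Finset.range N, (q : ℂ) ^ k • homField k W y) := by
        rw [smul_sub, Finset.smul_sum]
        simp only [smul_smul, hV]
      have h4 : ‖V q y - ∑ k ∈ Finset.range N, (((q : ℂ) ^ 2)⁻¹ * (q : ℂ) ^ k) •
          homField k W y‖ ≤ η := by
        rw [h3, norm_smul]
        calc _ ≤ (ε ^ 2)⁻¹ * (η * ε ^ 2) := by
              gcongr
              exact hqi q hq
          _ = η := by field_simp
      set S := ∑ k ∈ Finset.range N, (((q : ℂ) ^ 2)⁻¹ * (q : ℂ) ^ k) • homField k W y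
      have h5 : G q h y - y - (h : ℂ) • V q y =
          (G q h y - y - (h : ℂ) • S) - (h : ℂ) • (V q y - S) := by
        rw [smul_sub]; abel
      rw [h5]
      refine (norm_sub_le_of_le h1 (norm_smul_le _ _)).trans ?_
      rw [hnorm]
      nlinarith)
    (by rw [hηe]; exact min_le_left _ _)
  have hstart : pc ((ε : ℂ), z) = x := by
    rw [hpc]
    simp only [hz, smul_smul, mul_inv_cancel₀ hεC, one_smul]
    rw [hφχ _ (smul_mem_spectralBall (hKS hx) hεn), smul_smul, inv_mul_cancel₀ hεC, one_smul]
  have hend : pc (((1 : ℝ) : ℂ), z) = φ z := by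
    rw [hpc]; simp only [Complex.ofReal_one, inv_one, one_smul]
  simp only [hstart, hend] at key
  exact key.trans (hηe.le.trans (min_le_right _ _))

end RadialDeformation

/-! ### The derivative of an automorphism at scalar matrices -/

section ScalarPoints

/-- A pair of mutually inverse holomorphic self-maps of the spectral ball. -/
structure IsInversePair (φ χ : M2 → M2) : Prop where
  left_diff : DifferentiableOn ℂ φ SpectralBall
  right_diff : DifferentiableOn ℂ χ SpectralBall
  left_maps : MapsTo φ SpectralBall SpectralBall
  right_maps : MapsTo χ SpectralBall SpectralBall
  right_left : ∀ x ∈ SpectralBall, χ (φ x) = x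
  left_right : ∀ x ∈ SpectralBall, φ (χ x) = x

lemma IsInversePair.symm {φ χ : M2 → M2} (h : IsInversePair φ χ) : IsInversePair χ φ :=
  ⟨h.2, h.1, h.4, h.3, h.6, h.5⟩

lemma IsInversePair.differentiableAt {φ χ : M2 → M2} (h : IsInversePair φ χ) {x : M2}
    (hx : x ∈ SpectralBall) : DifferentiableAt ℂ φ x :=
  h.left_diff.differentiableAt (isOpen_spectralBall.mem_nhds hx)

lemma IsInversePair.fderiv_fderiv {φ χ : M2 → M2} (h : IsInversePair φ χ) {x : M2}
    (hx : x ∈ SpectralBall) (v : M2) : fderiv ℂ χ (φ x) (fderiv ℂ φ x v) = v := by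
  have h1 : HasFDerivAt (fun y => χ (φ y)) ((fderiv ℂ χ (φ x)).comp (fderiv ℂ φ x)) x :=
    (h.symm.differentiableAt (h.left_maps hx)).hasFDerivAt.comp x
      (h.differentiableAt hx).hasFDerivAt
  have h2 : HasFDerivAt (fun y => χ (φ y)) (ContinuousLinearMap.id ℂ M2) x := by
    refine (hasFDerivAt_id x).congr_of_eventuallyEq ?_
    filter_upwards [isOpen_spectralBall.mem_nhds hx] with y hy
    exact h.right_left y hy
  exact congrArg (fun D : M2 →L[ℂ] M2 => D v) (h1.unique h2)

lemma trace_eq_trace_of_entire {f : M2 → M2} (hf : DifferentiableOn ℂ f SpectralBall)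
    (mf : MapsTo f SpectralBall SpectralBall) {c : ℂ → M2} (hc : Differentiable ℂ c)
    (hcS : ∀ t, c t ∈ SpectralBall) (s t : ℂ) :
    (f (c s)).trace = (f (c t)).trace ∧ (f (c s)).det = (f (c t)).det := by
  have hfc : Differentiable ℂ fun t => f (c t) := fun t =>
    (hf.differentiableAt (isOpen_spectralBall.mem_nhds (hcS t))).comp t (hc t)
  constructor
  · refine (differentiable_trace.comp hfc).apply_eq_apply_of_bounded ?_ s t
    refine isBounded_iff_forall_norm_le.2 ⟨2, ?_⟩
    rintro _ ⟨t, rfl⟩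
    exact (norm_trace_lt (mf (hcS t))).le
  · refine (differentiable_det.comp hfc).apply_eq_apply_of_bounded ?_ s t
    refine isBounded_iff_forall_norm_le.2 ⟨1, ?_⟩
    rintro _ ⟨t, rfl⟩
    exact (norm_det_lt (mf (hcS t))).le

lemma scalar_add_nilpotent_mem {c : ℂ} (hc : ‖c‖ < 1) {N : M2} (ht : N.trace = 0)
    (hd : N.det = 0) : c • (1 : M2) + N ∈ SpectralBall := by
  refine (mem_spectralBall_congr (y := c • (1 : M2)) ?_ ?_).2 (scalar_mem_spectralBall.2 hc)
  · rw [Matrix.trace_add, ht, add_zero]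
  · rw [Matrix.trace_fin_two] at ht
    rw [Matrix.det_fin_two] at hd
    simp only [Matrix.det_fin_two, Matrix.add_apply, Matrix.smul_apply, smul_eq_mul,
      Matrix.one_fin_two, Matrix.of_apply, Matrix.cons_val', Matrix.cons_val_zero,
      Matrix.cons_val_one, Matrix.cons_val_fin_one]
    linear_combination hd + c * ht

variable {φ χ : M2 → M2}

lemma fderiv_scalar_nilpotent (hφ : DifferentiableOn ℂ φ SpectralBall)
    (mφ : MapsTo φ SpectralBall SpectralBall) {c : ℂ} (hc : ‖c‖ < 1) {N : M2}
    (ht : N.trace = 0) (hd : N.det = 0) :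
    (fderiv ℂ φ (c • (1 : M2)) N).trace = 0 ∧
      (Matrix.adjugate (φ (c • (1 : M2))) * fderiv ℂ φ (c • (1 : M2)) N).trace = 0 := by
  set D := fderiv ℂ φ (c • (1 : M2)) N with hD
  have hmem : ∀ t : ℂ, c • (1 : M2) + t • N ∈ SpectralBall := fun t =>
    scalar_add_nilpotent_mem hc (by rw [Matrix.trace_smul, ht, smul_zero])
      (by rw [Matrix.det_smul, hd, mul_zero])
  have h1 : HasDerivAt (fun ζ : ℂ => φ (c • (1 : M2) + ζ • N)) D 0 := by
    have h0 := hmem 0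
    have := hasDerivAt_comp_line (f := φ) (x := c • (1 : M2)) (v := N) (ζ := 0)
      (hφ.differentiableAt (isOpen_spectralBall.mem_nhds h0))
    rwa [zero_smul, add_zero] at this
  have hent : ∀ i j, HasDerivAt (fun ζ : ℂ => φ (c • (1 : M2) + ζ • N) i j) (D i j) 0 :=
    fun i j => hasDerivAt_pi.1 (hasDerivAt_pi.1 h1 i) j
  have hconst := fun t => trace_eq_trace_of_entire hφ mφ
    (differentiable_line (c • (1 : M2)) N) hmem t 0
  constructor
  · rw [Matrix.trace_fin_two]
    refine ((hent 0 0).add (hent 1 1)).unique ?_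
    refine (hasDerivAt_const (0 : ℂ) (φ (c • (1 : M2) + (0 : ℂ) • N)).trace).congr_of_eventuallyEq
      (Filter.Eventually.of_forall fun t => ?_)
    have := (hconst t).1
    rw [Matrix.trace_fin_two] at this
    exact this
  · have h2 := ((hent 0 0).mul (hent 1 1)).sub ((hent 0 1).mul (hent 1 0))
    have h3 := h2.unique ((hasDerivAt_const (0 : ℂ)
      (φ (c • (1 : M2) + (0 : ℂ) • N)).det).congr_of_eventuallyEq
      (Filter.Eventually.of_forall fun t => by
        have := (hconst t).2
        rw [Matrix.det_fin_two] at this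
        exact this))
    rw [zero_smul, add_zero] at h3
    rw [Matrix.trace_fin_two, Matrix.adjugate_fin_two, Matrix.mul_apply, Matrix.mul_apply,
      Fin.sum_univ_two, Fin.sum_univ_two]
    simp only [Matrix.of_apply, Matrix.cons_val', Matrix.cons_val_zero, Matrix.cons_val_one,
      Matrix.cons_val_fin_one]
    linear_combination h3

lemma linearMap_eq_trace_of_nilpotent {ℓ : M2 →ₗ[ℂ] ℂ}
    (h : ∀ N : M2, N.trace = 0 → N.det = 0 → ℓ N = 0) (y : M2) :
    ℓ y = ℓ 1 / 2 * y.trace := by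
  have h1 := h !![0, 1; 0, 0] (by simp [Matrix.trace_fin_two]) (by simp [Matrix.det_fin_two])
  have h2 := h !![0, 0; 1, 0] (by simp [Matrix.trace_fin_two]) (by simp [Matrix.det_fin_two])
  have h3 := h !![1, -1; 1, -1] (by simp [Matrix.trace_fin_two]) (by simp [Matrix.det_fin_two])
  have hy : y = (y.trace / 2) • (1 : M2) + ((y 0 0 - y 1 1) / 2) • !![1, -1; 1, -1] +
      (y 0 1 + (y 0 0 - y 1 1) / 2) • !![0, 1; 0, 0] +
      (y 1 0 - (y 0 0 - y 1 1) / 2) • !![0, 0; 1, 0] := by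
    ext i j
    fin_cases i <;> fin_cases j <;> simp [Matrix.trace_fin_two] <;> ring
  have h4 := congrArg ℓ hy
  simp only [map_add, map_smul, h1, h2, h3, smul_eq_mul, mul_zero, add_zero] at h4
  rw [h4]; ring

/-- The composition of the derivative of `φ` with the linear form `y ↦ tr (A y)`. -/
def traceForm (A : M2) (D : M2 →L[ℂ] M2) : M2 →ₗ[ℂ] ℂ where
  toFun y := (A * D y).trace
  map_add' y z := by rw [map_add, mul_add, Matrix.trace_add]
  map_smul' c y := by
    rw [ContinuousLinearMap.map_smul, Matrix.mul_smul, Matrix.trace_smul]; rfl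

lemma trace_fderiv_scalar (hφ : DifferentiableOn ℂ φ SpectralBall)
    (mφ : MapsTo φ SpectralBall SpectralBall) {c : ℂ} (hc : ‖c‖ < 1) (y : M2) :
    (fderiv ℂ φ (c • (1 : M2)) y).trace =
      (fderiv ℂ φ (c • (1 : M2)) 1).trace / 2 * y.trace := by
  have := linearMap_eq_trace_of_nilpotent (ℓ := traceForm 1 (fderiv ℂ φ (c • (1 : M2))))
    (fun N ht hd => by
      simpa only [traceForm, LinearMap.coe_mk, AddHom.coe_mk, one_mul] using
        (fderiv_scalar_nilpotent hφ mφ hc ht hd).1) y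
  simpa only [traceForm, LinearMap.coe_mk, AddHom.coe_mk, one_mul] using this

lemma adjugate_trace_fderiv_scalar (hφ : DifferentiableOn ℂ φ SpectralBall)
    (mφ : MapsTo φ SpectralBall SpectralBall) {c : ℂ} (hc : ‖c‖ < 1) (y : M2) :
    (Matrix.adjugate (φ (c • (1 : M2))) * fderiv ℂ φ (c • (1 : M2)) y).trace =
      (Matrix.adjugate (φ (c • (1 : M2))) * fderiv ℂ φ (c • (1 : M2)) 1).trace / 2 * y.trace :=
  linearMap_eq_trace_of_nilpotent
    (ℓ := traceForm (Matrix.adjugate (φ (c • (1 : M2)))) (fderiv ℂ φ (c • (1 : M2))))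
    (fun _ ht hd => (fderiv_scalar_nilpotent hφ mφ hc ht hd).2) y

/-- Automorphisms of the spectral ball map scalar matrices to scalar matrices. -/
lemma IsInversePair.map_scalar (h : IsInversePair φ χ) {c : ℂ} (hc : ‖c‖ < 1) :
    φ (c • (1 : M2)) = (φ (c • (1 : M2)) 0 0) • (1 : M2) := by
  have hcS := scalar_mem_spectralBall.2 hc
  have hsurj : ∀ w, ∃ y, fderiv ℂ φ (c • (1 : M2)) y = w := fun w => by
    have := h.symm.fderiv_fderiv (h.left_maps hcS) w
    rw [h.right_left _ hcS] at this
    exact ⟨_, this⟩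
  have h1 := trace_fderiv_scalar h.left_diff h.left_maps hc
  have h2 := adjugate_trace_fderiv_scalar h.left_diff h.left_maps hc
  set A := φ (c • (1 : M2)) with hA
  set a := (fderiv ℂ φ (c • (1 : M2)) 1).trace / 2
  set b := (Matrix.adjugate A * fderiv ℂ φ (c • (1 : M2)) 1).trace / 2
  have ha : a ≠ 0 := by
    intro ha
    obtain ⟨y, hy⟩ := hsurj 1
    have := h1 y
    rw [hy, ha, zero_mul, Matrix.trace_one, Fintype.card_fin] at this
    norm_num at this
  have key : ∀ w : M2, (Matrix.adjugate A * w).trace = b / a * w.trace := fun w => by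
    obtain ⟨y, rfl⟩ := hsurj w
    rw [h2, h1]; field_simp
  have k1 := key !![0, 1; 0, 0]
  have k2 := key !![0, 0; 1, 0]
  have k3 := key !![1, 0; 0, -1]
  simp [Matrix.trace_fin_two, Matrix.adjugate_fin_two] at k1 k2 k3
  ext i j
  fin_cases i <;> fin_cases j <;> simp [k1, k2]
  linear_combination k3

end ScalarPoints

/-! ### A Schwarz lemma for the spectral ball -/

section Schwarz

open Metric

lemma sq_eq_trace_smul_sub (x : M2) : x ^ 2 = x.trace • x - x.det • (1 : M2) := by
  rw [pow_two]
  ext i j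
  fin_cases i <;> fin_cases j <;>
    simp [Matrix.mul_apply, Matrix.trace_fin_two, Matrix.det_fin_two] <;> ring

lemma trace_pow_eq {x : M2} {a b : ℂ} (ht : x.trace = a + b) (hd : x.det = a * b) (k : ℕ) :
    (x ^ k).trace = a ^ k + b ^ k := by
  induction k using Nat.twoStepInduction with
  | zero => simp; norm_num
  | one => simpa using ht
  | more k h1 h2 =>
    rw [pow_add, sq_eq_trace_smul_sub, mul_sub, Matrix.mul_smul, Matrix.mul_smul, ← pow_succ,
      mul_one, Matrix.trace_sub, Matrix.trace_smul, Matrix.trace_smul, h1, h2, ht, hd,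
      smul_eq_mul, smul_eq_mul]
    ring

lemma norm_trace_pow_le {x : M2} (hx : x ∈ SpectralBall) (k : ℕ) : ‖(x ^ k).trace‖ ≤ 2 := by
  obtain ⟨a, b, ht, hd⟩ := exists_eigenvalues x
  obtain ⟨ha, hb⟩ := (mem_spectralBall_iff ht hd).1 hx
  rw [trace_pow_eq ht hd]
  refine (norm_add_le _ _).trans ?_
  rw [norm_pow, norm_pow]
  linarith [pow_le_one₀ (n := k) (norm_nonneg a) ha.le, pow_le_one₀ (n := k) (norm_nonneg b) hb.le]

lemma norm_le_one_of_norm_pow_add_pow_le {a b : ℂ} (h : ∀ k : ℕ, ‖a ^ k + b ^ k‖ ≤ 2) :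
    ‖a‖ ≤ 1 := by
  by_contra! ha
  obtain ⟨k, hk⟩ := pow_unbounded_of_one_lt 3 ha
  rw [← norm_pow] at hk
  have h1 := h k
  have h2 := h (2 * k)
  rw [mul_comm, pow_mul, pow_mul] at h2
  generalize a ^ k = e at *
  generalize b ^ k = f at *
  have h3 : ‖2 * (e * f)‖ ≤ 6 := by
    rw [show 2 * (e * f) = (e + f) ^ 2 - (e ^ 2 + f ^ 2) by ring]
    refine (norm_sub_le _ _).trans ?_
    rw [norm_pow]
    nlinarith [norm_nonneg (e + f)]
  have h4 : ‖e‖ ^ 2 ≤ 2 * ‖e‖ + 3 := by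
    rw [norm_mul, Complex.norm_two] at h3
    rw [← norm_pow, show e ^ 2 = (e + f) * e - e * f by ring]
    refine (norm_sub_le _ _).trans ?_
    rw [norm_mul]
    nlinarith [norm_nonneg e]
  nlinarith

lemma norm_le_of_norm_mul_le {u : ℂ → ℂ} {C : ℝ} (hu : DifferentiableOn ℂ u (ball 0 1))
    (h : ∀ ζ ∈ ball (0 : ℂ) 1, ‖ζ * u ζ‖ ≤ C) : ∀ ζ ∈ ball (0 : ℂ) 1, ‖u ζ‖ ≤ C := by
  have hne : ∀ ζ ∈ ball (0 : ℂ) 1, ζ ≠ 0 → ‖u ζ‖ ≤ C := by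
    intro ζ hζ h0
    have h1 := Complex.dist_le_div_mul_dist_of_mapsTo_ball (f := fun ζ => ζ * u ζ) (c := 0)
      (R₁ := 1) (R₂ := C) (differentiableOn_id.mul hu)
      (fun z hz => by simpa using h z hz) hζ
    rw [zero_mul, dist_zero_right, dist_zero_right, norm_mul, div_one, mul_comm] at h1
    exact le_of_mul_le_mul_right h1 (norm_pos_iff.2 h0)
  intro ζ hζ
  by_cases h0 : ζ = 0
  · subst h0
    have h1 : Filter.Tendsto (fun z => ‖u z‖) (nhdsWithin 0 {0}ᶜ) (nhds ‖u 0‖) :=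
      ((hu.continuousOn.continuousAt (isOpen_ball.mem_nhds hζ)).norm).mono_left inf_le_left
    refine le_of_tendsto h1 ?_
    filter_upwards [self_mem_nhdsWithin, mem_nhdsWithin_of_mem_nhds (isOpen_ball.mem_nhds hζ)]
      with z hz hz'
    exact hne z hz' hz
  · exact hne ζ hζ h0

lemma norm_le_of_norm_pow_mul_le {u : ℂ → ℂ} {C : ℝ} (hu : DifferentiableOn ℂ u (ball 0 1))
    (k : ℕ) (h : ∀ ζ ∈ ball (0 : ℂ) 1, ‖ζ ^ k * u ζ‖ ≤ C) : ∀ ζ ∈ ball (0 : ℂ) 1, ‖u ζ‖ ≤ C := by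
  induction k with
  | zero => simpa using h
  | succ k ih =>
    refine ih (norm_le_of_norm_mul_le ((differentiableOn_id.pow k).mul hu) fun ζ hζ => ?_)
    rw [← mul_assoc, ← pow_succ']
    exact h ζ hζ

lemma DifferentiableOn.matrix_pow {g : ℂ → M2} {s : Set ℂ} (hg : DifferentiableOn ℂ g s) (k : ℕ) :
    DifferentiableOn ℂ (fun ζ => g ζ ^ k) s := by
  induction k with
  | zero => simp
  | succ k ih => simpa only [pow_succ] using ih.matrix_mul hg

lemma norm_eigenvalue_le_of_smul_mem {g : ℂ → M2} (hg : DifferentiableOn ℂ g (ball 0 1))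
    (h : ∀ ζ ∈ ball (0 : ℂ) 1, ζ • g ζ ∈ SpectralBall) {ζ : ℂ} (hζ : ζ ∈ ball (0 : ℂ) 1) {a b : ℂ}
    (ht : (g ζ).trace = a + b) (hd : (g ζ).det = a * b) : ‖a‖ ≤ 1 ∧ ‖b‖ ≤ 1 := by
  have key : ∀ k : ℕ, ‖a ^ k + b ^ k‖ ≤ 2 := fun k => by
    rw [← trace_pow_eq ht hd]
    refine norm_le_of_norm_pow_mul_le (u := fun z => (g z ^ k).trace)
      (differentiable_trace.comp_differentiableOn (hg.matrix_pow k)) k (fun z hz => ?_) ζ hζ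
    have := norm_trace_pow_le (h z hz) k
    rwa [smul_pow, Matrix.trace_smul, smul_eq_mul] at this
  exact ⟨norm_le_one_of_norm_pow_add_pow_le key,
    norm_le_one_of_norm_pow_add_pow_le fun k => by rw [add_comm]; exact key k⟩

variable {φ χ : M2 → M2}

/-- The holomorphic curve `ζ ↦ ζ⁻¹ φ (ζ x)`, extended to `ζ = 0`. -/
def quotientCurve (φ : M2 → M2) (x : M2) : ℂ → M2 := dslope (fun ζ : ℂ => φ (ζ • x)) 0

lemma smul_quotientCurve (h0 : φ 0 = 0) (x : M2) (ζ : ℂ) :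
    ζ • quotientCurve φ x ζ = φ (ζ • x) := by
  have := sub_smul_dslope (fun ζ : ℂ => φ (ζ • x)) 0 ζ
  simp only [sub_zero, zero_smul, h0] at this
  exact this

lemma quotientCurve_zero (hφ : DifferentiableOn ℂ φ SpectralBall) (x : M2) :
    quotientCurve φ x 0 = fderiv ℂ φ 0 x := by
  have h1 := hasDerivAt_smul_comp_smul (φ := φ) (q := 0) (z := x) (by
    rw [zero_smul]; exact hφ.differentiableAt (isOpen_spectralBall.mem_nhds zero_mem_spectralBall))
  rw [zero_smul] at h1
  exact (dslope_same _ _).trans h1.deriv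

lemma differentiableOn_quotientCurve (hφ : DifferentiableOn ℂ φ SpectralBall) {x : M2}
    (hx : ∀ ζ ∈ ball (0 : ℂ) 1, ζ • x ∈ SpectralBall) :
    DifferentiableOn ℂ (quotientCurve φ x) (ball 0 1) := by
  refine (Complex.differentiableOn_dslope (isOpen_ball.mem_nhds (mem_ball_self one_pos))).2 ?_
  exact hφ.comp ((differentiable_id.smul_const x).differentiableOn) hx

lemma smul_mem_of_norm_eigenvalue_le {x : M2} {a b : ℂ} (ht : x.trace = a + b)
    (hd : x.det = a * b) (ha : ‖a‖ ≤ 1) (hb : ‖b‖ ≤ 1) {ζ : ℂ} (hζ : ζ ∈ ball (0 : ℂ) 1) :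
    ζ • x ∈ SpectralBall := by
  have hζ1 : ‖ζ‖ < 1 := by simpa using hζ
  refine (mem_spectralBall_iff (a := ζ * a) (b := ζ * b) ?_ ?_).2 ⟨?_, ?_⟩
  · rw [Matrix.trace_smul, ht, smul_eq_mul, mul_add]
  · rw [Matrix.det_smul, hd, Fintype.card_fin]; ring
  · rw [norm_mul]; nlinarith [norm_nonneg ζ, norm_nonneg a]
  · rw [norm_mul]; nlinarith [norm_nonneg ζ, norm_nonneg b]

lemma norm_eigenvalue_quotientCurve_le (hφ : DifferentiableOn ℂ φ SpectralBall)
    (mφ : MapsTo φ SpectralBall SpectralBall) (h0 : φ 0 = 0) {x : M2}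
    (hx : ∀ ζ ∈ ball (0 : ℂ) 1, ζ • x ∈ SpectralBall) {ζ : ℂ} (hζ : ζ ∈ ball (0 : ℂ) 1) {a b : ℂ}
    (ht : (quotientCurve φ x ζ).trace = a + b) (hd : (quotientCurve φ x ζ).det = a * b) :
    ‖a‖ ≤ 1 ∧ ‖b‖ ≤ 1 :=
  norm_eigenvalue_le_of_smul_mem (differentiableOn_quotientCurve hφ hx)
    (fun z hz => by rw [smul_quotientCurve h0]; exact mφ (hx z hz)) hζ ht hd

lemma IsInversePair.map_zero (h : IsInversePair φ χ) (h0 : φ 0 = 0) : χ 0 = 0 := by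
  have := h.right_left 0 zero_mem_spectralBall
  rwa [h0] at this

lemma IsInversePair.exists_fderiv_one (h : IsInversePair φ χ) (h0 : φ 0 = 0) :
    ∃ a : ℂ, ‖a‖ ≤ 1 ∧ fderiv ℂ φ 0 1 = a • (1 : M2) := by
  have hmem : ∀ ζ ∈ ball (0 : ℂ) 1, ζ • (1 : M2) ∈ SpectralBall := fun ζ hζ =>
    scalar_mem_spectralBall.2 (by simpa using hζ)
  have h1 : HasDerivAt (fun ζ : ℂ => φ (ζ • (1 : M2))) (fderiv ℂ φ 0 1) 0 := by
    have h1 := hasDerivAt_smul_comp_smul (φ := φ) (q := 0) (z := 1) (by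
      rw [zero_smul]; exact h.differentiableAt zero_mem_spectralBall)
    rwa [zero_smul] at h1
  have hent : ∀ i j, HasDerivAt (fun ζ : ℂ => φ (ζ • (1 : M2)) i j) (fderiv ℂ φ 0 1 i j) 0 :=
    fun i j => hasDerivAt_pi.1 (hasDerivAt_pi.1 h1 i) j
  have hev : ∀ᶠ ζ : ℂ in nhds 0, ζ ∈ ball (0 : ℂ) 1 :=
    isOpen_ball.mem_nhds (mem_ball_self one_pos)
  have hscal : ∀ ζ ∈ ball (0 : ℂ) 1, φ (ζ • (1 : M2)) = φ (ζ • (1 : M2)) 0 0 • (1 : M2) :=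
    fun ζ hζ => h.map_scalar (by simpa using hζ)
  have hij : ∀ i j, fderiv ℂ φ 0 1 i j = fderiv ℂ φ 0 1 0 0 * (1 : M2) i j := fun i j => by
    refine (hent i j).unique (((hent 0 0).mul_const ((1 : M2) i j)).congr_of_eventuallyEq ?_)
    filter_upwards [hev] with ζ hζ
    exact congrFun (congrFun (hscal ζ hζ) i) j
  refine ⟨fderiv ℂ φ 0 1 0 0, ?_, ?_⟩
  · rw [← (hent 0 0).deriv]
    refine Complex.norm_deriv_le_one_of_mapsTo_ball (R := 1) (fun ζ hζ => ?_) (fun ζ hζ => ?_)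
      one_pos
    · have h2 : DifferentiableOn ℂ (fun ζ : ℂ => φ (ζ • (1 : M2))) (ball 0 1) :=
        h.left_diff.comp ((differentiable_id.smul_const (1 : M2)).differentiableOn) hmem
      exact h2.entry 0 0 ζ hζ
    · have h3 := h.left_maps (hmem ζ hζ)
      rw [hscal ζ hζ, scalar_mem_spectralBall] at h3
      simp only [zero_smul, h0, Matrix.zero_apply, mem_closedBall_zero_iff]
      exact h3.le
  · ext i j
    rw [hij, Matrix.smul_apply, smul_eq_mul]

lemma IsInversePair.exists_fderiv_one_norm_eq (h : IsInversePair φ χ) (h0 : φ 0 = 0) :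
    ∃ a : ℂ, ‖a‖ = 1 ∧ fderiv ℂ φ 0 1 = a • (1 : M2) := by
  obtain ⟨a, ha, hL⟩ := h.exists_fderiv_one h0
  obtain ⟨b, hb, hL'⟩ := h.symm.exists_fderiv_one (h.map_zero h0)
  refine ⟨a, le_antisymm ha ?_, hL⟩
  have h1 := h.fderiv_fderiv zero_mem_spectralBall 1
  rw [h0, hL, ContinuousLinearMap.map_smul, hL', smul_smul] at h1
  have h2 : a * b = 1 := by simpa using congrFun (congrFun h1 0) 0
  have h3 : ‖a‖ * ‖b‖ = 1 := by rw [← norm_mul, h2, norm_one]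
  nlinarith [norm_nonneg a]

end Schwarz

/-! ### The derivative at the origin preserves trace and determinant -/

section DerivativeAtZero

open Metric

variable {φ χ : M2 → M2}

/-- The Pauli matrix `diag (1, -1)`. -/
def pauliZ : M2 := !![1, 0; 0, -1]

lemma trace_pauliZ : pauliZ.trace = 0 := by simp [pauliZ, Matrix.trace_fin_two]

lemma det_pauliZ : pauliZ.det = -1 := by simp [pauliZ, Matrix.det_fin_two]

lemma det_scalar_add_smul {y : M2} (hy : y.trace = 0) (c e : ℂ) :
    (c • (1 : M2) + e • y).det = c ^ 2 + e ^ 2 * y.det := by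
  rw [Matrix.trace_fin_two] at hy
  simp [Matrix.det_fin_two]
  linear_combination c * e * hy

lemma norm_det_fderiv_le (hφ : DifferentiableOn ℂ φ SpectralBall)
    (mφ : MapsTo φ SpectralBall SpectralBall) (h0 : φ 0 = 0) {x : M2}
    (hx : ∀ ζ ∈ ball (0 : ℂ) 1, ζ • x ∈ SpectralBall) : ‖(fderiv ℂ φ 0 x).det‖ ≤ 1 := by
  obtain ⟨a, b, ht, hd⟩ := exists_eigenvalues (quotientCurve φ x 0)
  obtain ⟨ha, hb⟩ := norm_eigenvalue_quotientCurve_le hφ mφ h0 hx (mem_ball_self one_pos) ht hd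
  rw [← quotientCurve_zero hφ, hd, norm_mul]
  exact mul_le_one₀ ha (norm_nonneg _) hb

lemma det_fderiv_nilpotent (hφ : DifferentiableOn ℂ φ SpectralBall)
    (mφ : MapsTo φ SpectralBall SpectralBall) (h0 : φ 0 = 0) {N : M2} (ht : N.trace = 0)
    (hd : N.det = 0) : (fderiv ℂ φ 0 N).det = 0 := by
  by_contra hne
  obtain ⟨c, hc⟩ := IsAlgClosed.exists_pow_nat_eq (2 / (fderiv ℂ φ 0 N).det) two_pos
  have h1 := norm_det_fderiv_le hφ mφ h0 (x := c • N) fun ζ _ => by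
    have := scalar_add_nilpotent_mem (c := 0) (N := ζ • c • N) (by simp)
      (by simp [Matrix.trace_smul, ht]) (by simp [hd])
    rwa [zero_smul, zero_add] at this
  rw [ContinuousLinearMap.map_smul, Matrix.det_smul, Fintype.card_fin, hc,
    div_mul_cancel₀ _ hne] at h1
  norm_num at h1

lemma det_eq_of_nilpotent {D : M2 →L[ℂ] M2}
    (h : ∀ N : M2, N.trace = 0 → N.det = 0 → (D N).det = 0) {y : M2} (hy : y.trace = 0) :
    (D y).det = -(D pauliZ).det * y.det := by
  have hs : ∀ u v w : ℂ, D (u • pauliZ + v • !![0, 1; 0, 0] + w • !![0, 0; 1, 0]) =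
      u • D pauliZ + v • D !![0, 1; 0, 0] + w • D !![0, 0; 1, 0] := fun u v w => by
    rw [map_add, map_add, ContinuousLinearMap.map_smul, ContinuousLinearMap.map_smul,
      ContinuousLinearMap.map_smul]
  have hn : ∀ u v w : ℂ, u ^ 2 + v * w = 0 →
      (u • D pauliZ + v • D !![0, 1; 0, 0] + w • D !![0, 0; 1, 0]).det = 0 := fun u v w huv => by
    rw [← hs]
    refine h _ (by simp [Matrix.trace_fin_two, pauliZ]) ?_
    simp [Matrix.det_fin_two, pauliZ]
    linear_combination -huv
  have hyd : y = y 0 0 • pauliZ + y 0 1 • !![0, 1; 0, 0] + y 1 0 • !![0, 0; 1, 0] := by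
    rw [Matrix.trace_fin_two] at hy
    ext i j
    fin_cases i <;> fin_cases j <;> simp [pauliZ]
    linear_combination hy
  have hDy := (congrArg D hyd).trans (hs _ _ _)
  rw [Matrix.trace_fin_two] at hy
  rw [hDy, Matrix.det_fin_two y]
  have n0 := hn 0 1 0 (by ring)
  have n0' := hn 0 0 1 (by ring)
  have n1 := hn 1 1 (-1) (by ring)
  have n2 := hn 1 (-1) 1 (by ring)
  have n3 := hn 1 Complex.I Complex.I (by linear_combination Complex.I_mul_I)
  obtain ⟨b, c, p, q, r, hexp⟩ : ∃ b c p q r : ℂ, ∀ u v w : ℂ,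
      (u • D pauliZ + v • D !![0, 1; 0, 0] + w • D !![0, 0; 1, 0]).det =
        u ^ 2 * (D pauliZ).det + v ^ 2 * b + w ^ 2 * c + u * v * p + u * w * q + v * w * r := by
    generalize D pauliZ = A
    generalize D !![0, 1; 0, 0] = P
    generalize D !![0, 0; 1, 0] = R
    refine ⟨P.det, R.det, A 0 0 * P 1 1 + P 0 0 * A 1 1 - A 0 1 * P 1 0 - P 0 1 * A 1 0,
      A 0 0 * R 1 1 + R 0 0 * A 1 1 - A 0 1 * R 1 0 - R 0 1 * A 1 0,
      P 0 0 * R 1 1 + R 0 0 * P 1 1 - P 0 1 * R 1 0 - R 0 1 * P 1 0, fun u v w => ?_⟩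
    simp only [Matrix.det_fin_two, Matrix.add_apply, Matrix.smul_apply, smul_eq_mul]
    ring
  rw [hexp] at n0 n0' n1 n2 n3 ⊢
  have hb : b = 0 := by linear_combination n0
  have hc : c = 0 := by linear_combination n0'
  subst hb hc
  have hr : r = (D pauliZ).det := by linear_combination -(n1 + n2) / 2
  have hpq : p = q := by linear_combination (n1 - n2) / 2
  have hp : Complex.I * (2 * p) = 0 := by
    linear_combination n3 + hr + Complex.I * hpq - r * Complex.I_mul_I
  have hp0 : p = 0 := by simpa [Complex.I_ne_zero] using hp
  rw [hr, ← hpq, hp0]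
  linear_combination (D pauliZ).det * y 0 0 * hy

lemma pauliZ_smul_mem {ζ : ℂ} (hζ : ζ ∈ ball (0 : ℂ) 1) : ζ • pauliZ ∈ SpectralBall :=
  smul_mem_of_norm_eigenvalue_le (a := 1) (b := -1) (by rw [trace_pauliZ]; ring)
    (by rw [det_pauliZ]; ring) (by simp) (by simp) hζ

lemma norm_det_fderiv_pauliZ_le (h : IsInversePair φ χ) (h0 : φ 0 = 0) :
    ‖(fderiv ℂ φ 0 pauliZ).det‖ ≤ 1 :=
  norm_det_fderiv_le h.left_diff h.left_maps h0 fun _ hζ => pauliZ_smul_mem hζ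

lemma trace_fderiv_zero (h : IsInversePair φ χ) (h1 : fderiv ℂ φ 0 1 = 1) (y : M2) :
    (fderiv ℂ φ 0 y).trace = y.trace := by
  have := trace_fderiv_scalar h.left_diff h.left_maps (c := 0) (by simp) y
  rw [zero_smul, h1, Matrix.trace_one, Fintype.card_fin] at this
  rw [this]; push_cast; ring

lemma fderiv_inverse_one (h : IsInversePair φ χ) (h0 : φ 0 = 0) (h1 : fderiv ℂ φ 0 1 = 1) :
    fderiv ℂ χ 0 1 = 1 := by
  have := h.fderiv_fderiv zero_mem_spectralBall 1
  rwa [h0, h1] at this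

lemma norm_det_fderiv_pauliZ (h : IsInversePair φ χ) (h0 : φ 0 = 0) (h1 : fderiv ℂ φ 0 1 = 1) :
    ‖(fderiv ℂ φ 0 pauliZ).det‖ = 1 := by
  refine le_antisymm (norm_det_fderiv_pauliZ_le h h0) ?_
  have h2 := norm_det_fderiv_pauliZ_le h.symm (h.map_zero h0)
  have h3 := det_eq_of_nilpotent (D := fderiv ℂ χ 0)
    (fun N ht hd => det_fderiv_nilpotent h.right_diff h.right_maps (h.map_zero h0) ht hd)
    (y := fderiv ℂ φ 0 pauliZ) (by rw [trace_fderiv_zero h h1, trace_pauliZ])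
  have h4 := h.fderiv_fderiv zero_mem_spectralBall pauliZ
  rw [h0] at h4
  rw [h4, det_pauliZ] at h3
  have h5 : ‖(fderiv ℂ χ 0 pauliZ).det‖ * ‖(fderiv ℂ φ 0 pauliZ).det‖ = 1 := by
    have := congrArg norm h3
    rw [norm_mul, norm_neg, norm_neg, norm_one] at this
    exact this.symm
  nlinarith [norm_nonneg (fderiv ℂ φ 0 pauliZ).det]

lemma eq_one_or_eq_neg_one_of_norm_le {e : ℂ} (he : ‖e‖ = 1)
    (h1 : ‖3 / 5 + 4 / 5 * Complex.I * e‖ ≤ 1) (h2 : ‖3 / 5 - 4 / 5 * Complex.I * e‖ ≤ 1) :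
    e ^ 2 = 1 := by
  have key : ∀ z : ℂ, ‖z‖ ^ 2 = z.re ^ 2 + z.im ^ 2 := fun z => by
    rw [← Complex.normSq_eq_norm_sq, Complex.normSq_apply]; ring
  have k0 := key e
  have k1 := key (3 / 5 + 4 / 5 * Complex.I * e)
  have k2 := key (3 / 5 - 4 / 5 * Complex.I * e)
  have e1 : (3 / 5 + 4 / 5 * Complex.I * e) = ⟨3 / 5 - 4 / 5 * e.im, 4 / 5 * e.re⟩ := by
    apply Complex.ext
    · simp; ring
    · simp
  have e2 : (3 / 5 - 4 / 5 * Complex.I * e) = ⟨3 / 5 + 4 / 5 * e.im, -(4 / 5 * e.re)⟩ := by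
    apply Complex.ext <;> simp
  have l1 := pow_le_one₀ (n := 2) (norm_nonneg _) h1
  have l2 := pow_le_one₀ (n := 2) (norm_nonneg _) h2
  rw [k1, e1] at l1
  rw [k2, e2] at l2
  rw [he] at k0
  simp only at l1 l2
  have him : e.im = 0 := by nlinarith
  have hre : e.re ^ 2 = 1 := by rw [him] at k0; linarith
  have : e = (e.re : ℂ) := Complex.ext rfl (by simpa using him)
  rw [this]
  exact_mod_cast hre

lemma det_fderiv_pauliZ (h : IsInversePair φ χ) (h0 : φ 0 = 0) (h1 : fderiv ℂ φ 0 1 = 1) :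
    (fderiv ℂ φ 0 pauliZ).det = -1 := by
  obtain ⟨e, he⟩ := IsAlgClosed.exists_pow_nat_eq (-(fderiv ℂ φ 0 pauliZ).det) two_pos
  have hen : ‖e‖ = 1 := by
    have := congrArg norm he
    rw [norm_pow, norm_neg, norm_det_fderiv_pauliZ h h0 h1] at this
    exact (pow_eq_one_iff_of_nonneg (norm_nonneg e) two_ne_zero).1 this
  have hU : ∀ s : ℝ, s ^ 2 = 1 → ‖3 / 5 + (s : ℂ) * (4 / 5 * Complex.I)‖ ≤ 1 := by
    intro s hs
    have e1 : 3 / 5 + (s : ℂ) * (4 / 5 * Complex.I) = ⟨3 / 5, 4 / 5 * s⟩ := by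
      apply Complex.ext
      · simp
      · simp [mul_comm]
    have hn : ‖3 / 5 + (s : ℂ) * (4 / 5 * Complex.I)‖ ^ 2 = 1 := by
      rw [e1, ← Complex.normSq_eq_norm_sq, Complex.normSq_apply]
      linear_combination (16 / 25) * hs
    exact ((pow_eq_one_iff_of_nonneg (norm_nonneg _) two_ne_zero).1 hn).le
  obtain ⟨ha, hb⟩ := norm_eigenvalue_quotientCurve_le h.left_diff h.left_maps h0
    (x := (3 / 5 : ℂ) • (1 : M2) + (4 / 5 * Complex.I) • pauliZ)
    (a := 3 / 5 + 4 / 5 * Complex.I * e) (b := 3 / 5 - 4 / 5 * Complex.I * e)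
    (fun ζ hζ => smul_mem_of_norm_eigenvalue_le
      (a := 3 / 5 + ((1 : ℝ) : ℂ) * (4 / 5 * Complex.I))
      (b := 3 / 5 + ((-1 : ℝ) : ℂ) * (4 / 5 * Complex.I))
      (by rw [Matrix.trace_add, Matrix.trace_smul, Matrix.trace_smul, trace_pauliZ,
            Matrix.trace_one, Fintype.card_fin, smul_eq_mul, smul_zero]; push_cast; ring)
      (by rw [det_scalar_add_smul trace_pauliZ, det_pauliZ]; push_cast; ring)
      (hU 1 (by norm_num)) (hU (-1) (by norm_num)) hζ) (mem_ball_self one_pos)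
    (by rw [quotientCurve_zero h.left_diff, trace_fderiv_zero h h1, Matrix.trace_add,
            Matrix.trace_smul, Matrix.trace_smul, trace_pauliZ,
            Matrix.trace_one, Fintype.card_fin, smul_eq_mul, smul_zero]; push_cast; ring)
    (by
      rw [quotientCurve_zero h.left_diff, map_add, ContinuousLinearMap.map_smul,
        ContinuousLinearMap.map_smul, h1, det_scalar_add_smul
          (by rw [trace_fderiv_zero h h1, trace_pauliZ])]
      linear_combination (4 / 5 * Complex.I) ^ 2 * he)
  have h2 := eq_one_or_eq_neg_one_of_norm_le hen ha hb
  linear_combination he - h2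

/-- The derivative at the origin of a normalised automorphism preserves the determinant. -/
lemma det_fderiv_zero (h : IsInversePair φ χ) (h0 : φ 0 = 0) (h1 : fderiv ℂ φ 0 1 = 1) (y : M2) :
    (fderiv ℂ φ 0 y).det = y.det := by
  have hy : y = (y.trace / 2) • (1 : M2) + (1 : ℂ) • (y - (y.trace / 2) • (1 : M2)) := by
    rw [one_smul]; abel
  have ht : (y - (y.trace / 2) • (1 : M2)).trace = 0 := by
    rw [Matrix.trace_sub, Matrix.trace_smul, Matrix.trace_one, Fintype.card_fin, smul_eq_mul]
    push_cast; ring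
  have hd := det_eq_of_nilpotent (D := fderiv ℂ φ 0)
    (fun N ht hd => det_fderiv_nilpotent h.left_diff h.left_maps h0 ht hd) ht
  rw [det_fderiv_pauliZ h h0 h1, neg_neg, one_mul] at hd
  set z := y - (y.trace / 2) • (1 : M2)
  rw [hy, map_add, ContinuousLinearMap.map_smul, ContinuousLinearMap.map_smul, h1,
    det_scalar_add_smul (by rw [trace_fderiv_zero h h1, ht]), det_scalar_add_smul ht, hd]

end DerivativeAtZero

/-! ### Normalised automorphisms preserve trace and determinant -/

section PreserveSpectrum

open Metric

variable {φ χ : M2 → M2}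

lemma eq_of_conj_eq_self {u : ℂ → ℂ} (hu : DifferentiableOn ℂ u (ball 0 1))
    (h : ∀ ζ ∈ ball (0 : ℂ) 1, starRingEnd ℂ (u ζ) = u ζ) : ∀ ζ ∈ ball (0 : ℂ) 1, u ζ = u 0 := by
  have hne : ∀ ζ ∈ ball (0 : ℂ) 1, u ζ + Complex.I ≠ 0 := fun ζ hζ h1 => by
    have h2 := congrArg (starRingEnd ℂ) h1
    rw [map_add, h ζ hζ, Complex.conj_I, map_zero] at h2
    exact Complex.I_ne_zero (by linear_combination (h1 - h2) / 2)
  have hn : ∀ ζ ∈ ball (0 : ℂ) 1, ‖(u ζ - Complex.I) / (u ζ + Complex.I)‖ = 1 := fun ζ hζ => by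
    have h1 : starRingEnd ℂ (u ζ + Complex.I) = u ζ - Complex.I := by
      rw [map_add, h ζ hζ, Complex.conj_I, sub_eq_add_neg]
    rw [norm_div, ← h1, Complex.norm_conj, div_self (norm_ne_zero_iff.2 (hne ζ hζ))]
  have h0 : (0 : ℂ) ∈ ball (0 : ℂ) 1 := mem_ball_self one_pos
  intro ζ hζ
  have h1 := Complex.eqOn_of_isPreconnected_of_isMaxOn_norm (convex_ball (0 : ℂ) 1).isPreconnected
    isOpen_ball (((hu.sub_const Complex.I).div (hu.add_const Complex.I)) hne) h0
    (fun z hz => ((hn z hz).trans (hn 0 h0).symm).le) hζ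
  simp only [Pi.div_apply, Function.const_apply] at h1
  rw [div_eq_div_iff (hne ζ hζ) (hne 0 h0)] at h1
  have h2 : Complex.I * (2 * (u ζ - u 0)) = 0 := by linear_combination h1
  have h3 : u ζ - u 0 = 0 := by simpa [Complex.I_ne_zero] using h2
  exact sub_eq_zero.1 h3

lemma eq_zero_of_eq_zero_on_sphere {u : ℂ → ℂ} (hu : DifferentiableOn ℂ u (ball 0 1)) {r : ℝ}
    (hr : 0 < r) (hr1 : r < 1) (h : ∀ ζ : ℂ, ‖ζ‖ = r → u ζ = 0) :
    ∀ ζ ∈ ball (0 : ℂ) 1, u ζ = 0 := by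
  have h1 : EqOn u (fun _ => 0) (ball 0 r) := by
    refine Complex.eqOn_of_eqOn_frontier isBounded_ball ?_ diffContOnCl_const ?_
    · refine DifferentiableOn.diffContOnCl (hu.mono ?_)
      rw [closure_ball (0 : ℂ) hr.ne']
      exact closedBall_subset_ball hr1
    · intro ζ hζ
      rw [frontier_ball (0 : ℂ) hr.ne'] at hζ
      exact h ζ (by simpa using hζ)
  refine (hu.analyticOnNhd isOpen_ball).eqOn_of_preconnected_of_eventuallyEq
    analyticOnNhd_const (convex_ball (0 : ℂ) 1).isPreconnected (mem_ball_self one_pos) ?_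
  filter_upwards [isOpen_ball.mem_nhds (mem_ball_self hr)] with z hz
  exact h1 hz

lemma eq_zero_at_zero {u : ℂ → ℂ} (hu : DifferentiableOn ℂ u (ball 0 1))
    (h : ∀ ζ ∈ ball (0 : ℂ) 1, ζ ≠ 0 → u ζ = 0) : u 0 = 0 := by
  have h0 : ball (0 : ℂ) 1 ∈ nhds 0 := isOpen_ball.mem_nhds (mem_ball_self one_pos)
  have h1 : Filter.Tendsto u (nhdsWithin 0 {0}ᶜ) (nhds (u 0)) :=
    (hu.continuousOn.continuousAt h0).mono_left inf_le_left
  refine tendsto_nhds_unique h1 (tendsto_const_nhds.congr' ?_)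
  filter_upwards [self_mem_nhdsWithin, mem_nhdsWithin_of_mem_nhds h0] with z hz hz'
  exact (h z hz' hz).symm

lemma mem_spectralBall_of_upper {a b c : ℂ} : !![a, c; 0, b] ∈ SpectralBall ↔ ‖a‖ < 1 ∧ ‖b‖ < 1 :=
  mem_spectralBall_iff (by simp [Matrix.trace_fin_two]) (by simp [Matrix.det_fin_two])

lemma mem_spectralBall_of_lower {a b c : ℂ} : !![a, 0; c, b] ∈ SpectralBall ↔ ‖a‖ < 1 ∧ ‖b‖ < 1 :=
  mem_spectralBall_iff (by simp [Matrix.trace_fin_two]) (by simp [Matrix.det_fin_two])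

/-- A holomorphic function on the spectral ball, constant along entire curves, vanishes as soon as
it vanishes at the diagonal matrices whose eigenvalues have the same nonzero modulus. -/
lemma eq_zero_of_eq_zero_on_diagonal {Q : M2 → ℂ} (hQ : DifferentiableOn ℂ Q SpectralBall)
    (hc : ∀ c : ℂ → M2, Differentiable ℂ c → (∀ t, c t ∈ SpectralBall) → ∀ s t, Q (c s) = Q (c t))
    (h : ∀ a b : ℂ, a ≠ 0 → ‖a‖ < 1 → ‖b‖ = ‖a‖ → Q !![a, 0; 0, b] = 0) :
    ∀ x ∈ SpectralBall, Q x = 0 := by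
  have hd1 : ∀ a : ℂ, ‖a‖ < 1 → DifferentiableOn ℂ (fun b : ℂ => Q !![a, 0; 0, b]) (ball 0 1) :=
    fun a ha => hQ.comp (differentiable_of_entry fun i j => by
      fin_cases i <;> fin_cases j <;> simp).differentiableOn
      fun b hb => mem_spectralBall_of_upper.2 ⟨ha, by simpa using hb⟩
  have hd2 : ∀ b : ℂ, ‖b‖ < 1 → DifferentiableOn ℂ (fun a : ℂ => Q !![a, 0; 0, b]) (ball 0 1) :=
    fun b hb => hQ.comp (differentiable_of_entry fun i j => by
      fin_cases i <;> fin_cases j <;> simp).differentiableOn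
      fun a ha => mem_spectralBall_of_upper.2 ⟨by simpa using ha, hb⟩
  have hne : ∀ a b : ℂ, a ≠ 0 → ‖a‖ < 1 → ‖b‖ < 1 → Q !![a, 0; 0, b] = 0 := fun a b h0 ha hb =>
    eq_zero_of_eq_zero_on_sphere (hd1 a ha) (norm_pos_iff.2 h0) ha (fun z hz => h a z h0 ha hz) b
      (by simpa using hb)
  have hdiag : ∀ a b : ℂ, ‖a‖ < 1 → ‖b‖ < 1 → Q !![a, 0; 0, b] = 0 := fun a b ha hb => by
    by_cases h0 : a = 0
    · rw [h0]
      exact eq_zero_at_zero (hd2 b hb) fun z hz hz0 => hne z b hz0 (by simpa using hz) hb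
    · exact hne a b h0 ha hb
  have hup : ∀ a b c : ℂ, !![a, c; 0, b] ∈ SpectralBall → Q !![a, c; 0, b] = 0 := by
    intro a b c hx
    have hx' := mem_spectralBall_of_upper.1 hx
    have := hc (fun z => !![a, z * c; 0, b]) (differentiable_of_entry fun i j => by
      fin_cases i <;> fin_cases j <;> simp) (fun z => mem_spectralBall_of_upper.2 hx') 1 0
    simp only [one_mul, zero_mul] at this
    rw [this, hdiag a b hx'.1 hx'.2]
  have hlow : ∀ a b c : ℂ, !![a, 0; c, b] ∈ SpectralBall → Q !![a, 0; c, b] = 0 := by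
    intro a b c hx
    have hx' := mem_spectralBall_of_lower.1 hx
    have := hc (fun z => !![a, 0; z * c, b]) (differentiable_of_entry fun i j => by
      fin_cases i <;> fin_cases j <;> simp) (fun z => mem_spectralBall_of_lower.2 hx') 1 0
    simp only [one_mul, zero_mul] at this
    rw [this, hdiag a b hx'.1 hx'.2]
  intro x hx
  by_cases h0 : x 0 1 = 0
  · have he : x = !![x 0 0, 0; x 1 0, x 1 1] := by
      rw [← h0]; exact Matrix.eta_fin_two x
    rw [he] at hx ⊢
    exact hlow _ _ _ hx
  · obtain ⟨s, hs⟩ := IsAlgClosed.exists_pow_nat_eq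
      ((x 0 0 - x 1 1) ^ 2 + 4 * x 0 1 * x 1 0) two_pos
    obtain ⟨z, hz⟩ : ∃ z, x 1 0 + z * (x 0 0 - x 1 1) - z ^ 2 * x 0 1 = 0 := by
      refine ⟨(x 0 0 - x 1 1 + s) / (2 * x 0 1), ?_⟩
      field_simp
      linear_combination -hs
    set c : ℂ → M2 := fun b => !![x 0 0 - b * x 0 1, x 0 1;
      x 1 0 + b * (x 0 0 - x 1 1) - b ^ 2 * x 0 1, x 1 1 + b * x 0 1] with hcdef
    have hcS : ∀ t, c t ∈ SpectralBall := fun t => by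
      refine (mem_spectralBall_congr (y := x) ?_ ?_).2 hx
      · simp [hcdef, Matrix.trace_fin_two]
      · simp [hcdef, Matrix.det_fin_two]; ring
    have h1 := hc c (differentiable_of_entry fun i j => by
      fin_cases i <;> fin_cases j <;> simp [hcdef]) hcS 0 z
    have hc0 : c 0 = x := by
      simp only [hcdef, zero_mul, sub_zero, add_zero, ne_eq, OfNat.ofNat_ne_zero,
        not_false_eq_true, zero_pow]
      exact (Matrix.eta_fin_two x).symm
    rw [hc0] at h1
    have h2 := hcS z
    rw [h1]
    simp only [hcdef, hz] at h2 ⊢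
    exact hup _ _ _ h2

lemma quotientCurve_trace_det (h : IsInversePair φ χ) (h0 : φ 0 = 0) (h1 : fderiv ℂ φ 0 1 = 1)
    {ω : ℂ} (hω : ‖ω‖ = 1) {ζ : ℂ} (hζ : ζ ∈ ball (0 : ℂ) 1) :
    (quotientCurve φ !![1, 0; 0, ω] ζ).trace = 1 + ω ∧
      (quotientCurve φ !![1, 0; 0, ω] ζ).det = ω := by
  set x : M2 := !![1, 0; 0, ω] with hx
  have htx : x.trace = 1 + ω := by simp [hx, Matrix.trace_fin_two]
  have hdx : x.det = 1 * ω := by simp [hx, Matrix.det_fin_two]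
  have hmem : ∀ ζ ∈ ball (0 : ℂ) 1, ζ • x ∈ SpectralBall := fun ζ hζ =>
    smul_mem_of_norm_eigenvalue_le htx hdx (by simp) hω.le hζ
  have hg := differentiableOn_quotientCurve h.left_diff hmem
  have h00 : (0 : ℂ) ∈ ball (0 : ℂ) 1 := mem_ball_self one_pos
  have hev : ∀ ζ ∈ ball (0 : ℂ) 1, ∃ a b : ℂ, (quotientCurve φ x ζ).trace = a + b ∧
      (quotientCurve φ x ζ).det = a * b ∧ ‖a‖ ≤ 1 ∧ ‖b‖ ≤ 1 := fun ζ hζ => by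
    obtain ⟨a, b, ht, hd⟩ := exists_eigenvalues (quotientCurve φ x ζ)
    exact ⟨a, b, ht, hd, norm_eigenvalue_quotientCurve_le h.left_diff h.left_maps h0 hmem hζ ht hd⟩
  have hd0 : (quotientCurve φ x 0).det = ω := by
    rw [quotientCurve_zero h.left_diff, det_fderiv_zero h h0 h1, hdx, one_mul]
  have ht0 : (quotientCurve φ x 0).trace = 1 + ω := by
    rw [quotientCurve_zero h.left_diff, trace_fderiv_zero h h1, htx]
  have hdet : ∀ ζ ∈ ball (0 : ℂ) 1, (quotientCurve φ x ζ).det = ω := fun ζ hζ => by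
    have := Complex.eqOn_of_isPreconnected_of_isMaxOn_norm
      (convex_ball (0 : ℂ) 1).isPreconnected isOpen_ball
      (differentiable_det.comp_differentiableOn hg) h00 (fun z hz => by
        obtain ⟨a, b, -, hd, ha, hb⟩ := hev z hz
        simp only [Function.comp_apply, mem_ofPred_eq]
        rw [hd, hd0, hω, norm_mul]
        exact mul_le_one₀ ha (norm_nonneg _) hb) hζ
    exact this.trans hd0
  refine ⟨?_, hdet ζ hζ⟩
  obtain ⟨u, hu⟩ := IsAlgClosed.exists_pow_nat_eq ω two_pos
  have hun : ‖u‖ = 1 := by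
    have := congrArg norm hu
    rw [norm_pow, hω] at this
    exact (pow_eq_one_iff_of_nonneg (norm_nonneg u) two_ne_zero).1 this
  have hcc : ∀ z : ℂ, ‖z‖ = 1 → starRingEnd ℂ z * z = 1 := fun z hz => by
    rw [mul_comm, Complex.mul_conj, Complex.normSq_eq_norm_sq, hz]; norm_num
  have hreal := eq_of_conj_eq_self
    (u := fun z => (quotientCurve φ x z).trace * starRingEnd ℂ u)
    ((differentiable_trace.comp_differentiableOn hg).mul_const _) (fun z hz => by
      obtain ⟨a, b, ht, hd, ha, hb⟩ := hev z hz
      have hab : a * b = ω := hd.symm.trans (hdet z hz)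
      have hn : ‖a‖ * ‖b‖ = 1 := by rw [← norm_mul, hab, hω]
      have ha1 : ‖a‖ = 1 := le_antisymm ha (by nlinarith [norm_nonneg a])
      have hb1 : ‖b‖ = 1 := le_antisymm hb (by nlinarith [norm_nonneg b])
      have ka := hcc a ha1
      have kb := hcc b hb1
      have ku := hcc u hun
      rw [ht, map_mul, map_add, Complex.conj_conj]
      generalize starRingEnd ℂ a = a' at *
      generalize starRingEnd ℂ b = b' at *
      generalize starRingEnd ℂ u = u' at *
      have e1 : u = u' * (a * b) := by rw [hab, ← hu]; linear_combination -u * ku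
      rw [e1]
      linear_combination u' * b * ka + u' * a * kb) ζ hζ
  have hu0 : starRingEnd ℂ u ≠ 0 := fun hz => by
    have := hcc u hun
    rw [hz, zero_mul] at this
    exact zero_ne_one this
  exact (mul_right_cancel₀ hu0 hreal).trans ht0

lemma trace_det_diagonal (h : IsInversePair φ χ) (h0 : φ 0 = 0) (h1 : fderiv ℂ φ 0 1 = 1)
    {a b : ℂ} (ha0 : a ≠ 0) (ha : ‖a‖ < 1) (hab : ‖b‖ = ‖a‖) :
    (φ !![a, 0; 0, b]).trace = (!![a, 0; 0, b] : M2).trace ∧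
      (φ !![a, 0; 0, b]).det = (!![a, 0; 0, b] : M2).det := by
  obtain ⟨ht, hd⟩ := quotientCurve_trace_det h h0 h1 (ω := b / a) (ζ := a)
    (by rw [norm_div, hab, div_self (norm_ne_zero_iff.2 ha0)]) (by simpa using ha)
  have e1 : a • (!![1, 0; 0, b / a] : M2) = !![a, 0; 0, b] := by
    ext i j
    fin_cases i <;> fin_cases j <;> simp
    field_simp
  have e2 := smul_quotientCurve h0 (!![1, 0; 0, b / a]) a
  rw [e1] at e2
  rw [← e2, Matrix.trace_smul, Matrix.det_smul, ht, hd, Fintype.card_fin]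
  constructor
  · simp [Matrix.trace_fin_two]; field_simp
  · simp [Matrix.det_fin_two]; field_simp

/-- Normalised automorphisms preserve trace and determinant. -/
lemma IsInversePair.trace_det_eq (h : IsInversePair φ χ) (h0 : φ 0 = 0)
    (h1 : fderiv ℂ φ 0 1 = 1) :
    ∀ x ∈ SpectralBall, (φ x).trace = x.trace ∧ (φ x).det = x.det := by
  have hid : ∀ c : ℂ → M2, Differentiable ℂ c → (∀ t, c t ∈ SpectralBall) → ∀ s t,
      (c s).trace = (c t).trace ∧ (c s).det = (c t).det := fun c hc hcS s t =>
    trace_eq_trace_of_entire (f := id) differentiableOn_id (mapsTo_id _) hc hcS s t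
  have hmap : ∀ c : ℂ → M2, Differentiable ℂ c → (∀ t, c t ∈ SpectralBall) → ∀ s t,
      (φ (c s)).trace = (φ (c t)).trace ∧ (φ (c s)).det = (φ (c t)).det := fun c hc hcS s t =>
    trace_eq_trace_of_entire h.left_diff h.left_maps hc hcS s t
  intro x hx
  constructor
  · refine sub_eq_zero.1 (eq_zero_of_eq_zero_on_diagonal
      (Q := fun x => (φ x).trace - x.trace) ?_ (fun c hc hcS s t => ?_)
      (fun a b ha0 ha hab => ?_) x hx)
    · exact (differentiable_trace.comp_differentiableOn h.left_diff).sub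
        differentiable_trace.differentiableOn
    · simp only [(hid c hc hcS s t).1, (hmap c hc hcS s t).1]
    · exact sub_eq_zero.2 (trace_det_diagonal h h0 h1 ha0 ha hab).1
  · refine sub_eq_zero.1 (eq_zero_of_eq_zero_on_diagonal
      (Q := fun x => (φ x).det - x.det) ?_ (fun c hc hcS s t => ?_)
      (fun a b ha0 ha hab => ?_) x hx)
    · exact (differentiable_det.comp_differentiableOn h.left_diff).sub
        differentiable_det.differentiableOn
    · simp only [(hid c hc hcS s t).2, (hmap c hc hcS s t).2]
    · exact sub_eq_zero.2 (trace_det_diagonal h h0 h1 ha0 ha hab).2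

end PreserveSpectrum

/-! ### Linear maps preserving trace and determinant -/

section LinearPreserver

lemma isGenerated_mul_mul {g g' : M2} (h : g * g' = 1) : IsGenerated (fun x => g * x * g') := by
  have hdet : g.det ≠ 0 := by
    intro h0
    have := congrArg Matrix.det h
    rw [Matrix.det_mul, h0, zero_mul, Matrix.det_one] at this
    exact zero_ne_one this
  have := isGenerated_conj hdet
  rwa [Matrix.inv_eq_right_inv h] at this

lemma exists_eq_mul_single_mul {N : M2} (ht : N.trace = 0) (hd : N.det = 0) (hN : N ≠ 0) :
    ∃ s s' : M2, s * s' = 1 ∧ s * !![0, 1; 0, 0] * s' = N := by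
  rw [Matrix.trace_fin_two] at ht
  rw [Matrix.det_fin_two] at hd
  have h11 : N 1 1 = -N 0 0 := by linear_combination ht
  rw [h11] at hd
  by_cases hr : N 1 0 = 0
  · have hp : N 0 0 = 0 := by
      have : N 0 0 ^ 2 = 0 := by linear_combination -hd - N 0 1 * hr
      exact pow_eq_zero_iff two_ne_zero |>.1 this
    have hq : N 0 1 ≠ 0 := fun hq => hN (by
      ext i j
      fin_cases i <;> fin_cases j <;> simp [hr, hp, hq, h11])
    refine ⟨!![N 0 1, 0; 0, 1], !![(N 0 1)⁻¹, 0; 0, 1], ?_, ?_⟩ <;> ext i j <;>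
      fin_cases i <;> fin_cases j <;> simp [Matrix.mul_apply, Fin.sum_univ_two, hr, hp, hq, h11]
  · refine ⟨!![N 0 0, 1; N 1 0, 0], !![0, (N 1 0)⁻¹; 1, -N 0 0 / N 1 0], ?_, ?_⟩ <;> ext i j <;>
      fin_cases i <;> fin_cases j <;> simp [Matrix.mul_apply, Fin.sum_univ_two, h11] <;> field_simp
    · ring
    · linear_combination hd

variable {L : M2 →ₗ[ℂ] M2}

/-- The bilinear form obtained by polarising the determinant. -/
def polarDet (x y : M2) : ℂ := x 0 0 * y 1 1 + y 0 0 * x 1 1 - x 0 1 * y 1 0 - y 0 1 * x 1 0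

lemma polarDet_map (hd : ∀ x, (L x).det = x.det) (x y : M2) :
    polarDet (L x) (L y) = polarDet x y := by
  have h : ∀ x y : M2, polarDet x y = (x + y).det - x.det - y.det := fun x y => by
    simp only [polarDet, Matrix.det_fin_two, Matrix.add_apply]; ring
  rw [h, h, ← map_add, hd, hd, hd]

lemma isGenerated_of_map_single (h1 : L 1 = 1) (ht : ∀ x, (L x).trace = x.trace)
    (hd : ∀ x, (L x).det = x.det) (hE : L !![0, 1; 0, 0] = !![0, 1; 0, 0]) : IsGenerated L := by
  have hy : ∀ y : M2, L y = (y.trace / 2) • (1 : M2) + ((y 0 0 - y 1 1) / 2) • L pauliZ +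
      y 0 1 • !![0, 1; 0, 0] + y 1 0 • L !![0, 0; 1, 0] := fun y => by
    have : y = (y.trace / 2) • (1 : M2) + ((y 0 0 - y 1 1) / 2) • pauliZ +
        y 0 1 • !![0, 1; 0, 0] + y 1 0 • !![0, 0; 1, 0] := by
      ext i j
      fin_cases i <;> fin_cases j <;> simp [pauliZ, Matrix.trace_fin_two] <;> ring
    conv_lhs => rw [this]
    rw [map_add, map_add, map_add, map_smul, map_smul, map_smul, map_smul, h1, hE]
  have tH := ht pauliZ
  have tF := ht !![0, 0; 1, 0]
  have dH := hd pauliZ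
  have dF := hd !![0, 0; 1, 0]
  have bHE := polarDet_map hd pauliZ !![0, 1; 0, 0]
  have bFE := polarDet_map hd !![0, 0; 1, 0] !![0, 1; 0, 0]
  have bHF := polarDet_map hd pauliZ !![0, 0; 1, 0]
  rw [hE] at bHE bFE
  rw [trace_pauliZ] at tH
  rw [det_pauliZ] at dH
  generalize L pauliZ = H at *
  generalize L !![0, 0; 1, 0] = F at *
  simp [polarDet, pauliZ] at bHE bFE bHF
  simp [Matrix.trace_fin_two] at tH tF
  simp [Matrix.det_fin_two] at dH dF
  have hH : H = !![H 0 0, H 0 1; 0, -H 0 0] := by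
    ext i j
    fin_cases i <;> fin_cases j <;> simp [bHE]
    linear_combination tH
  have hF : F = !![F 0 0, -F 0 0 ^ 2; 1, -F 0 0] := by
    ext i j
    fin_cases i <;> fin_cases j <;> simp [bFE]
    · linear_combination -dF + F 0 0 * tF - F 0 1 * bFE
    · linear_combination tF
  rw [hH, hF] at bHF
  simp at bHF
  have hu : (H 0 0 - 1) * (H 0 0 + 1) = 0 := by
    linear_combination -dH + H 0 0 * tH - H 0 1 * bHE
  set z := F 0 0
  have hz : !![1, z; 0, 1] * !![1, -z; 0, 1] = (1 : M2) := by
    ext i j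
    fin_cases i <;> fin_cases j <;> simp [Matrix.mul_apply, Fin.sum_univ_two]
  have hgen := isGenerated_mul_mul hz
  rcases mul_eq_zero.1 hu with hu | hu
  · have hu' : H 0 0 = 1 := by linear_combination hu
    rw [hu'] at bHF hH
    have hv : H 0 1 = -2 * z := by linear_combination -bHF
    rw [hv] at hH
    refine hgen.congr fun y _ => ?_
    rw [hy y, hH, hF]
    ext i j
    fin_cases i <;> fin_cases j <;>
      simp [Matrix.mul_apply, Matrix.vecMul, dotProduct, Fin.sum_univ_two,
        Matrix.trace_fin_two] <;> ring
  · have hu' : H 0 0 = -1 := by linear_combination hu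
    rw [hu'] at bHF hH
    have hv : H 0 1 = 2 * z := by linear_combination -bHF
    rw [hv] at hH
    have hJ : !![0, 1; 1, 0] * !![0, 1; 1, 0] = (1 : M2) := by
      ext i j
      fin_cases i <;> fin_cases j <;> simp [Matrix.mul_apply, Fin.sum_univ_two]
    refine (hgen.comp ((isGenerated_mul_mul hJ).comp isGenerated_transpose)).congr fun y _ => ?_
    rw [hy y, hH, hF]
    ext i j
    fin_cases i <;> fin_cases j <;>
      simp [Matrix.mul_apply, Matrix.vecMul, dotProduct, Fin.sum_univ_two,
        Matrix.trace_fin_two] <;> ring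

/-- Linear maps preserving the identity, the trace and the determinant are conjugations, up to
transposition. -/
lemma isGenerated_of_linear (h1 : L 1 = 1) (ht : ∀ x, (L x).trace = x.trace)
    (hd : ∀ x, (L x).det = x.det) : IsGenerated L := by
  have hN : L !![0, 1; 0, 0] ≠ 0 := fun h0 => by
    have := polarDet_map hd !![0, 1; 0, 0] !![0, 0; 1, 0]
    rw [h0] at this
    simp [polarDet] at this
  obtain ⟨s, s', hs, hsN⟩ := exists_eq_mul_single_mul (N := L !![0, 1; 0, 0])
    (by rw [ht]; simp [Matrix.trace_fin_two]) (by rw [hd]; simp [Matrix.det_fin_two]) hN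
  have hs' : s' * s = 1 := mul_eq_one_comm.1 hs
  have key : ∀ y : M2, (LinearMap.mulLeftRight ℂ (s', s) ∘ₗ L) y = s' * L y * s := fun y => by
    simp
  have hL' := isGenerated_of_map_single (L := LinearMap.mulLeftRight ℂ (s', s) ∘ₗ L)
    (by rw [key, h1, mul_one, hs'])
    (fun x => by rw [key, Matrix.trace_mul_comm, ← mul_assoc, hs, one_mul, ht])
    (fun x => by
      have := congrArg Matrix.det hs
      rw [Matrix.det_mul, Matrix.det_one] at this
      rw [key, Matrix.det_mul, Matrix.det_mul, hd]
      linear_combination x.det * this)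
    (by rw [key, ← hsN, ← mul_assoc, ← mul_assoc, hs', one_mul, mul_assoc, hs', mul_one])
  refine ((isGenerated_mul_mul hs).comp hL').congr fun y _ => ?_
  rw [Function.comp_apply, key, ← mul_assoc, ← mul_assoc, hs, one_mul, mul_assoc, hs, mul_one]

end LinearPreserver

/-! ### Approximation of automorphisms -/

section Main

open Metric

lemma IsAutomorphismOn.exists_isInversePair {φ : M2 → M2}
    (hφ : IsAutomorphismOn SpectralBall φ) : ∃ χ, IsInversePair φ χ := by
  obtain ⟨h1, h2, χ, h3, h4, h5, h6⟩ := hφ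
  exact ⟨χ, h1, h3, h2, h4, h5, h6⟩

lemma exists_norm_inv_smul_sub_le {χ : M2 → M2} (hχ : DifferentiableAt ℂ χ 0) (h0 : χ 0 = 0)
    {K : Set M2} (hK : IsCompact K) {δ : ℝ} (hδ : 0 < δ) :
    ∃ ε : ℝ, 0 < ε ∧ ε < 1 ∧
      ∀ x ∈ K, ‖(ε : ℂ)⁻¹ • χ ((ε : ℂ) • x) - fderiv ℂ χ 0 x‖ ≤ δ := by
  obtain ⟨R, hR⟩ := hK.isBounded.exists_norm_le
  have hlo := hasFDerivAt_iff_isLittleO_nhds_zero.1 hχ.hasFDerivAt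
  have hc : 0 < δ / (|R| + 1) := by positivity
  obtain ⟨ρ, hρ, H⟩ := Metric.eventually_nhds_iff.1 (hlo.def hc)
  set ε := min (1 / 2) (ρ / (2 * (|R| + 1))) with hε
  have hε0 : 0 < ε := by positivity
  have hεC : (ε : ℂ) ≠ 0 := by exact_mod_cast hε0.ne'
  have hεn : ‖(ε : ℂ)‖ = ε := by rw [Complex.norm_real, Real.norm_of_nonneg hε0.le]
  refine ⟨ε, hε0, (min_le_left _ _).trans_lt (by norm_num), fun x hx => ?_⟩
  have hxR : ‖x‖ ≤ |R| + 1 := by linarith [hR x hx, le_abs_self R]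
  have hn : ‖(ε : ℂ) • x‖ = ε * ‖x‖ := (norm_smul _ _).trans (by rw [hεn])
  have hsmall : ‖(ε : ℂ) • x‖ < ρ := by
    rw [hn]
    calc ε * ‖x‖ ≤ ρ / (2 * (|R| + 1)) * (|R| + 1) :=
          mul_le_mul (min_le_right _ _) hxR (norm_nonneg _) (by positivity)
      _ = ρ / 2 := by field_simp
      _ < ρ := by linarith
  have h2 : ‖χ ((ε : ℂ) • x) - (ε : ℂ) • fderiv ℂ χ 0 x‖ ≤ δ / (|R| + 1) * (ε * ‖x‖) := by
    have h := H (y := (ε : ℂ) • x) (by rw [dist_eq_norm, sub_zero]; exact hsmall)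
    rw [zero_add, h0, sub_zero, hn] at h
    rw [← ContinuousLinearMap.map_smul]
    exact h
  have h3 : (ε : ℂ)⁻¹ • χ ((ε : ℂ) • x) - fderiv ℂ χ 0 x =
      (ε : ℂ)⁻¹ • (χ ((ε : ℂ) • x) - (ε : ℂ) • fderiv ℂ χ 0 x) := by
    rw [smul_sub, smul_smul, inv_mul_cancel₀ hεC, one_smul]
  rw [h3]
  refine (norm_smul _ _).le.trans ?_
  rw [norm_inv, hεn]
  calc ε⁻¹ * _ ≤ ε⁻¹ * (δ / (|R| + 1) * (ε * ‖x‖)) := by gcongr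
    _ = δ / (|R| + 1) * ‖x‖ := by field_simp
    _ ≤ δ / (|R| + 1) * (|R| + 1) := by gcongr
    _ = δ := by field_simp

variable {φ χ : M2 → M2}

lemma IsInversePair.isApproximable_of_fderiv_one_eq (h : IsInversePair φ χ) (h0 : φ 0 = 0)
    (h1 : fderiv ℂ φ 0 1 = 1) : IsApproximable φ := by
  have h0' := h.map_zero h0
  have h1' := fderiv_inverse_one h h0 h1
  have hL : IsGenerated (fderiv ℂ φ 0) :=
    isGenerated_of_linear (L := (fderiv ℂ φ 0).toLinearMap) h1 (trace_fderiv_zero h h1)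
      (det_fderiv_zero h h0 h1)
  have hD : IsGenerated (fderiv ℂ χ 0) :=
    isGenerated_of_linear (L := (fderiv ℂ χ 0).toLinearMap) h1' (trace_fderiv_zero h.symm h1')
      (det_fderiv_zero h.symm h0' h1')
  have hDm := hD.isAutomorphismOn.2.1
  have hDc := hD.isAutomorphismOn.1.continuousOn
  have hφD : IsApproximable (fun x => φ (fderiv ℂ χ 0 x)) := by
    refine isApproximable_of_forall_exists fun K hKS hK η hη => ?_
    have hC : IsCompact (fderiv ℂ χ 0 '' K) := hK.image_of_continuousOn (hDc.mono hKS)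
    obtain ⟨δ, hδ, hsub⟩ := hC.exists_cthickening_subset_open isOpen_spectralBall
      (hDm.mono_left hKS).image_subset
    obtain ⟨δ₁, hδ₁, Hδ⟩ := Metric.uniformContinuousOn_iff.1
      (hC.cthickening.uniformContinuousOn_of_continuous (h.left_diff.continuousOn.mono hsub)) η hη
    obtain ⟨ε, hε, hε1, Hε⟩ := exists_norm_inv_smul_sub_le
      (h.symm.differentiableAt zero_mem_spectralBall) h0' hK (δ := min δ (δ₁ / 2)) (by positivity)
    refine ⟨_, isApproximable_rescale h.left_diff h.right_diff h.right_maps h.right_left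
      h.left_right (fun x hx => (h.trace_det_eq h0 h1 x hx).1)
      (fun x hx => (h.trace_det_eq h0 h1 x hx).2) hε hε1, fun x hx => ?_⟩
    have hmem : fderiv ℂ χ 0 x ∈ fderiv ℂ χ 0 '' K := ⟨x, hx, rfl⟩
    have h2 := Hε x hx
    have h3 := Hδ _ (mem_cthickening_of_dist_le _ _ δ _ hmem (by
      rw [dist_eq_norm]; exact h2.trans (min_le_left _ _))) _ (self_subset_cthickening _ hmem) (by
      rw [dist_eq_norm]; have := h2.trans (min_le_right _ _); linarith)
    rw [dist_eq_norm] at h3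
    exact h3.le
  refine (hφD.comp (h.left_diff.continuousOn.comp hDc hDm) hL.isApproximable
    hL.isAutomorphismOn.1.continuousOn hL.isAutomorphismOn.2.1).congr fun x _ => ?_
  have := h.fderiv_fderiv zero_mem_spectralBall x
  rw [h0] at this
  simp only [this]

lemma isApproximable_of_mobiusMap_comp {α γ : ℂ} (hα : ‖α‖ < 1) (hγ : ‖γ‖ = 1)
    (hφ : IsAutomorphismOn SpectralBall φ) (h : IsApproximable (MobiusMap α γ ∘ φ)) :
    IsApproximable φ := by
  have hα' : ‖-(α * γ)‖ < 1 := by rw [norm_neg, norm_mul, hγ, mul_one]; exact hα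
  have hγ' : ‖starRingEnd ℂ γ‖ = 1 := by simpa using hγ
  have hcomp := (isAutomorphismOn_mobiusMap hα hγ).comp hφ
  exact ((isGenerated_mobiusMap hα' hγ').isApproximable.comp
    (differentiableOn_mobiusMap hα').continuousOn h hcomp.1.continuousOn hcomp.2.1).congr
    fun x hx => (mobiusMap_inverse hα hγ (hφ.2.1 hx)).symm

lemma IsAutomorphismOn.isApproximable_of_map_zero (hφ : IsAutomorphismOn SpectralBall φ)
    (h0 : φ 0 = 0) : IsApproximable φ := by
  obtain ⟨χ, h⟩ := hφ.exists_isInversePair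
  obtain ⟨a, ha, h1⟩ := h.exists_fderiv_one_norm_eq h0
  have hγ : ‖starRingEnd ℂ a‖ = 1 := by simpa using ha
  have hz : ‖(0 : ℂ)‖ < 1 := by simp
  refine isApproximable_of_mobiusMap_comp hz hγ hφ ?_
  obtain ⟨χ', h'⟩ :=
    ((isAutomorphismOn_mobiusMap hz hγ).comp hφ).exists_isInversePair
  have hfun : MobiusMap 0 (starRingEnd ℂ a) ∘ φ = fun x => starRingEnd ℂ a • φ x := by
    funext x
    simp [MobiusMap]
  rw [hfun] at h' ⊢
  refine h'.isApproximable_of_fderiv_one_eq (by rw [h0, smul_zero]) ?_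
  have h2 : HasFDerivAt (fun x => starRingEnd ℂ a • φ x) (starRingEnd ℂ a • fderiv ℂ φ 0) 0 :=
    (h.differentiableAt zero_mem_spectralBall).hasFDerivAt.const_smul (starRingEnd ℂ a)
  rw [h2.fderiv]
  refine (congrArg (starRingEnd ℂ a • ·) h1).trans ?_
  have h3 : starRingEnd ℂ a * a = 1 := by
    rw [mul_comm, Complex.mul_conj, Complex.normSq_eq_norm_sq, ha]; norm_num
  simp only [smul_smul, h3, one_smul]

/-- Every automorphism of the spectral ball is a locally uniform limit of generated maps. -/
lemma IsAutomorphismOn.isApproximable (hφ : IsAutomorphismOn SpectralBall φ) :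
    IsApproximable φ := by
  obtain ⟨χ, h⟩ := hφ.exists_isInversePair
  have hs := h.map_scalar (c := 0) (by simp)
  rw [zero_smul] at hs
  have hα : ‖φ 0 0 0‖ < 1 := by
    have := h.left_maps zero_mem_spectralBall
    rw [hs] at this
    exact scalar_mem_spectralBall.1 this
  refine isApproximable_of_mobiusMap_comp hα norm_one hφ
    (((isAutomorphismOn_mobiusMap hα norm_one).comp hφ).isApproximable_of_map_zero ?_)
  rw [Function.comp_apply, MobiusMap, ← hs, sub_self, zero_mul, smul_zero]

end Main

/-- The group generated by the transposition, Möbius maps, and diagonal and triangular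
conjugations is dense in the group of automorphisms of the spectral ball (in the topology of
uniform convergence on compact sets). -/
theorem density_of_triangular_and_diagonal_conjugations
    (φ : M2 → M2) (hφ : IsAutomorphismOn SpectralBall φ) :
    ∃ φseq : ℕ → M2 → M2,
      (∀ k, IsAutomorphismOn SpectralBall (φseq k)) ∧
      (∀ k, ∃ L : List (M2 → M2), (∀ g ∈ L, IsGenerator g) ∧
        Set.EqOn (φseq k) (L.foldr (· ∘ ·) id) SpectralBall) ∧
      (∀ K : Set M2, K ⊆ SpectralBall → IsCompact K →
        TendstoUniformlyOn (fun k => φseq k) φ Filter.atTop K) := by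
  obtain ⟨g, hg, hlim⟩ := hφ.isApproximable.exists_seq
  exact ⟨g, fun k => (hg k).isAutomorphismOn, hg, hlim⟩
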